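/- Let f₀ ∈ L^∞(ℝ^d × ℝ^d) be a probability density with supp(f₀) ⊂ B_{R_x} × B_{R_v}, and let T > 0. Then there exists a unique family {f_t}_{t ∈ [0,T]} of bounded probability densities, weakly continuous in t, which is a weak solution of the topological Cucker–Smale equation ∂_t f_t + v·∇_x f_t + ∇_v·(W[Sf_t,f_t] f_t) = 0, i.e. f_t is the push-forward of f₀ along the flow (X_t,V_t) solving Ẋ_t = V_t, V̇_t = W[Sf_t,f_t](X_t,V_t). Moreover supp(f_t) ⊂ B_{R_x + tR_v} × B_{R_v} and ‖f_t‖_∞ ≤ ‖f₀‖_∞ e^{dγt} for all t ∈ [0,T]. -/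

import Mathlib

open MeasureTheory Metric Set

noncomputable section

/-- `M[ρ](x,r) = ∫_{|x'−x| ≤ r} ρ(x') dx'`. -/
def Mdens {d : ℕ} (ρ : EuclideanSpace ℝ (Fin d) → ℝ)
    (x : EuclideanSpace ℝ (Fin d)) (r : ℝ) : ℝ :=
  ∫ y in closedBall x r, ρ y

/-- The spatial marginal `Sf(x) = ∫ f(x,v) dv`. -/
def Smarg {d : ℕ} (f : EuclideanSpace ℝ (Fin d) × EuclideanSpace ℝ (Fin d) → ℝ)
    (x : EuclideanSpace ℝ (Fin d)) : ℝ :=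
  ∫ w, f (x, w)

/-- The interaction field
`W[ρ,f](x,v) = ∫ K(M[ρ](x,|x−y|)) (w−v) f(y,w) dy dw`. -/
def Wfield {d : ℕ} (K : ℝ → ℝ) (ρ : EuclideanSpace ℝ (Fin d) → ℝ)
    (f : EuclideanSpace ℝ (Fin d) × EuclideanSpace ℝ (Fin d) → ℝ)
    (x v : EuclideanSpace ℝ (Fin d)) : EuclideanSpace ℝ (Fin d) :=
  ∫ p : EuclideanSpace ℝ (Fin d) × EuclideanSpace ℝ (Fin d),
    (K (Mdens ρ x (dist x p.1)) * f p) • (p.2 - v)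

/-- A family `{f_t}_{t∈[0,T]}` of bounded probability densities, weakly continuous
in `t`, which is a weak solution of the topological Cucker–Smale equation with
initial datum `f₀`: `f_t` is the push-forward of `f₀` along the flow `(X_t,V_t)`
generated by the field `(v, W[Sf_t,f_t])`. -/
def IsWeakSolCS {d : ℕ} (K : ℝ → ℝ) (T : ℝ)
    (f₀ : EuclideanSpace ℝ (Fin d) × EuclideanSpace ℝ (Fin d) → ℝ)
    (f : ℝ → EuclideanSpace ℝ (Fin d) × EuclideanSpace ℝ (Fin d) → ℝ) : Prop :=
  (∀ t ∈ Set.Icc 0 T, Measurable (f t) ∧ (∀ p, 0 ≤ f t p) ∧ (∫ p, f t p) = 1) ∧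
  (∃ C : ℝ, ∀ t ∈ Set.Icc 0 T, ∀ᵐ p ∂volume, f t p ≤ C) ∧
  (∀ α : EuclideanSpace ℝ (Fin d) × EuclideanSpace ℝ (Fin d) → ℝ,
    Continuous α → (∃ C : ℝ, ∀ p, |α p| ≤ C) →
    ContinuousOn (fun t => ∫ p, α p * f t p) (Set.Icc 0 T)) ∧
  (∃ Z : ℝ → EuclideanSpace ℝ (Fin d) × EuclideanSpace ℝ (Fin d) →
      EuclideanSpace ℝ (Fin d) × EuclideanSpace ℝ (Fin d),
    (∀ p, Z 0 p = p) ∧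
    (∀ p, ∀ t ∈ Set.Icc 0 T,
      HasDerivWithinAt (fun τ => (Z τ p).1) ((Z t p).2) (Set.Icc 0 T) t ∧
      HasDerivWithinAt (fun τ => (Z τ p).2)
        (Wfield K (Smarg (f t)) (f t) (Z t p).1 (Z t p).2) (Set.Icc 0 T) t) ∧
    (∀ t ∈ Set.Icc 0 T,
      ∀ α : EuclideanSpace ℝ (Fin d) × EuclideanSpace ℝ (Fin d) → ℝ,
        Continuous α → (∃ C : ℝ, ∀ p, |α p| ≤ C) →
        (∫ p, α p * f t p) = ∫ p, α (Z t p) * f₀ p))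

section Kernel

variable {Ω E : Type*} [MeasurableSpace Ω] [NormedAddCommGroup E]

/-- The mass of the particles `X` within distance `r` of `x`. -/
def massIn (μ : Measure Ω) (X : Ω → E) (x : E) (r : ℝ) : ℝ :=
  μ.real {q | dist x (X q) ≤ r}

/-- The attraction felt at `x` from particles with positions `X` and velocities `U`. -/
def accel [NormedSpace ℝ E] (k : ℝ → ℝ) (μ : Measure Ω) (X U : Ω → E) (x : E) : E :=
  ∫ p, k (massIn μ X x (dist x (X p))) • U p ∂μ

/-- Rings centred in the ball of radius `R` have mass controlled by their width. -/
def RingBound (μ : Measure Ω) (X : Ω → E) (R c : ℝ) : Prop :=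
  ∀ x, ‖x‖ ≤ R → ∀ a b, a ≤ b →
    μ.real {q | a ≤ dist x (X q) ∧ dist x (X q) ≤ b} ≤ c * (b - a)

/-- A nonnegative bounded Lipschitz communication weight. -/
structure LipWeight (k : ℝ → ℝ) (L k₀ : ℝ) : Prop where
  nonneg : ∀ z, 0 ≤ k z
  le : ∀ z, k z ≤ k₀
  L_nonneg : 0 ≤ L
  lip : ∀ a b, |k a - k b| ≤ L * |a - b|

lemma LipWeight.continuous {k : ℝ → ℝ} {L k₀ : ℝ} (hk : LipWeight k L k₀) : Continuous k := by
  have : LipschitzWith ⟨L, hk.L_nonneg⟩ k := LipschitzWith.of_dist_le_mul fun a b => by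
    rw [Real.dist_eq, Real.dist_eq]
    exact hk.lip a b
  exact this.continuous

lemma LipWeight.k₀_nonneg {k : ℝ → ℝ} {L k₀ : ℝ} (hk : LipWeight k L k₀) : 0 ≤ k₀ :=
  (hk.nonneg 0).trans (hk.le 0)

variable {μ : Measure Ω} [IsProbabilityMeasure μ]

lemma massIn_mono (X : Ω → E) (x : E) : Monotone (massIn μ X x) := fun _ _ h =>
  measureReal_mono fun _ hq => le_trans hq h

omit [IsProbabilityMeasure μ] in
lemma massIn_nonneg (X : Ω → E) (x : E) (r : ℝ) : 0 ≤ massIn μ X x r := measureReal_nonneg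

lemma massIn_le_one (X : Ω → E) (x : E) (r : ℝ) : massIn μ X x r ≤ 1 := measureReal_le_one

lemma massIn_sub_le {X₁ X₂ : Ω → E} {R c δ η r₁ r₂ : ℝ} {x₁ x₂ : E}
    (hring : RingBound μ X₁ R c) (hx₁ : ‖x₁‖ ≤ R)
    (hX : ∀ᵐ q ∂μ, dist (X₁ q) (X₂ q) ≤ δ) (hx : dist x₁ x₂ + δ ≤ η) (hr : |r₁ - r₂| ≤ η) :
    |massIn μ X₁ x₁ r₁ - massIn μ X₂ x₂ r₂| ≤ c * (2 * η) := by
  have hη : 0 ≤ η := (abs_nonneg _).trans hr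
  have key : ∀ᵐ q ∂μ, |dist x₁ (X₁ q) - dist x₂ (X₂ q)| ≤ η := by
    filter_upwards [hX] with q hq
    have := dist_dist_dist_le x₁ (X₁ q) x₂ (X₂ q)
    rw [Real.dist_eq] at this
    linarith
  rw [abs_le] at hr
  have up : massIn μ X₂ x₂ r₂ ≤ massIn μ X₁ x₁ r₁ + c * (2 * η) := by
    have h1 : massIn μ X₂ x₂ r₂ ≤ μ.real ({q | dist x₁ (X₁ q) ≤ r₁} ∪
        {q | r₁ ≤ dist x₁ (X₁ q) ∧ dist x₁ (X₁ q) ≤ r₁ + 2 * η}) := by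
      refine ENNReal.toReal_mono (measure_ne_top _ _) (measure_mono_ae ?_)
      filter_upwards [key] with q hq h
      change dist x₂ (X₂ q) ≤ r₂ at h
      rw [abs_le] at hq
      rcases le_total (dist x₁ (X₁ q)) r₁ with h' | h'
      · exact Or.inl h'
      · exact Or.inr ⟨h', by linarith⟩
    refine h1.trans ((measureReal_union_le _ _).trans ?_)
    have := hring x₁ hx₁ r₁ (r₁ + 2 * η) (by linarith)
    unfold massIn
    rw [add_sub_cancel_left] at this
    linarith
  have low : massIn μ X₁ x₁ r₁ ≤ massIn μ X₂ x₂ r₂ + c * (2 * η) := by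
    have h1 : massIn μ X₁ x₁ r₁ ≤ μ.real ({q | dist x₁ (X₁ q) ≤ r₁ - 2 * η} ∪
        {q | r₁ - 2 * η ≤ dist x₁ (X₁ q) ∧ dist x₁ (X₁ q) ≤ r₁}) := by
      refine measureReal_mono fun q h => ?_
      rcases le_total (dist x₁ (X₁ q)) (r₁ - 2 * η) with h' | h'
      · exact Or.inl h'
      · exact Or.inr ⟨h', h⟩
    have h2 : μ.real {q | dist x₁ (X₁ q) ≤ r₁ - 2 * η} ≤ massIn μ X₂ x₂ r₂ := by
      refine ENNReal.toReal_mono (measure_ne_top _ _) (measure_mono_ae ?_)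
      filter_upwards [key] with q hq h
      change dist x₁ (X₁ q) ≤ r₁ - 2 * η at h
      rw [abs_le] at hq
      change dist x₂ (X₂ q) ≤ r₂
      linarith
    refine h1.trans ((measureReal_union_le _ _).trans ?_)
    have := hring x₁ hx₁ (r₁ - 2 * η) r₁ (by linarith)
    rw [sub_sub_cancel] at this
    linarith
  rw [abs_le]
  constructor <;> linarith

variable {k : ℝ → ℝ} {L k₀ : ℝ}

lemma aestronglyMeasurable_weight (hk : LipWeight k L k₀) {X : Ω → E}
    (hX : AEStronglyMeasurable X μ) (x : E) :
    AEStronglyMeasurable (fun p => k (massIn μ X x (dist x (X p)))) μ := by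
  have h1 : AEMeasurable (fun p => dist x (X p)) μ :=
    (aestronglyMeasurable_const.dist hX).aemeasurable
  exact (hk.continuous.measurable.comp_aemeasurable
    ((massIn_mono X x).measurable.comp_aemeasurable h1)).aestronglyMeasurable

variable [NormedSpace ℝ E]

lemma integrable_accel (hk : LipWeight k L k₀) {X U : Ω → E}
    (hX : AEStronglyMeasurable X μ) (hU : Integrable U μ) (x : E) :
    Integrable (fun p => k (massIn μ X x (dist x (X p))) • U p) μ := by
  refine (hU.norm.const_mul k₀).mono' ((aestronglyMeasurable_weight hk hX x).smul hU.1) ?_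
  refine Filter.Eventually.of_forall fun p => ?_
  rw [norm_smul, Real.norm_of_nonneg (hk.nonneg _)]
  exact mul_le_mul_of_nonneg_right (hk.le _) (norm_nonneg _)

lemma norm_accel_le_weight (hk : LipWeight k L k₀) {X U : Ω → E} {R : ℝ}
    (hX : AEStronglyMeasurable X μ) (hUR : ∀ᵐ p ∂μ, ‖U p‖ ≤ R) (x : E) :
    ‖accel k μ X U x‖ ≤ (∫ p, k (massIn μ X x (dist x (X p))) ∂μ) * R := by
  rw [← integral_mul_const]
  refine norm_integral_le_of_norm_le ?_ ?_
  · refine Integrable.mul_const ?_ _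
    refine Integrable.of_bound (aestronglyMeasurable_weight hk hX x) k₀
      (Filter.Eventually.of_forall fun p => ?_)
    rw [Real.norm_of_nonneg (hk.nonneg _)]
    exact hk.le _
  · filter_upwards [hUR] with p hp
    rw [norm_smul, Real.norm_of_nonneg (hk.nonneg _)]
    exact mul_le_mul_of_nonneg_left hp (hk.nonneg _)

lemma norm_accel_le (hk : LipWeight k L k₀) {X U : Ω → E} {R : ℝ}
    (hUR : ∀ᵐ p ∂μ, ‖U p‖ ≤ R) (x : E) : ‖accel k μ X U x‖ ≤ k₀ * R := by
  have := norm_integral_le_of_norm_le_const (μ := μ)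
    (f := fun p => k (massIn μ X x (dist x (X p))) • U p) (C := k₀ * R) ?_
  · simpa [accel] using this
  · filter_upwards [hUR] with p hp
    rw [norm_smul, Real.norm_of_nonneg (hk.nonneg _)]
    exact mul_le_mul (hk.le _) hp (norm_nonneg _) hk.k₀_nonneg

lemma accel_sub_le (hk : LipWeight k L k₀) {X₁ X₂ U₁ U₂ : Ω → E} {R R' c δ : ℝ} {x₁ x₂ : E}
    (hX₁ : AEStronglyMeasurable X₁ μ) (hX₂ : AEStronglyMeasurable X₂ μ)
    (hU₁ : AEStronglyMeasurable U₁ μ) (hU₂ : AEStronglyMeasurable U₂ μ)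
    (hring : RingBound μ X₁ R c) (hx₁ : ‖x₁‖ ≤ R) (hδ : 0 ≤ δ)
    (hX : ∀ᵐ q ∂μ, dist (X₁ q) (X₂ q) ≤ δ) (hU : ∀ᵐ q ∂μ, dist (U₁ q) (U₂ q) ≤ δ)
    (hUR : ∀ᵐ q ∂μ, ‖U₁ q‖ ≤ R') :
    dist (accel k μ X₁ U₁ x₁) (accel k μ X₂ U₂ x₂) ≤
      (L * (c * 2) * R' + k₀) * (dist x₁ x₂ + δ) := by
  set η := dist x₁ x₂ + δ with hη
  have hη0 : 0 ≤ η := by positivity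
  have hi₁ : Integrable U₁ μ := Integrable.of_bound hU₁ R' hUR
  have hi₂ : Integrable U₂ μ := by
    refine Integrable.of_bound hU₂ (R' + δ) ?_
    filter_upwards [hUR, hU] with q h1 h2
    have := norm_le_norm_add_norm_sub' (U₂ q) (U₁ q)
    rw [← dist_eq_norm, dist_comm] at this
    linarith
  unfold accel
  rw [dist_eq_norm,
    ← integral_sub (integrable_accel hk hX₁ hi₁ x₁) (integrable_accel hk hX₂ hi₂ x₂)]
  have := norm_integral_le_of_norm_le_const (μ := μ)
    (f := fun p => k (massIn μ X₁ x₁ (dist x₁ (X₁ p))) • U₁ p -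
      k (massIn μ X₂ x₂ (dist x₂ (X₂ p))) • U₂ p) (C := (L * (c * 2) * R' + k₀) * η) ?_
  · simpa using this
  filter_upwards [hX, hU, hUR] with p h1 h2 h3
  set a := massIn μ X₁ x₁ (dist x₁ (X₁ p))
  set b := massIn μ X₂ x₂ (dist x₂ (X₂ p))
  have hab : |a - b| ≤ c * (2 * η) := by
    refine massIn_sub_le hring hx₁ hX hη.ge ?_
    have := dist_dist_dist_le x₁ (X₁ p) x₂ (X₂ p)
    rw [Real.dist_eq] at this
    linarith
  have e : k a • U₁ p - k b • U₂ p = (k a - k b) • U₁ p + k b • (U₁ p - U₂ p) := by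
    rw [sub_smul, smul_sub]; abel
  rw [e]
  have n1 : ‖(k a - k b) • U₁ p‖ ≤ L * (c * (2 * η)) * R' := by
    rw [norm_smul, Real.norm_eq_abs]
    have : |k a - k b| ≤ L * (c * (2 * η)) :=
      (hk.lip a b).trans (mul_le_mul_of_nonneg_left hab hk.L_nonneg)
    exact mul_le_mul this h3 (norm_nonneg _) ((abs_nonneg _).trans this)
  have n2 : ‖k b • (U₁ p - U₂ p)‖ ≤ k₀ * η := by
    rw [norm_smul, Real.norm_of_nonneg (hk.nonneg _), ← dist_eq_norm]
    refine mul_le_mul (hk.le _) (h2.trans ?_) dist_nonneg hk.k₀_nonneg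
    simp [hη]
  calc _ ≤ _ := norm_add_le _ _
    _ ≤ L * (c * (2 * η)) * R' + k₀ * η := add_le_add n1 n2
    _ = _ := by ring

end Kernel

section ProbabilityIntegralTransform

open ProbabilityTheory

lemma continuous_cdf_of_noAtoms (ν : Measure ℝ) [IsProbabilityMeasure ν] [NullSingletonClass ν] :
    Continuous (cdf ν) := by
  rw [continuous_iff_continuousAt]
  intro a
  rw [(monotone_cdf ν).continuousAt_iff_leftLim_eq_rightLim, (cdf ν).rightLim_eq]
  have h := (cdf ν).measure_singleton a
  rw [measure_cdf, measure_singleton, eq_comm, ENNReal.ofReal_eq_zero] at h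
  exact le_antisymm ((monotone_cdf ν).leftLim_le le_rfl) (by linarith)

lemma map_cdf_of_noAtoms (ν : Measure ℝ) [IsProbabilityMeasure ν] [NullSingletonClass ν] :
    ν.map (cdf ν) = volume.restrict (Icc 0 1) := by
  have hc := continuous_cdf_of_noAtoms ν
  have hm : Measurable (cdf ν) := hc.measurable
  have : IsProbabilityMeasure (ν.map (cdf ν)) := Measure.isProbabilityMeasure_map hm.aemeasurable
  refine Measure.ext_of_Iic _ _ fun s => ?_
  rw [Measure.map_apply hm measurableSet_Iic, Measure.restrict_apply measurableSet_Iic]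
  rcases lt_or_ge s 0 with hs | hs
  · have h1 : cdf ν ⁻¹' Iic s = ∅ := by
      ext r; simp only [mem_preimage, mem_Iic, mem_empty_iff_false, iff_false, not_le]
      exact hs.trans_le (cdf_nonneg ν r)
    have h2 : Iic s ∩ Icc (0 : ℝ) 1 = ∅ := by
      ext r; simp only [mem_inter_iff, mem_Iic, mem_Icc, mem_empty_iff_false, iff_false]
      intro h; linarith [h.1, h.2.1]
    rw [h1, h2, measure_empty, measure_empty]
  rcases le_or_gt 1 s with hs1 | hs1
  · have h1 : cdf ν ⁻¹' Iic s = univ := by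
      ext r; simp only [mem_preimage, mem_Iic, mem_univ, iff_true]
      exact (cdf_le_one ν r).trans hs1
    have h2 : Iic s ∩ Icc (0 : ℝ) 1 = Icc 0 1 := inter_eq_right.2 fun r hr => hr.2.trans hs1
    rw [h1, h2, measure_univ]; simp
  have h2 : Iic s ∩ Icc (0 : ℝ) 1 = Icc 0 s := by
    ext r; simp only [mem_inter_iff, mem_Iic, mem_Icc]
    constructor
    · intro h; exact ⟨h.2.1, h.1⟩
    · intro h; exact ⟨h.2, h.1, h.2.trans hs1.le⟩
  rw [h2, Real.volume_Icc, sub_zero]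
  obtain ⟨b, hb⟩ : ∃ b, s < cdf ν b := by
    have := (tendsto_cdf_atTop ν).eventually (lt_mem_nhds hs1)
    exact this.exists
  have hub : ∀ r ∈ cdf ν ⁻¹' Iic s, r ≤ b := fun r hr => by
    by_contra h
    have := monotone_cdf ν (not_le.1 h).le
    exact absurd (hb.trans_le this) (not_lt.2 hr)
  rcases (cdf ν ⁻¹' Iic s).eq_empty_or_nonempty with he | hne
  · have : s ≤ 0 := by
      refine ge_of_tendsto' (tendsto_cdf_atBot ν) fun r => ?_
      by_contra h
      have : r ∈ cdf ν ⁻¹' Iic s := (not_le.1 h).le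
      rw [he] at this; exact this
    rw [he, measure_empty, ENNReal.ofReal_eq_zero.2 this]
  · have hbdd : BddAbove (cdf ν ⁻¹' Iic s) := ⟨b, hub⟩
    have hmem : sSup (cdf ν ⁻¹' Iic s) ∈ cdf ν ⁻¹' Iic s :=
      (isClosed_Iic.preimage hc).csSup_mem hne hbdd
    obtain ⟨a, ha⟩ := hne
    obtain ⟨r, hr⟩ := mem_range_of_exists_le_of_exists_ge hc ⟨a, ha⟩ ⟨b, hb.le⟩
    have hrle : r ≤ sSup (cdf ν ⁻¹' Iic s) := le_csSup hbdd (show cdf ν r ≤ s from hr.le)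
    have hval : cdf ν (sSup (cdf ν ⁻¹' Iic s)) = s :=
      le_antisymm hmem (hr.ge.trans (monotone_cdf ν hrle))
    have hset : cdf ν ⁻¹' Iic s = Iic (sSup (cdf ν ⁻¹' Iic s)) := by
      ext t
      exact ⟨fun h => le_csSup hbdd h, fun h => (monotone_cdf ν h).trans hmem⟩
    rw [hset, ← ofReal_cdf, hval]

variable {Ω : Type*} [MeasurableSpace Ω] {μ : Measure Ω} [IsProbabilityMeasure μ]

lemma integral_comp_rank {Y : Ω → ℝ} (hY : AEMeasurable Y μ) (hna : ∀ r, μ {p | Y p = r} = 0)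
    {k : ℝ → ℝ} (hk : Continuous k) :
    ∫ p, k (μ.real {q | Y q ≤ Y p}) ∂μ = ∫ z in (0 : ℝ)..1, k z := by
  have : IsProbabilityMeasure (μ.map Y) := Measure.isProbabilityMeasure_map hY
  have : NullSingletonClass (μ.map Y) := ⟨fun r => by
    rw [Measure.map_apply_of_aemeasurable hY (measurableSet_singleton r)]
    exact hna r⟩
  have hc := continuous_cdf_of_noAtoms (μ.map Y)
  have h1 : ∀ r, μ.real {q | Y q ≤ r} = cdf (μ.map Y) r := fun r => by
    rw [cdf_eq_real, Measure.real, Measure.real,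
      Measure.map_apply_of_aemeasurable hY measurableSet_Iic]
    rfl
  simp_rw [h1]
  rw [← integral_map (f := fun r => k (cdf (μ.map Y) r)) hY
    (hk.comp hc).measurable.aestronglyMeasurable,
    ← integral_map (f := k) hc.measurable.aemeasurable hk.measurable.aestronglyMeasurable,
    map_cdf_of_noAtoms, intervalIntegral.integral_of_le zero_le_one, integral_Icc_eq_integral_Ioc]

end ProbabilityIntegralTransform

section Ring

open Module

variable {E : Type*} [NormedAddCommGroup E] [InnerProductSpace ℝ E] [FiniteDimensional ℝ E]
  [MeasurableSpace E] [BorelSpace E] [Nontrivial E]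
variable {Ω : Type*} [MeasurableSpace Ω] {μ : Measure Ω} [IsProbabilityMeasure μ]

lemma volume_real_ring_le {Q a b : ℝ} (ha : 0 ≤ a) (hab : a ≤ b) (hb : b ≤ Q)
    (x : E) :
    volume.real (closedBall x b \ ball x a) ≤
      finrank ℝ E * Q ^ (finrank ℝ E - 1) * volume.real (ball (0 : E) 1) * (b - a) := by
  rw [measureReal_sdiff ((ball_subset_closedBall).trans (closedBall_subset_closedBall hab))
    measurableSet_ball measure_closedBall_lt_top.ne,
    Measure.addHaar_real_closedBall _ _ (ha.trans hab), show (volume : Measure E).real (ball x a) =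
      a ^ finrank ℝ E * volume.real (ball (0 : E) 1) from by
      rw [Measure.real, Measure.addHaar_ball _ _ ha, ENNReal.toReal_mul,
        ENNReal.toReal_ofReal (by positivity)]; rfl, ← sub_mul]
  have h := abs_pow_sub_pow_le b a (finrank ℝ E)
  rw [abs_of_nonneg (sub_nonneg.2 hab), abs_of_nonneg ha, abs_of_nonneg (ha.trans hab),
    max_eq_left hab] at h
  have h3 : b ^ (finrank ℝ E - 1) ≤ Q ^ (finrank ℝ E - 1) :=
    pow_le_pow_left₀ (ha.trans hab) hb _
  have h2 : b ^ finrank ℝ E - a ^ finrank ℝ E ≤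
      (b - a) * finrank ℝ E * Q ^ (finrank ℝ E - 1) := by
    refine (le_abs_self _).trans (h.trans ?_)
    have : 0 ≤ b - a := sub_nonneg.2 hab
    gcongr
  calc _ ≤ (b - a) * finrank ℝ E * Q ^ (finrank ℝ E - 1) * volume.real (ball (0 : E) 1) :=
        mul_le_mul_of_nonneg_right h2 measureReal_nonneg
    _ = _ := by ring

omit [IsProbabilityMeasure μ] in
variable (E μ) in
lemma exists_ringBound (C : NNReal) {R R' : ℝ} (hR : 0 ≤ R) (hR' : 0 ≤ R') :
    ∃ c, 0 ≤ c ∧ ∀ X : Ω → E, (∀ S, MeasurableSet S → μ (X ⁻¹' S) ≤ C * volume S) →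
      (∀ᵐ p ∂μ, ‖X p‖ ≤ R) → RingBound μ X R' c := by
  refine ⟨C * (finrank ℝ E * (R + R') ^ (finrank ℝ E - 1) * volume.real (ball (0 : E) 1)),
    by positivity, fun X hlaw hX x hx a b hab => ?_⟩
  have hdist : ∀ᵐ p ∂μ, dist x (X p) ≤ R + R' := by
    filter_upwards [hX] with p hp
    rw [dist_eq_norm]
    exact (norm_sub_le _ _).trans (by linarith)
  set c := (finrank ℝ E * (R + R') ^ (finrank ℝ E - 1) * volume.real (ball (0 : E) 1)) with hc
  have hc0 : 0 ≤ c := by positivity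
  by_cases h : a ≤ R + R' ∧ 0 ≤ b
  · have hab' : max a 0 ≤ min b (R + R') :=
      max_le (le_min hab h.1) (le_min h.2 (by linarith))
    have h1 : μ {q | a ≤ dist x (X q) ∧ dist x (X q) ≤ b} ≤
        μ (X ⁻¹' (closedBall x (min b (R + R')) \ ball x (max a 0))) := by
      refine measure_mono_ae ?_
      filter_upwards [hdist] with p hp hq
      change a ≤ dist x (X p) ∧ dist x (X p) ≤ b at hq
      change X p ∈ closedBall x (min b (R + R')) \ ball x (max a 0)
      rw [mem_sdiff, mem_closedBall, mem_ball, dist_comm, not_lt]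
      exact ⟨le_min hq.2 hp, max_le hq.1 dist_nonneg⟩
    have h2 := h1.trans (hlaw _ (measurableSet_closedBall.diff measurableSet_ball))
    have h3 : μ.real {q | a ≤ dist x (X q) ∧ dist x (X q) ≤ b} ≤
        C * volume.real (closedBall x (min b (R + R')) \ ball x (max a 0)) := by
      refine (ENNReal.toReal_mono ?_ h2).trans ?_
      · exact ENNReal.mul_ne_top ENNReal.coe_ne_top
          (ne_top_of_le_ne_top measure_closedBall_lt_top.ne (measure_mono sdiff_subset))
      · rw [ENNReal.toReal_mul]; rfl
    have h4 := volume_real_ring_le (le_max_right a 0) hab' (min_le_right b (R + R')) x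
    rw [← hc] at h4
    refine h3.trans ?_
    rw [mul_assoc]
    refine mul_le_mul_of_nonneg_left (h4.trans ?_) C.2
    refine mul_le_mul_of_nonneg_left ?_ hc0
    linarith [min_le_left b (R + R'), le_max_left a 0]
  · have h0 : μ {q | a ≤ dist x (X q) ∧ dist x (X q) ≤ b} = 0 := by
      rw [← nonpos_iff_eq_zero, ← measure_empty (μ := μ)]
      refine measure_mono_ae ?_
      filter_upwards [hdist] with p hp hq
      change a ≤ dist x (X p) ∧ dist x (X p) ≤ b at hq
      exact h ⟨hq.1.trans hp, dist_nonneg.trans hq.2⟩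
    rw [Measure.real, h0, ENNReal.toReal_zero]
    exact mul_nonneg (mul_nonneg C.2 hc0) (sub_nonneg.2 hab)

lemma integral_weight {X : Ω → E} (hX : AEStronglyMeasurable X μ)
    (hlaw : ∀ S, volume S = 0 → μ (X ⁻¹' S) = 0) {k : ℝ → ℝ} (hk : Continuous k) (x : E) :
    ∫ p, k (massIn μ X x (dist x (X p))) ∂μ = ∫ z in (0 : ℝ)..1, k z := by
  refine integral_comp_rank (Y := fun p => dist x (X p))
    (aestronglyMeasurable_const.dist hX).aemeasurable (fun r => ?_) hk
  have h : {p | dist x (X p) = r} = X ⁻¹' sphere x r := by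
    ext p
    rw [mem_ofPred_eq, mem_preimage, mem_sphere, dist_comm]
  rw [h]
  exact hlaw (sphere x r) (Measure.addHaar_sphere _ x r)

end Ring

section Stability

variable {E : Type*} [NormedAddCommGroup E] [NormedSpace ℝ E] [MeasurableSpace E]

/-- `(X, U)` solves `X' = exp (-γ t) U`, `U' = accel k μ X U (X)` on `[0, T]`, started at the points
of `S` and in integrated form, up to the error `δ`, and remains in the ball of radius `R`. -/
structure IsApproxSol (k : ℝ → ℝ) (γ T : ℝ) (μ : Measure (E × E)) (X U : ℝ → E × E → E)
    (S : Set (E × E)) (R δ : ℝ) : Prop where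
  meas_X : ∀ t ∈ Icc 0 T, AEStronglyMeasurable (X t) μ
  meas_U : ∀ t ∈ Icc 0 T, AEStronglyMeasurable (U t) μ
  norm_X : ∀ t ∈ Icc 0 T, ∀ p ∈ S, ‖X t p‖ ≤ R
  norm_U : ∀ t ∈ Icc 0 T, ∀ p ∈ S, ‖U t p‖ ≤ R
  intble_U : ∀ p ∈ S, IntervalIntegrable (fun s => Real.exp (-(γ * s)) • U s p) volume 0 T
  intble_accel : ∀ p ∈ S,
    IntervalIntegrable (fun s => accel k μ (X s) (U s) (X s p)) volume 0 T
  eq_X : ∀ p ∈ S, ∀ t ∈ Icc 0 T,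
    dist (X t p) (p.1 + ∫ s in (0 : ℝ)..t, Real.exp (-(γ * s)) • U s p) ≤ δ
  eq_U : ∀ p ∈ S, ∀ t ∈ Icc 0 T,
    dist (U t p) (p.2 + ∫ s in (0 : ℝ)..t, accel k μ (X s) (U s) (X s p)) ≤ δ

omit [MeasurableSpace E] in
lemma dist_add_integral_le {f₁ f₂ : ℝ → E} {a : E} {T t M l A : ℝ} (ht : t ∈ Icc 0 T)
    (h₁ : IntervalIntegrable f₁ volume 0 T) (h₂ : IntervalIntegrable f₂ volume 0 T)
    (hM : 0 ≤ M) (hAl : 2 * A ≤ l)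
    (h : ∀ s ∈ Icc 0 T, dist (f₁ s) (f₂ s) ≤ A * (M * Real.exp (l * s))) :
    dist (a + ∫ s in (0 : ℝ)..t, f₁ s) (a + ∫ s in (0 : ℝ)..t, f₂ s) ≤
      M / 2 * Real.exp (l * t) := by
  have hsub : uIcc 0 t ⊆ uIcc 0 T := by
    rw [uIcc_of_le ht.1, uIcc_of_le (ht.1.trans ht.2)]
    exact Icc_subset_Icc_right ht.2
  rw [dist_add_left, dist_eq_norm,
    ← intervalIntegral.integral_sub (h₁.mono_set hsub) (h₂.mono_set hsub)]
  have hb : ∀ s ∈ Ioc 0 t, ‖f₁ s - f₂ s‖ ≤ M / 2 * (l * Real.exp (l * s)) := fun s hs => by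
    rw [← dist_eq_norm]
    refine (h s ⟨hs.1.le, hs.2.trans ht.2⟩).trans ?_
    have : 0 ≤ M * Real.exp (l * s) := by positivity
    nlinarith
  have hder : ∀ s ∈ uIcc 0 t, HasDerivAt (fun s => Real.exp (l * s)) (l * Real.exp (l * s)) s :=
    fun s _ => by
      have := ((hasDerivAt_id s).const_mul l).exp
      simpa [mul_comm] using this
  have hint : ∫ s in (0 : ℝ)..t, M / 2 * (l * Real.exp (l * s)) =
      M / 2 * (Real.exp (l * t) - 1) := by
    rw [intervalIntegral.integral_const_mul, intervalIntegral.integral_eq_sub_of_hasDerivAt hder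
      (by apply Continuous.intervalIntegrable; fun_prop)]
    simp
  refine (intervalIntegral.norm_integral_le_of_norm_le ht.1
    (Filter.Eventually.of_forall hb) (by apply Continuous.intervalIntegrable; fun_prop)).trans ?_
  rw [hint]
  nlinarith

variable {k : ℝ → ℝ} {L k₀ γ T : ℝ} {μ : Measure (E × E)} [IsProbabilityMeasure μ]
  {X₁ U₁ X₂ U₂ : ℝ → E × E → E} {S : Set (E × E)} {R δ₁ δ₂ c : ℝ}

lemma IsApproxSol.dist_le (hk : LipWeight k L k₀) (hγ : 0 ≤ γ)
    (h₁ : IsApproxSol k γ T μ X₁ U₁ S R δ₁) (h₂ : IsApproxSol k γ T μ X₂ U₂ S R δ₂)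
    (hS : ∀ᵐ p ∂μ, p ∈ S) (hc : 0 ≤ c) (hring : ∀ t ∈ Icc 0 T, RingBound μ (X₁ t) R c)
    {t : ℝ} (ht : t ∈ Icc 0 T) {p : E × E} (hp : p ∈ S) :
    dist (X₁ t p) (X₂ t p) ≤
        2 * (δ₁ + δ₂) * Real.exp ((4 * (L * (c * 2) * R + k₀) + 2) * t) ∧
      dist (U₁ t p) (U₂ t p) ≤
        2 * (δ₁ + δ₂) * Real.exp ((4 * (L * (c * 2) * R + k₀) + 2) * t) := by
  have hR : 0 ≤ R := (norm_nonneg _).trans (h₁.norm_X t ht p hp)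
  set l := 4 * (L * (c * 2) * R + k₀) + 2 with hl
  have hk₀ := hk.k₀_nonneg
  have hA : 0 ≤ L * (c * 2) * R + k₀ := by have := hk.L_nonneg; positivity
  have hl0 : 0 < l := by positivity
  have hδ : 0 ≤ δ₁ + δ₂ :=
    add_nonneg (dist_nonneg.trans (h₁.eq_X p hp t ht)) (dist_nonneg.trans (h₂.eq_X p hp t ht))
  have hδe : ∀ t ∈ Icc 0 T, δ₁ + δ₂ ≤ (δ₁ + δ₂) * Real.exp (l * t) := fun t ht =>
    le_mul_of_one_le_right hδ (Real.one_le_exp (mul_nonneg hl0.le ht.1))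
  have step : ∀ M, 0 ≤ M → (∀ t ∈ Icc 0 T, ∀ p ∈ S, dist (X₁ t p) (X₂ t p) ≤ M * Real.exp (l * t) ∧
      dist (U₁ t p) (U₂ t p) ≤ M * Real.exp (l * t)) →
      ∀ t ∈ Icc 0 T, ∀ p ∈ S,
        dist (X₁ t p) (X₂ t p) ≤ ((δ₁ + δ₂) + M / 2) * Real.exp (l * t) ∧
        dist (U₁ t p) (U₂ t p) ≤ ((δ₁ + δ₂) + M / 2) * Real.exp (l * t) := by
    intro M hM hd t ht p hp
    constructor
    · have h := dist_add_integral_le (a := p.1) (A := 1) (l := l) ht (h₁.intble_U p hp)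
        (h₂.intble_U p hp) hM (by linarith) (fun s hs => by
          rw [dist_smul₀, Real.norm_of_nonneg (Real.exp_pos _).le]
          refine mul_le_mul (Real.exp_le_one_iff.2 ?_) (hd s hs p hp).2 dist_nonneg zero_le_one
          have := mul_nonneg hγ hs.1
          linarith)
      have e₁ := h₁.eq_X p hp t ht
      have e₂ := h₂.eq_X p hp t ht
      rw [dist_comm] at e₂
      have := dist_triangle4 (X₁ t p) (p.1 + ∫ s in (0 : ℝ)..t, Real.exp (-(γ * s)) • U₁ s p)
        (p.1 + ∫ s in (0 : ℝ)..t, Real.exp (-(γ * s)) • U₂ s p) (X₂ t p)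
      linarith [hδe t ht]
    · have h := dist_add_integral_le (a := p.2) (A := 2 * (L * (c * 2) * R + k₀)) (l := l) ht
        (h₁.intble_accel p hp) (h₂.intble_accel p hp) hM (by linarith) (fun s hs => by
          have hXae : ∀ᵐ q ∂μ, dist (X₁ s q) (X₂ s q) ≤ M * Real.exp (l * s) := by
            filter_upwards [hS] with q hq using (hd s hs q hq).1
          have hUae : ∀ᵐ q ∂μ, dist (U₁ s q) (U₂ s q) ≤ M * Real.exp (l * s) := by
            filter_upwards [hS] with q hq using (hd s hs q hq).2
          have hUR : ∀ᵐ q ∂μ, ‖U₁ s q‖ ≤ R := by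
            filter_upwards [hS] with q hq using h₁.norm_U s hs q hq
          refine (accel_sub_le hk (h₁.meas_X s hs) (h₂.meas_X s hs) (h₁.meas_U s hs)
            (h₂.meas_U s hs) (hring s hs) (h₁.norm_X s hs p hp) (by positivity)
            hXae hUae hUR).trans ?_
          have := mul_le_mul_of_nonneg_left (hd s hs p hp).1 hA
          linarith)
      have e₁ := h₁.eq_U p hp t ht
      have e₂ := h₂.eq_U p hp t ht
      rw [dist_comm] at e₂
      have := dist_triangle4 (U₁ t p) (p.2 + ∫ s in (0 : ℝ)..t, accel k μ (X₁ s) (U₁ s) (X₁ s p))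
        (p.2 + ∫ s in (0 : ℝ)..t, accel k μ (X₂ s) (U₂ s) (X₂ s p)) (U₂ t p)
      linarith [hδe t ht]
  have iter : ∀ n : ℕ, ∀ t ∈ Icc 0 T, ∀ p ∈ S,
      dist (X₁ t p) (X₂ t p) ≤ (2 * (δ₁ + δ₂) + 2 * R * (1 / 2) ^ n) * Real.exp (l * t) ∧
      dist (U₁ t p) (U₂ t p) ≤ (2 * (δ₁ + δ₂) + 2 * R * (1 / 2) ^ n) * Real.exp (l * t) := by
    intro n
    induction n with
    | zero =>
      intro t ht p hp
      have h1 : 1 ≤ Real.exp (l * t) := Real.one_le_exp (mul_nonneg hl0.le ht.1)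
      have h2 : 2 * R ≤ (2 * (δ₁ + δ₂) + 2 * R * (1 / 2) ^ 0) * Real.exp (l * t) := by
        rw [pow_zero]; nlinarith
      rw [dist_eq_norm, dist_eq_norm]
      exact ⟨(norm_sub_le _ _).trans (by linarith [h₁.norm_X t ht p hp, h₂.norm_X t ht p hp]),
        (norm_sub_le _ _).trans (by linarith [h₁.norm_U t ht p hp, h₂.norm_U t ht p hp])⟩
    | succ n ih =>
      have := step _ (by positivity) ih
      have e : δ₁ + δ₂ + (2 * (δ₁ + δ₂) + 2 * R * (1 / 2) ^ n) / 2 =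
          2 * (δ₁ + δ₂) + 2 * R * (1 / 2) ^ (n + 1) := by ring
      rwa [e] at this
  have hlim : Filter.Tendsto (fun n : ℕ => (2 * (δ₁ + δ₂) + 2 * R * (1 / 2) ^ n) * Real.exp (l * t))
      Filter.atTop (nhds ((2 * (δ₁ + δ₂) + 2 * R * 0) * Real.exp (l * t))) :=
    (((tendsto_pow_atTop_nhds_zero_of_lt_one (by norm_num) (by norm_num)).const_mul _).const_add
      _).mul_const _
  rw [mul_zero, add_zero] at hlim
  exact ⟨ge_of_tendsto' hlim fun n => (iter n t ht p hp).1,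
    ge_of_tendsto' hlim fun n => (iter n t ht p hp).2⟩

end Stability

section DensityBound

open Module

variable {E : Type*} [NormedAddCommGroup E] [InnerProductSpace ℝ E] [FiniteDimensional ℝ E]
  [MeasurableSpace E] [BorelSpace E]

/-- The law of `Z` under `μ` has a density bounded by `C`. -/
def DensityBound {Ω F : Type*} [MeasurableSpace Ω] [MeasureSpace F] (μ : Measure Ω) (Z : Ω → F)
    (C : NNReal) : Prop :=
  ∀ S, MeasurableSet S → μ (Z ⁻¹' S) ≤ C * volume S

lemma DensityBound.null {Ω F : Type*} [MeasurableSpace Ω] [MeasureSpace F] {μ : Measure Ω}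
    {Z : Ω → F} {C : NNReal} (h : DensityBound μ Z C) {S : Set F} (hS : volume S = 0) :
    μ (Z ⁻¹' S) = 0 := by
  have h1 := h _ (measurableSet_toMeasurable volume S)
  rw [measure_toMeasurable, hS, mul_zero] at h1
  exact nonpos_iff_eq_zero.1
    ((measure_mono (preimage_mono (subset_toMeasurable volume S))).trans h1)

lemma DensityBound.fst {Ω : Type*} [MeasurableSpace Ω] {μ : Measure Ω} {X U : Ω → E} {C : NNReal}
    (h : DensityBound μ (fun p => (X p, U p)) C) {R : ℝ} (hU : ∀ᵐ p ∂μ, ‖U p‖ ≤ R) :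
    DensityBound μ X (C * (volume (closedBall (0 : E) R)).toNNReal) := by
  intro S hS
  have h1 : μ (X ⁻¹' S) ≤ μ ((fun p => (X p, U p)) ⁻¹' (S ×ˢ closedBall 0 R)) := by
    refine measure_mono_ae ?_
    filter_upwards [hU] with p hp hq
    exact ⟨hq, mem_closedBall_zero_iff.2 hp⟩
  refine h1.trans ((h _ (hS.prod measurableSet_closedBall)).trans ?_)
  rw [Measure.volume_eq_prod, Measure.prod_prod, ENNReal.coe_mul,
    ENNReal.coe_toNNReal measure_closedBall_lt_top.ne, mul_assoc]
  exact mul_le_mul_right (mul_comm _ _).le _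

variable (E) in
lemma exists_ringBound_of_densityBound [Nontrivial E] {Ω : Type*} [MeasurableSpace Ω]
    (μ : Measure Ω) (C : NNReal) {R R' : ℝ} (hR : 0 ≤ R) (hR' : 0 ≤ R') :
    ∃ c, 0 ≤ c ∧ ∀ X U : Ω → E, DensityBound μ (fun p => (X p, U p)) C →
      (∀ᵐ p ∂μ, ‖X p‖ ≤ R) → (∀ᵐ p ∂μ, ‖U p‖ ≤ R) → RingBound μ X R' c := by
  obtain ⟨c, hc, h⟩ := exists_ringBound E μ (C * (volume (closedBall (0 : E) R)).toNNReal) hR hR'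
  exact ⟨c, hc, fun X U hZ hX hU => h X (hZ.fst hU) hX⟩

lemma measurePreserving_shear_snd {φ : E → E} (hφ : Measurable φ) :
    MeasurePreserving (fun z : E × E => (z.1, z.2 + φ z.1)) :=
  (MeasurePreserving.id (volume : Measure E)).skew_product (g := fun x y => y + φ x)
    (measurable_snd.add (hφ.comp measurable_fst))
    (Filter.Eventually.of_forall fun x => map_add_right_eq_self volume (φ x))

lemma measurePreserving_shear_fst {φ : E → E} (hφ : Measurable φ) :
    MeasurePreserving (fun z : E × E => (z.1 + φ z.2, z.2)) := by
  have h1 := (measurePreserving_shear_snd hφ)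
  have h2 : MeasurePreserving (Prod.swap : E × E → E × E) :=
    Measure.measurePreserving_swap
  exact h2.comp (h1.comp h2)

end DensityBound

section Scheme

variable {E : Type*} [NormedAddCommGroup E] [InnerProductSpace ℝ E] [FiniteDimensional ℝ E]
  [MeasurableSpace E] [BorelSpace E]

/-- Bounded density and bounded support of the initial law. -/
structure IsDatum (μ : Measure (E × E)) (C : NNReal) (Rx Rv : ℝ) : Prop where
  le : DensityBound μ (fun p => p) C
  supp : ∀ᵐ p ∂μ, p ∈ closedBall (0 : E) Rx ×ˢ closedBall (0 : E) Rv
  Rx_nonneg : 0 ≤ Rx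
  Rv_nonneg : 0 ≤ Rv

/-- One step of the splitting scheme: a drift of length `a`, then a kick of length `h`. -/
def splitStep (k : ℝ → ℝ) (μ : Measure (E × E)) (a h : ℝ) (X U : E × E → E) (z : E × E) : E × E :=
  (z.1 + a • z.2, z.2 + h • accel k μ X U (z.1 + a • z.2))

/-- The splitting scheme with time step `h` for `X' = exp (-γ t) U`, `U' = accel k μ X U (X)`. -/
def splitScheme (k : ℝ → ℝ) (γ h : ℝ) (μ : Measure (E × E)) : ℕ → E × E → E × E
  | 0 => id
  | j + 1 => fun p => splitStep k μ (∫ s in (h * j)..(h * (j + 1)), Real.exp (-(γ * s))) h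
      (fun q => (splitScheme k γ h μ j q).1) (fun q => (splitScheme k γ h μ j q).2)
      (splitScheme k γ h μ j p)

lemma measurePreserving_splitStep {k : ℝ → ℝ} {μ : Measure (E × E)} {a h : ℝ} {X U : E × E → E}
    (hm : Measurable (accel k μ X U)) : MeasurePreserving (splitStep k μ a h X U) :=
  (measurePreserving_shear_snd (hm.const_smul h)).comp
    (measurePreserving_shear_fst (measurable_id.const_smul a))

variable [Nontrivial E] {k : ℝ → ℝ} {L k₀ γ h T : ℝ} {μ : Measure (E × E)} [IsProbabilityMeasure μ]
  {C : NNReal} {Rx Rv : ℝ}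

omit [FiniteDimensional ℝ E] [BorelSpace E] [Nontrivial E] in
lemma lipschitz_accel (hk : LipWeight k L k₀) {X U : E × E → E}
    {R c : ℝ} (hX : AEStronglyMeasurable X μ) (hU : AEStronglyMeasurable U μ)
    (hring : RingBound μ X R c) (hUR : ∀ᵐ p ∂μ, ‖U p‖ ≤ R) {x y : E} (hx : ‖x‖ ≤ R) :
    dist (accel k μ X U x) (accel k μ X U y) ≤ (L * (c * 2) * R + k₀) * dist x y := by
  have := accel_sub_le hk hX hX hU hU hring hx le_rfl (x₂ := y)
    (Filter.Eventually.of_forall fun q => (dist_self _).le)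
    (Filter.Eventually.of_forall fun q => (dist_self _).le) hUR
  simpa using this

lemma continuous_accel (hk : LipWeight k L k₀) {X U : E × E → E} {R : ℝ}
    (hX : AEStronglyMeasurable X μ) (hU : AEStronglyMeasurable U μ)
    (hZ : DensityBound μ (fun p => (X p, U p)) C)
    (hXR : ∀ᵐ p ∂μ, ‖X p‖ ≤ R) (hUR : ∀ᵐ p ∂μ, ‖U p‖ ≤ R) : Continuous (accel k μ X U) := by
  rw [continuous_iff_continuousAt]
  intro x
  have hR : 0 ≤ R := by
    obtain ⟨p, hp⟩ := hXR.exists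
    exact (norm_nonneg _).trans hp
  obtain ⟨c, hc, hring⟩ := exists_ringBound_of_densityBound E μ C hR (R' := max R ‖x‖)
    (hR.trans (le_max_left _ _))
  rw [ContinuousAt, tendsto_iff_dist_tendsto_zero]
  have hb : ∀ y, dist (accel k μ X U y) (accel k μ X U x) ≤
      (L * (c * 2) * max R ‖x‖ + k₀) * dist y x := fun y => by
    rw [dist_comm, dist_comm y]
    exact lipschitz_accel hk hX hU (hring X U hZ hXR hUR)
      (hUR.mono fun p hp => hp.trans (le_max_left _ _)) (le_max_right _ _)
  refine squeeze_zero (fun _ => dist_nonneg) hb ?_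
  have : Continuous fun y => (L * (c * 2) * max R ‖x‖ + k₀) * dist y x := by fun_prop
  have h2 := this.tendsto x
  rwa [dist_self, mul_zero] at h2

lemma norm_accel_le_gamma (hk : LipWeight k L k₀) (hγ : γ = ∫ z in (0 : ℝ)..1, k z)
    {X U : E × E → E} {R : ℝ} (hX : AEStronglyMeasurable X μ)
    (hZ : DensityBound μ (fun p => (X p, U p)) C) (hUR : ∀ᵐ p ∂μ, ‖U p‖ ≤ R) (x : E) :
    ‖accel k μ X U x‖ ≤ γ * R := by
  have := norm_accel_le_weight hk hX hUR x
  rwa [integral_weight hX (fun S hS => (hZ.fst hUR).null hS) hk.continuous, ← hγ] at this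

lemma exp_integral_bounds (hγ : 0 ≤ γ) (hh : 0 ≤ h) (j : ℕ) :
    0 ≤ ∫ s in (h * j)..(h * (j + 1)), Real.exp (-(γ * s)) ∧
      ∫ s in (h * j)..(h * (j + 1)), Real.exp (-(γ * s)) ≤ h * Real.exp (-(γ * (h * j))) := by
  have hle : h * j ≤ h * (j + 1) := by nlinarith
  refine ⟨intervalIntegral.integral_nonneg hle fun s _ => (Real.exp_pos _).le, ?_⟩
  have : ∫ s in (h * j)..(h * (j + 1)), Real.exp (-(γ * s)) ≤
      ∫ s in (h * j)..(h * (j + 1)), Real.exp (-(γ * (h * j))) := by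
    refine intervalIntegral.integral_mono_on hle
      (by apply Continuous.intervalIntegrable; fun_prop) (by simp) fun s hs => ?_
    rw [Real.exp_le_exp, neg_le_neg_iff]
    exact mul_le_mul_of_nonneg_left hs.1 hγ
  rw [intervalIntegral.integral_const, smul_eq_mul] at this
  refine this.trans (le_of_eq ?_)
  ring

lemma splitScheme_spec (hk : LipWeight k L k₀) (hγ : γ = ∫ z in (0 : ℝ)..1, k z) (hγ0 : 0 ≤ γ)
    (hh : 0 ≤ h) (hμ : IsDatum μ C Rx Rv) (j : ℕ) :
    MeasurePreserving (splitScheme k γ h μ j) ∧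
    (∀ p ∈ closedBall (0 : E) Rx ×ˢ closedBall (0 : E) Rv,
      ‖(splitScheme k γ h μ j p).1‖ ≤ Rx + h * j * Rv ∧
      ‖(splitScheme k γ h μ j p).2‖ ≤ Real.exp (γ * (h * j)) * Rv) := by
  induction j with
  | zero =>
    refine ⟨MeasurePreserving.id _, fun p hp => ?_⟩
    simpa [splitScheme] using hp
  | succ j ih =>
    obtain ⟨hmp, hb⟩ := ih
    set Z := splitScheme k γ h μ j with hZdef
    set a := ∫ s in (h * j)..(h * (j + 1)), Real.exp (-(γ * s)) with ha
    have hdens : DensityBound μ (fun p => ((Z p).1, (Z p).2)) C := fun S hS => by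
      have := hμ.le _ (hmp.measurable hS)
      rwa [hmp.measure_preimage hS.nullMeasurableSet] at this
    have hX : AEStronglyMeasurable (fun p => (Z p).1) μ :=
      hmp.measurable.fst.aestronglyMeasurable
    have hU : AEStronglyMeasurable (fun p => (Z p).2) μ :=
      hmp.measurable.snd.aestronglyMeasurable
    have hXR : ∀ᵐ p ∂μ, ‖(Z p).1‖ ≤ Rx + h * j * Rv := hμ.supp.mono fun p hp => (hb p hp).1
    have hUR : ∀ᵐ p ∂μ, ‖(Z p).2‖ ≤ Real.exp (γ * (h * j)) * Rv :=
      hμ.supp.mono fun p hp => (hb p hp).2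
    have hacc := continuous_accel hk hX hU hdens
      (R := max (Rx + h * j * Rv) (Real.exp (γ * (h * j)) * Rv))
      (hXR.mono fun p hp => hp.trans (le_max_left _ _))
      (hUR.mono fun p hp => hp.trans (le_max_right _ _))
    have hRv := hμ.Rv_nonneg
    obtain ⟨ha0, ha1⟩ := exp_integral_bounds hγ0 hh j
    refine ⟨(measurePreserving_splitStep hacc.measurable).comp hmp, fun p hp => ⟨?_, ?_⟩⟩
    · change ‖(Z p).1 + a • (Z p).2‖ ≤ _
      refine (norm_add_le _ _).trans ?_
      rw [norm_smul, Real.norm_of_nonneg ha0]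
      have h1 : a * ‖(Z p).2‖ ≤ h * Real.exp (-(γ * (h * j))) * (Real.exp (γ * (h * j)) * Rv) :=
        mul_le_mul ha1 (hb p hp).2 (norm_nonneg _) (by positivity)
      have h2 : h * Real.exp (-(γ * (h * j))) * (Real.exp (γ * (h * j)) * Rv) = h * Rv := by
        rw [Real.exp_neg]
        field_simp
      push_cast
      linarith [(hb p hp).1]
    · change ‖(Z p).2 + h • accel k μ (fun q => (Z q).1) (fun q => (Z q).2) _‖ ≤ _
      refine (norm_add_le _ _).trans ?_
      rw [norm_smul, Real.norm_of_nonneg hh]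
      have h1 := mul_le_mul_of_nonneg_left (norm_accel_le_gamma hk hγ hX hdens hUR
        ((Z p).1 + a • (Z p).2)) hh
      have h2 : Real.exp (γ * (h * (j + 1 : ℕ))) =
          Real.exp (γ * (h * j)) * Real.exp (γ * h) := by
        rw [← Real.exp_add]; push_cast; ring_nf
      have h3 := Real.add_one_le_exp (γ * h)
      have h4 : 0 ≤ Real.exp (γ * (h * j)) * Rv := by positivity
      have h5 := mul_le_mul_of_nonneg_left h3 h4
      rw [h2]
      linarith [(hb p hp).2]

end Scheme

section StepFunctions

variable {E : Type*} [NormedAddCommGroup E] [NormedSpace ℝ E]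

lemma floor_div_eq {h s : ℝ} (hh : 0 < h) {j : ℕ} (hs : s ∈ Ioo (h * j) (h * (j + 1))) :
    ⌊s / h⌋₊ = j := by
  rw [Nat.floor_eq_iff (div_nonneg ((mul_nonneg hh.le j.cast_nonneg).trans hs.1.le) hh.le),
    le_div_iff₀ hh, div_lt_iff₀ hh]
  exact ⟨by linarith [hs.1], by linarith [hs.2]⟩

lemma mul_floor_le {h t : ℝ} (hh : 0 < h) (ht : 0 ≤ t) : h * ⌊t / h⌋₊ ≤ t := by
  have := Nat.floor_le (div_nonneg ht hh.le)
  rw [le_div_iff₀ hh] at this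
  linarith

lemma lt_mul_floor_add {h : ℝ} (hh : 0 < h) (t : ℝ) : t ≤ h * (⌊t / h⌋₊ + 1) := by
  have := (Nat.lt_floor_add_one (t / h)).le
  rw [div_le_iff₀ hh] at this
  linarith

lemma dist_euler_le {h T M ε : ℝ} (hh : 0 < h) {y : ℕ → E} {f : ℝ → E} (hε : 0 ≤ ε)
    (hf : IntervalIntegrable f volume 0 T) (hM : ∀ s ∈ Icc 0 T, ‖f s‖ ≤ M)
    (hy : ∀ j : ℕ, h * (j + 1) ≤ T →
      dist (y (j + 1)) (y j + ∫ s in (h * j)..(h * (j + 1)), f s) ≤ ε * h)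
    {t : ℝ} (ht : t ∈ Icc 0 T) :
    dist (y ⌊t / h⌋₊) (y 0 + ∫ s in (0 : ℝ)..t, f s) ≤ ε * T + M * h := by
  have hT : 0 ≤ T := ht.1.trans ht.2
  have hM0 : 0 ≤ M := (norm_nonneg _).trans (hM t ht)
  have hsub : ∀ a b, a ∈ Icc 0 T → b ∈ Icc 0 T → IntervalIntegrable f volume a b :=
    fun a b ha hb => hf.mono_set (by
      rw [uIcc_of_le hT]
      exact uIcc_subset_Icc ha hb)
  have key : ∀ j : ℕ, h * j ≤ T →
      dist (y j) (y 0 + ∫ s in (0 : ℝ)..(h * j), f s) ≤ ε * (h * j) := by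
    intro j
    induction j with
    | zero => intro _; simp
    | succ j ih =>
      intro hj
      push_cast at hj ⊢
      have hj' : h * j ≤ T := by nlinarith
      have hj0 : 0 ≤ h * j := by positivity
      have h1 := intervalIntegral.integral_add_adjacent_intervals
        (hsub 0 (h * j) ⟨le_rfl, hT⟩ ⟨hj0, hj'⟩)
        (hsub (h * j) (h * (j + 1)) ⟨hj0, hj'⟩ ⟨by positivity, hj⟩)
      rw [← h1, ← add_assoc]
      have h2 := dist_triangle (y (j + 1)) (y j + ∫ s in (h * j)..(h * (j + 1)), f s)
        (y 0 + (∫ s in (0 : ℝ)..(h * j), f s) + ∫ s in (h * j)..(h * (j + 1)), f s)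
      rw [dist_add_right] at h2
      linarith [ih hj', hy j hj]
  have hle := mul_floor_le hh ht.1
  have h0 : (0 : ℝ) ≤ h * ⌊t / h⌋₊ := by positivity
  have h1 := intervalIntegral.integral_add_adjacent_intervals
    (hsub 0 (h * ⌊t / h⌋₊) ⟨le_rfl, hT⟩ ⟨h0, hle.trans ht.2⟩)
    (hsub (h * ⌊t / h⌋₊) t ⟨h0, hle.trans ht.2⟩ ht)
  have h2 : ‖∫ s in (h * ⌊t / h⌋₊)..t, f s‖ ≤ M * h := by
    refine (intervalIntegral.norm_integral_le_of_norm_le_const (C := M) fun s hs => ?_).trans ?_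
    · rw [uIoc_of_le hle] at hs
      exact hM s ⟨h0.trans hs.1.le, hs.2.trans ht.2⟩
    · rw [abs_of_nonneg (by linarith)]
      refine mul_le_mul_of_nonneg_left ?_ hM0
      linarith [lt_mul_floor_add hh t]
  rw [← h1, ← add_assoc]
  have h3 := key _ (hle.trans ht.2)
  have h4 := dist_triangle (y ⌊t / h⌋₊) (y 0 + ∫ s in (0 : ℝ)..(h * ⌊t / h⌋₊), f s)
    (y 0 + (∫ s in (0 : ℝ)..(h * ⌊t / h⌋₊), f s) + ∫ s in (h * ⌊t / h⌋₊)..t, f s)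
  rw [dist_self_add_right] at h4
  have h5 : ε * (h * ⌊t / h⌋₊) ≤ ε * T := mul_le_mul_of_nonneg_left (hle.trans ht.2) hε
  linarith

end StepFunctions

section Scheme

variable {E : Type*} [NormedAddCommGroup E] [InnerProductSpace ℝ E] [FiniteDimensional ℝ E]
  [MeasurableSpace E] [BorelSpace E]
variable [Nontrivial E] {k : ℝ → ℝ} {L k₀ γ h T : ℝ} {μ : Measure (E × E)} [IsProbabilityMeasure μ]
  {C : NNReal} {Rx Rv : ℝ}

lemma splitScheme_densityBound (hk : LipWeight k L k₀) (hγ : γ = ∫ z in (0 : ℝ)..1, k z)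
    (hγ0 : 0 ≤ γ) (hh : 0 ≤ h) (hμ : IsDatum μ C Rx Rv) (j : ℕ) :
    DensityBound μ (fun p => ((splitScheme k γ h μ j p).1, (splitScheme k γ h μ j p).2)) C :=
  fun S hS => by
    have hmp := (splitScheme_spec hk hγ hγ0 hh hμ j).1
    have := hμ.le _ (hmp.measurable hS)
    rwa [hmp.measure_preimage hS.nullMeasurableSet] at this

/-- An a priori bound for trajectories started in the ball of radius `P`. -/
def trajBound (γ T Rv P : ℝ) : ℝ := (1 + T) * (P + T * (γ * (Real.exp (γ * T) * Rv)))

lemma splitScheme_norm_le (hk : LipWeight k L k₀) (hγ : γ = ∫ z in (0 : ℝ)..1, k z) (hγ0 : 0 ≤ γ)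
    (hh : 0 ≤ h) (hμ : IsDatum μ C Rx Rv) {P : ℝ} {p : E × E} (hp : ‖p‖ ≤ P) (j : ℕ)
    (hj : h * j ≤ T) :
    ‖(splitScheme k γ h μ j p).1‖ ≤ trajBound γ T Rv P ∧
      ‖(splitScheme k γ h μ j p).2‖ ≤ trajBound γ T Rv P := by
  have hRv := hμ.Rv_nonneg
  have hT : 0 ≤ T := le_trans (by positivity) hj
  have hP : 0 ≤ P := (norm_nonneg p).trans hp
  set G := γ * (Real.exp (γ * T) * Rv) with hG
  have hG0 : 0 ≤ G := by positivity
  have key : ∀ j : ℕ, h * j ≤ T → ‖(splitScheme k γ h μ j p).1‖ ≤ P + h * j * (P + T * G) ∧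
      ‖(splitScheme k γ h μ j p).2‖ ≤ P + h * j * G := by
    intro j
    induction j with
    | zero =>
      intro _
      simpa [splitScheme] using ⟨(norm_fst_le p).trans hp, (norm_snd_le p).trans hp⟩
    | succ j ih =>
      intro hj
      push_cast at hj
      have hj' : h * j ≤ T := by nlinarith
      obtain ⟨ih1, ih2⟩ := ih hj'
      obtain ⟨hmp, hb⟩ := splitScheme_spec hk hγ hγ0 hh hμ j
      have hUR : ∀ᵐ p ∂μ, ‖(splitScheme k γ h μ j p).2‖ ≤ Real.exp (γ * T) * Rv :=
        hμ.supp.mono fun p hp => (hb p hp).2.trans (by gcongr)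
      obtain ⟨ha0, ha1⟩ := exp_integral_bounds hγ0 hh j
      have ha2 : ∫ s in (h * j)..(h * (j + 1)), Real.exp (-(γ * s)) ≤ h :=
        ha1.trans (mul_le_of_le_one_right hh
          (Real.exp_le_one_iff.2 (neg_nonpos.2 (by positivity))))
      constructor
      · change ‖(splitScheme k γ h μ j p).1 + (∫ s in (h * j)..(h * (j + 1)),
          Real.exp (-(γ * s))) • (splitScheme k γ h μ j p).2‖ ≤ _
        refine (norm_add_le _ _).trans ?_
        rw [norm_smul, Real.norm_of_nonneg ha0]
        have h1 := mul_le_mul ha2 (ih2.trans (show P + h * j * G ≤ P + T * G by gcongr))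
          (norm_nonneg _) hh
        push_cast
        linarith
      · change ‖(splitScheme k γ h μ j p).2 + h • accel k μ (fun q => (splitScheme k γ h μ j q).1)
          (fun q => (splitScheme k γ h μ j q).2) _‖ ≤ _
        refine (norm_add_le _ _).trans ?_
        rw [norm_smul, Real.norm_of_nonneg hh]
        have h1 := mul_le_mul_of_nonneg_left (norm_accel_le_gamma hk hγ
          hmp.measurable.fst.aestronglyMeasurable (splitScheme_densityBound hk hγ hγ0 hh hμ j) hUR
          ((splitScheme k γ h μ j p).1 + (∫ s in (h * j)..(h * (j + 1)),
          Real.exp (-(γ * s))) • (splitScheme k γ h μ j p).2)) hh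
        push_cast
        linarith
  obtain ⟨h1, h2⟩ := key j hj
  have e : trajBound γ T Rv P = (P + T * G) + T * (P + T * G) := by rw [trajBound]; ring
  have h3 : h * j * (P + T * G) ≤ T * (P + T * G) := by gcongr
  have h4 : h * j * G ≤ T * G := by gcongr
  have h5 : 0 ≤ T * G := by positivity
  have h6 : 0 ≤ T * (P + T * G) := by positivity
  rw [e]
  exact ⟨by linarith, by linarith⟩

lemma isApproxSol_splitScheme (hk : LipWeight k L k₀) (hγ : γ = ∫ z in (0 : ℝ)..1, k z)
    (hγ0 : 0 ≤ γ) (hh : 0 < h) (hT : 0 ≤ T) (hμ : IsDatum μ C Rx Rv) {P c : ℝ}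
    (hS : ∀ᵐ p ∂μ, p ∈ closedBall (0 : E × E) P) (hc : 0 ≤ c)
    (hring : ∀ j : ℕ, h * j ≤ T →
      RingBound μ (fun p => (splitScheme k γ h μ j p).1) (trajBound γ T Rv P) c) :
    IsApproxSol k γ T μ (fun t p => (splitScheme k γ h μ ⌊t / h⌋₊ p).1)
      (fun t p => (splitScheme k γ h μ ⌊t / h⌋₊ p).2) (closedBall 0 P) (trajBound γ T Rv P)
      (((L * (c * 2) * trajBound γ T Rv P + k₀) * trajBound γ T Rv P * T +
        (1 + k₀) * trajBound γ T Rv P) * h) := by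
  set R := trajBound γ T Rv P with hRdef
  set A := L * (c * 2) * R + k₀ with hAdef
  have hn : ∀ j : ℕ, h * j ≤ T → ∀ p ∈ closedBall (0 : E × E) P,
      ‖(splitScheme k γ h μ j p).1‖ ≤ R ∧ ‖(splitScheme k γ h μ j p).2‖ ≤ R := fun j hj p hp =>
    splitScheme_norm_le hk hγ hγ0 hh.le hμ (mem_closedBall_zero_iff.1 hp) j hj
  have hfl : ∀ t ∈ Icc 0 T, h * ⌊t / h⌋₊ ≤ T := fun t ht => (mul_floor_le hh ht.1).trans ht.2
  have hm : ∀ j, Measurable (splitScheme k γ h μ j) := fun j =>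
    (splitScheme_spec hk hγ hγ0 hh.le hμ j).1.measurable
  obtain ⟨p₀, hp₀⟩ := hS.exists
  have hR : 0 ≤ R := (norm_nonneg _).trans (hn 0 (by simpa using hT) p₀ hp₀).1
  have hk₀ := hk.k₀_nonneg
  have hA : 0 ≤ A := by have := hk.L_nonneg; positivity
  have hUR : ∀ j : ℕ, h * j ≤ T → ∀ᵐ p ∂μ, ‖(splitScheme k γ h μ j p).2‖ ≤ R := fun j hj =>
    hS.mono fun p hp => (hn j hj p hp).2
  have hfloor : Measurable fun s : ℝ => ⌊s / h⌋₊ :=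
    Nat.measurable_floor.comp (measurable_id.div_const h)
  have hint : ∀ (f : ℝ → E) (M : ℝ), Measurable f → (∀ s ∈ Icc 0 T, ‖f s‖ ≤ M) →
      IntervalIntegrable f volume 0 T := fun f M hf hM => by
    rw [intervalIntegrable_iff_integrableOn_Icc_of_le hT]
    exact Measure.integrableOn_of_bounded (by simp) hf.aestronglyMeasurable
      ((ae_restrict_iff' measurableSet_Icc).2 (Filter.Eventually.of_forall hM))
  have hmU : ∀ p, Measurable fun s : ℝ =>
      Real.exp (-(γ * s)) • (splitScheme k γ h μ ⌊s / h⌋₊ p).2 := fun p =>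
    (by fun_prop : Measurable fun s : ℝ => Real.exp (-(γ * s))).smul
      ((measurable_from_nat (f := fun j => (splitScheme k γ h μ j p).2)).comp hfloor)
  have hbU : ∀ p ∈ closedBall (0 : E × E) P, ∀ s ∈ Icc 0 T,
      ‖Real.exp (-(γ * s)) • (splitScheme k γ h μ ⌊s / h⌋₊ p).2‖ ≤ R := fun p hp s hs => by
    rw [norm_smul, Real.norm_of_nonneg (Real.exp_pos _).le]
    refine (mul_le_of_le_one_left (norm_nonneg _) (Real.exp_le_one_iff.2 ?_)).trans
      (hn _ (hfl s hs) p hp).2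
    exact neg_nonpos.2 (mul_nonneg hγ0 hs.1)
  have hma : ∀ p, Measurable fun s : ℝ =>
      accel k μ (fun p => (splitScheme k γ h μ ⌊s / h⌋₊ p).1)
        (fun p => (splitScheme k γ h μ ⌊s / h⌋₊ p).2) (splitScheme k γ h μ ⌊s / h⌋₊ p).1 :=
    fun p => (measurable_from_nat (f := fun j => accel k μ (fun p => (splitScheme k γ h μ j p).1)
        (fun p => (splitScheme k γ h μ j p).2) (splitScheme k γ h μ j p).1)).comp hfloor
  have hba : ∀ p, ∀ s ∈ Icc 0 T, ‖accel k μ (fun p => (splitScheme k γ h μ ⌊s / h⌋₊ p).1)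
        (fun p => (splitScheme k γ h μ ⌊s / h⌋₊ p).2) (splitScheme k γ h μ ⌊s / h⌋₊ p).1‖ ≤
        k₀ * R := fun p s hs => norm_accel_le hk (hUR _ (hfl s hs)) _
  have hstep : ∀ j : ℕ, h * j ≤ h * (j + 1) := fun j => by nlinarith
  refine ⟨fun t _ => (hm _).fst.aestronglyMeasurable, fun t _ => (hm _).snd.aestronglyMeasurable,
    fun t ht p hp => (hn _ (hfl t ht) p hp).1, fun t ht p hp => (hn _ (hfl t ht) p hp).2,
    fun p hp => hint _ R (hmU p) (hbU p hp), fun p hp => hint _ _ (hma p) (hba p), ?_, ?_⟩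
  · intro p hp t ht
    refine (dist_euler_le (y := fun j => (splitScheme k γ h μ j p).1) hh le_rfl
      (hint _ R (hmU p) (hbU p hp)) (hbU p hp) (fun j hj => ?_) ht).trans ?_
    · rw [intervalIntegral.integral_congr_Ioo_of_le (hstep j) (g := fun s =>
        Real.exp (-(γ * s)) • (splitScheme k γ h μ j p).2) fun s hs => by
          simp only [floor_div_eq hh hs], intervalIntegral.integral_smul_const, zero_mul]
      exact (dist_self _).le
    · have h1 : 0 ≤ A * R * T * h := by positivity
      have h2 : 0 ≤ k₀ * R * h := by positivity
      nlinarith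
  · intro p hp t ht
    refine (dist_euler_le (y := fun j => (splitScheme k γ h μ j p).2) (ε := A * (R * h)) hh
      (by positivity) (hint _ _ (hma p) (hba p)) (hba p) (fun j hj => ?_) ht).trans ?_
    · have hj' : h * j ≤ T := (hstep j).trans hj
      rw [intervalIntegral.integral_congr_Ioo_of_le (hstep j) (g := fun _ =>
        accel k μ (fun p => (splitScheme k γ h μ j p).1)
          (fun p => (splitScheme k γ h μ j p).2) (splitScheme k γ h μ j p).1) fun s hs => by
          simp only [floor_div_eq hh hs], intervalIntegral.integral_const]
      have e : h * ((j : ℝ) + 1) - h * j = h := by ring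
      obtain ⟨ha0, ha1⟩ := exp_integral_bounds hγ0 hh.le j
      have ha2 : ∫ s in (h * j)..(h * (j + 1)), Real.exp (-(γ * s)) ≤ h :=
        ha1.trans (mul_le_of_le_one_right hh.le
          (Real.exp_le_one_iff.2 (neg_nonpos.2 (by positivity))))
      change dist ((splitScheme k γ h μ j p).2 + h • accel k μ
        (fun q => (splitScheme k γ h μ j q).1) (fun q => (splitScheme k γ h μ j q).2)
        ((splitScheme k γ h μ j p).1 + (∫ s in (h * j)..(h * (j + 1)), Real.exp (-(γ * s))) •
          (splitScheme k γ h μ j p).2)) _ ≤ _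
      rw [e, dist_add_left, dist_smul₀, Real.norm_of_nonneg hh.le, mul_comm _ h, dist_comm]
      refine mul_le_mul_of_nonneg_left ?_ hh.le
      refine (lipschitz_accel hk (hm j).fst.aestronglyMeasurable (hm j).snd.aestronglyMeasurable
        (hring j hj') (hUR j hj') (hn j hj' p hp).1).trans ?_
      rw [dist_self_add_right, norm_smul, Real.norm_of_nonneg ha0, mul_comm R h]
      exact mul_le_mul_of_nonneg_left
        (mul_le_mul ha2 (hn j hj' p hp).2 (norm_nonneg _) hh.le) hA
    · have h1 : 0 ≤ R * h := by positivity
      nlinarith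

end Scheme

section Limits

open Filter Topology

lemma DensityBound.of_tendsto {Ω F : Type*} [MeasurableSpace Ω] [MeasureSpace F]
    [TopologicalSpace F] [BorelSpace F] [(volume : Measure F).OuterRegular] {μ : Measure Ω}
    {Z : ℕ → Ω → F} {Z' : Ω → F} {C : NNReal} (h : ∀ n, DensityBound μ (Z n) C)
    (hlim : ∀ p, Tendsto (fun n => Z n p) atTop (𝓝 (Z' p))) : DensityBound μ Z' C := by
  have hopen : ∀ V : Set F, IsOpen V → μ (Z' ⁻¹' V) ≤ C * volume V := fun V hV => by
    have hsub : Z' ⁻¹' V ⊆ ⋃ N : ℕ, ⋂ n ∈ Ici N, Z n ⁻¹' V := fun p hp => by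
      have := (hlim p).eventually (hV.mem_nhds hp)
      obtain ⟨N, hN⟩ := eventually_atTop.1 this
      exact mem_iUnion.2 ⟨N, mem_iInter₂.2 fun n hn => hN n hn⟩
    have hmono : Monotone fun N : ℕ => ⋂ n ∈ Ici N, Z n ⁻¹' V := fun N M hNM =>
      biInter_subset_biInter_left (Ici_subset_Ici.2 hNM)
    refine (measure_mono hsub).trans ?_
    rw [hmono.measure_iUnion]
    exact iSup_le fun N => (measure_mono (biInter_subset_of_mem (mem_Ici.2 le_rfl))).trans
      (h N V hV.measurableSet)
  intro S _
  have : C * volume S = (C • volume : Measure F) S := by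
    rw [Measure.smul_apply, ENNReal.smul_def, smul_eq_mul]
  rw [this, S.measure_eq_iInf_isOpen]
  refine le_iInf fun V => le_iInf fun hSV => le_iInf fun hV => ?_
  rw [Measure.smul_apply, ENNReal.smul_def, smul_eq_mul]
  exact (measure_mono (preimage_mono hSV)).trans (hopen V hV)

variable {E : Type*} [NormedAddCommGroup E] [NormedSpace ℝ E]

lemma intervalIntegrable_of_uniform_limit {f : ℕ → ℝ → E} {g : ℝ → E} {T : ℝ} (hT : 0 ≤ T)
    {ε : ℕ → ℝ} (hε : Tendsto ε atTop (𝓝 0)) (hf : ∀ n, IntervalIntegrable (f n) volume 0 T)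
    (h : ∀ n, ∀ s ∈ Icc 0 T, dist (f n s) (g s) ≤ ε n) :
    IntervalIntegrable g volume 0 T ∧ ∀ n, ∀ t ∈ Icc 0 T,
      dist (∫ s in (0 : ℝ)..t, f n s) (∫ s in (0 : ℝ)..t, g s) ≤ ε n * T := by
  have hg : IntervalIntegrable g volume 0 T := by
    rw [intervalIntegrable_iff_integrableOn_Icc_of_le hT]
    have hf' : ∀ n, IntegrableOn (f n) (Icc 0 T) := fun n =>
      (intervalIntegrable_iff_integrableOn_Icc_of_le hT).1 (hf n)
    have hmeas : AEStronglyMeasurable g (volume.restrict (Icc 0 T)) := by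
      refine aestronglyMeasurable_of_tendsto_ae atTop (fun n => (hf' n).aestronglyMeasurable) ?_
      refine (ae_restrict_iff' measurableSet_Icc).2 (Eventually.of_forall fun s hs => ?_)
      rw [tendsto_iff_dist_tendsto_zero]
      exact squeeze_zero (fun _ => dist_nonneg) (fun n => h n s hs) hε
    refine ((hf' 0).norm.add (integrable_const (ε 0))).mono' hmeas ?_
    refine (ae_restrict_iff' measurableSet_Icc).2 (Eventually.of_forall fun s hs => ?_)
    have h1 := h 0 s hs
    rw [dist_comm, dist_eq_norm] at h1
    have h2 := norm_le_norm_add_norm_sub' (g s) (f 0 s)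
    simp only [Pi.add_apply]
    linarith
  refine ⟨hg, fun n t ht => ?_⟩
  have hsub : uIcc 0 t ⊆ uIcc 0 T := by
    rw [uIcc_of_le ht.1, uIcc_of_le hT]
    exact Icc_subset_Icc_right ht.2
  have hε0 : 0 ≤ ε n := dist_nonneg.trans (h n t ht)
  rw [dist_eq_norm, ← intervalIntegral.integral_sub ((hf n).mono_set hsub) (hg.mono_set hsub)]
  refine (intervalIntegral.norm_integral_le_of_norm_le_const (C := ε n) fun s hs => ?_).trans ?_
  · rw [uIoc_of_le ht.1] at hs
    rw [← dist_eq_norm]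
    exact h n s ⟨hs.1.le, hs.2.trans ht.2⟩
  · rw [sub_zero, abs_of_nonneg ht.1]
    exact mul_le_mul_of_nonneg_left ht.2 hε0

variable [MeasurableSpace E] {k : ℝ → ℝ} {L k₀ γ T : ℝ} {μ : Measure (E × E)}
  [IsProbabilityMeasure μ] {X U : ℝ → E × E → E} {Xn Un : ℕ → ℝ → E × E → E} {S : Set (E × E)}
  {R c : ℝ} {δ η : ℕ → ℝ}

lemma IsApproxSol.of_tendsto (hk : LipWeight k L k₀) (hγ : 0 ≤ γ) (hT : 0 ≤ T)
    (h : ∀ n, IsApproxSol k γ T μ (Xn n) (Un n) S R (δ n)) (hS : ∀ᵐ p ∂μ, p ∈ S)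
    (hring : ∀ n, ∀ t ∈ Icc 0 T, RingBound μ (Xn n t) R c)
    (hδ : Tendsto δ atTop (𝓝 0)) (hη : Tendsto η atTop (𝓝 0))
    (hX : ∀ n, ∀ t ∈ Icc 0 T, ∀ p ∈ S, dist (Xn n t p) (X t p) ≤ η n)
    (hU : ∀ n, ∀ t ∈ Icc 0 T, ∀ p ∈ S, dist (Un n t p) (U t p) ≤ η n)
    (hXm : ∀ t ∈ Icc 0 T, AEStronglyMeasurable (X t) μ)
    (hUm : ∀ t ∈ Icc 0 T, AEStronglyMeasurable (U t) μ) :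
    IsApproxSol k γ T μ X U S R 0 := by
  have hXlim : ∀ t ∈ Icc 0 T, ∀ p ∈ S, Tendsto (fun n => Xn n t p) atTop (𝓝 (X t p)) :=
    fun t ht p hp => tendsto_iff_dist_tendsto_zero.2
      (squeeze_zero (fun _ => dist_nonneg) (fun n => hX n t ht p hp) hη)
  have hUlim : ∀ t ∈ Icc 0 T, ∀ p ∈ S, Tendsto (fun n => Un n t p) atTop (𝓝 (U t p)) :=
    fun t ht p hp => tendsto_iff_dist_tendsto_zero.2
      (squeeze_zero (fun _ => dist_nonneg) (fun n => hU n t ht p hp) hη)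
  have hη0 : ∀ n, 0 ≤ η n := fun n => by
    obtain ⟨p, hp⟩ := hS.exists
    exact dist_nonneg.trans (hX n 0 ⟨le_rfl, hT⟩ p hp)
  have iU : ∀ p ∈ S, _ := fun p hp => intervalIntegrable_of_uniform_limit hT hη
    (fun n => (h n).intble_U p hp) (g := fun s => Real.exp (-(γ * s)) • U s p) fun n s hs => by
      rw [dist_smul₀, Real.norm_of_nonneg (Real.exp_pos _).le]
      refine (mul_le_of_le_one_left dist_nonneg (Real.exp_le_one_iff.2 ?_)).trans (hU n s hs p hp)
      exact neg_nonpos.2 (mul_nonneg hγ hs.1)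
  have hdA : ∀ p ∈ S, ∀ n, ∀ s ∈ Icc 0 T, dist (accel k μ (Xn n s) (Un n s) (Xn n s p))
      (accel k μ (X s) (U s) (X s p)) ≤ |L * (c * 2) * R + k₀| * (η n + η n) :=
    fun p hp n s hs => by
      refine (accel_sub_le hk ((h n).meas_X s hs) (hXm s hs) ((h n).meas_U s hs) (hUm s hs)
        (hring n s hs) ((h n).norm_X s hs p hp) (hη0 n) (hS.mono fun q hq => hX n s hs q hq)
        (hS.mono fun q hq => hU n s hs q hq) (hS.mono fun q hq => (h n).norm_U s hs q hq)).trans ?_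
      exact mul_le_mul (le_abs_self _) (add_le_add_left (hX n s hs p hp) _)
        (add_nonneg dist_nonneg (hη0 n)) (abs_nonneg _)
  have hε : Tendsto (fun n => |L * (c * 2) * R + k₀| * (η n + η n)) atTop (𝓝 0) := by
    have := (hη.add hη).const_mul |L * (c * 2) * R + k₀|
    simpa using this
  have iA : ∀ p ∈ S, _ := fun p hp => intervalIntegrable_of_uniform_limit hT hε
    (fun n => (h n).intble_accel p hp) (hdA p hp)
  refine ⟨hXm, hUm, fun t ht p hp => le_of_tendsto (hXlim t ht p hp).norm
      (Eventually.of_forall fun n => (h n).norm_X t ht p hp),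
    fun t ht p hp => le_of_tendsto (hUlim t ht p hp).norm
      (Eventually.of_forall fun n => (h n).norm_U t ht p hp),
    fun p hp => (iU p hp).1, fun p hp => (iA p hp).1, fun p hp t ht => ?_, fun p hp t ht => ?_⟩
  · have hl : Tendsto (fun n => dist (Xn n t p)
        (p.1 + ∫ s in (0 : ℝ)..t, Real.exp (-(γ * s)) • Un n s p)) atTop
        (𝓝 (dist (X t p) (p.1 + ∫ s in (0 : ℝ)..t, Real.exp (-(γ * s)) • U s p))) := by
      refine (hXlim t ht p hp).dist (Tendsto.const_add _ (tendsto_iff_dist_tendsto_zero.2 ?_))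
      refine squeeze_zero (fun _ => dist_nonneg) (fun n => (iU p hp).2 n t ht) ?_
      simpa using hη.mul_const T
    exact le_of_tendsto_of_tendsto' hl hδ fun n => (h n).eq_X p hp t ht
  · have hl : Tendsto (fun n => dist (Un n t p)
        (p.2 + ∫ s in (0 : ℝ)..t, accel k μ (Xn n s) (Un n s) (Xn n s p))) atTop
        (𝓝 (dist (U t p) (p.2 + ∫ s in (0 : ℝ)..t, accel k μ (X s) (U s) (X s p)))) := by
      refine (hUlim t ht p hp).dist (Tendsto.const_add _ (tendsto_iff_dist_tendsto_zero.2 ?_))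
      refine squeeze_zero (fun _ => dist_nonneg) (fun n => (iA p hp).2 n t ht) ?_
      simpa using hε.mul_const T
    exact le_of_tendsto_of_tendsto' hl hδ fun n => (h n).eq_U p hp t ht

end Limits

section Existence

open Filter Topology

variable {E : Type*} [NormedAddCommGroup E] [InnerProductSpace ℝ E] [FiniteDimensional ℝ E]
  [MeasurableSpace E] [BorelSpace E]
variable [Nontrivial E] {k : ℝ → ℝ} {L k₀ γ T : ℝ} {μ : Measure (E × E)} [IsProbabilityMeasure μ]
  {C : NNReal} {Rx Rv : ℝ}

lemma exists_flow (hk : LipWeight k L k₀) (hγ : γ = ∫ z in (0 : ℝ)..1, k z)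
    (hγ0 : 0 ≤ γ) (hT : 0 < T) (hμ : IsDatum μ C Rx Rv) :
    ∃ X U : ℝ → E × E → E,
      (∀ t ∈ Icc 0 T, Measurable (X t) ∧ Measurable (U t)) ∧
      (∀ t ∈ Icc 0 T, DensityBound μ (fun p => (X t p, U t p)) C) ∧
      (∀ t ∈ Icc 0 T, ∀ p ∈ closedBall (0 : E) Rx ×ˢ closedBall (0 : E) Rv,
        ‖X t p‖ ≤ Rx + t * Rv ∧ ‖U t p‖ ≤ Real.exp (γ * t) * Rv) ∧
      ∀ P, max Rx Rv ≤ P →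
        IsApproxSol k γ T μ X U (closedBall 0 P) (trajBound γ T Rv P) 0 := by
  set h : ℕ → ℝ := fun n => T / (n + 1) with hdef
  have hh : ∀ n, 0 < h n := fun n => by positivity
  have hlim0 : Tendsto h atTop (𝓝 0) := by
    have := tendsto_one_div_add_atTop_nhds_zero_nat.const_mul T
    simpa [hdef, div_eq_mul_inv] using this
  set Z : ℕ → ℝ → E × E → E × E := fun n t => splitScheme k γ (h n) μ ⌊t / h n⌋₊ with hZ
  have hfl : ∀ n, ∀ t ∈ Icc 0 T, h n * ⌊t / h n⌋₊ ≤ t := fun n t ht => mul_floor_le (hh n) ht.1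
  have hdens : ∀ n t, DensityBound μ (fun p => ((Z n t p).1, (Z n t p).2)) C := fun n t =>
    splitScheme_densityBound hk hγ hγ0 (hh n).le hμ _
  have hbox : ∀ P, max Rx Rv ≤ P →
      closedBall (0 : E) Rx ×ˢ closedBall (0 : E) Rv ⊆ closedBall (0 : E × E) P := by
    intro P hP p hp
    rw [mem_closedBall_zero_iff, Prod.norm_def]
    exact max_le ((mem_closedBall_zero_iff.1 hp.1).trans ((le_max_left _ _).trans hP))
      ((mem_closedBall_zero_iff.1 hp.2).trans ((le_max_right _ _).trans hP))
  have approx : ∀ P, max Rx Rv ≤ P → ∃ c D, 0 ≤ c ∧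
      (∀ n, ∀ t ∈ Icc 0 T, RingBound μ (fun p => (Z n t p).1) (trajBound γ T Rv P) c) ∧
      ∀ n, IsApproxSol k γ T μ (fun t p => (Z n t p).1) (fun t p => (Z n t p).2)
        (closedBall 0 P) (trajBound γ T Rv P) (D * h n) := by
    intro P hP
    have hR : 0 ≤ trajBound γ T Rv P := by
      have := hμ.Rv_nonneg
      have : 0 ≤ P := hμ.Rx_nonneg.trans ((le_max_left _ _).trans hP)
      unfold trajBound
      positivity
    have hS := hμ.supp.mono fun p hp => hbox P hP hp
    obtain ⟨c, hc, hring⟩ := exists_ringBound_of_densityBound E μ C hR hR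
    have hr : ∀ n, ∀ j : ℕ, h n * j ≤ T →
        RingBound μ (fun p => (splitScheme k γ (h n) μ j p).1) (trajBound γ T Rv P) c := by
      intro n j hj
      refine hring _ (fun p => (splitScheme k γ (h n) μ j p).2)
        (splitScheme_densityBound hk hγ hγ0 (hh n).le hμ j) (hS.mono fun p hp => ?_)
        (hS.mono fun p hp => ?_)
      · exact (splitScheme_norm_le hk hγ hγ0 (hh n).le hμ (mem_closedBall_zero_iff.1 hp) j hj).1
      · exact (splitScheme_norm_le hk hγ hγ0 (hh n).le hμ (mem_closedBall_zero_iff.1 hp) j hj).2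
    exact ⟨c, _, hc, fun n t ht => hr n _ ((hfl n t ht).trans ht.2), fun n =>
      isApproxSol_splitScheme hk hγ hγ0 (hh n) hT.le hμ hS hc (hr n)⟩
  have cauchy : ∀ P, max Rx Rv ≤ P → ∃ D, ∀ t ∈ Icc 0 T, ∀ p ∈ closedBall (0 : E × E) P,
      ∀ n m, dist (Z n t p) (Z m t p) ≤ D * (h n + h m) := by
    intro P hP
    obtain ⟨c, D, hc, hring, happ⟩ := approx P hP
    refine ⟨2 * D * Real.exp ((4 * (L * (c * 2) * trajBound γ T Rv P + k₀) + 2) * T),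
      fun t ht p hp n m => ?_⟩
    have hR : 0 ≤ trajBound γ T Rv P := (norm_nonneg _).trans ((happ n).norm_X t ht p hp)
    have hD : 0 ≤ D * h n := dist_nonneg.trans ((happ n).eq_X p hp t ht)
    have hD0 : 0 ≤ D := nonneg_of_mul_nonneg_left hD (hh n)
    obtain ⟨h1, h2⟩ := (happ n).dist_le hk hγ0 (happ m)
      (hμ.supp.mono fun p hp => hbox P hP hp) hc (hring n) ht hp
    have h3 : 2 * (D * h n + D * h m) *
        Real.exp ((4 * (L * (c * 2) * trajBound γ T Rv P + k₀) + 2) * t) ≤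
        2 * D * Real.exp ((4 * (L * (c * 2) * trajBound γ T Rv P + k₀) + 2) * T) *
          (h n + h m) := by
      have h4 : Real.exp ((4 * (L * (c * 2) * trajBound γ T Rv P + k₀) + 2) * t) ≤
          Real.exp ((4 * (L * (c * 2) * trajBound γ T Rv P + k₀) + 2) * T) := by
        have := hk.L_nonneg
        have := hk.k₀_nonneg
        gcongr
        exact ht.2
      have h5 : 0 ≤ 2 * (D * h n + D * h m) := by
        have := (hh n).le
        have := (hh m).le
        positivity
      refine (mul_le_mul_of_nonneg_left h4 h5).trans (le_of_eq ?_)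
      ring
    rw [Prod.dist_eq]
    exact max_le (h1.trans h3) (h2.trans h3)
  have hPP : ∀ p : E × E, max Rx Rv ≤ max (max Rx Rv) ‖p‖ ∧
      p ∈ closedBall (0 : E × E) (max (max Rx Rv) ‖p‖) := fun p =>
    ⟨le_max_left _ _, mem_closedBall_zero_iff.2 (le_max_right _ _)⟩
  have hex : ∀ t p, ∃ z, t ∈ Icc 0 T → Tendsto (fun n => Z n t p) atTop (𝓝 z) := by
    intro t p
    by_cases ht : t ∈ Icc 0 T
    · obtain ⟨D, hD⟩ := cauchy _ (hPP p).1
      have hD' := hD t ht p (hPP p).2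
      have hc : CauchySeq fun n => Z n t p := by
        refine cauchySeq_of_le_tendsto_0 (fun N => |D| * (2 * h N)) (fun n m N hn hm => ?_) ?_
        · have hanti : ∀ n, N ≤ n → h n ≤ h N := fun n hn => by
            have : (N : ℝ) ≤ n := Nat.cast_le.2 hn
            simp only [hdef]
            gcongr
          refine (hD' n m).trans (mul_le_mul (le_abs_self D) ?_
            (add_nonneg (hh n).le (hh m).le) (abs_nonneg D))
          linarith [hanti n hn, hanti m hm]
        · simpa using (hlim0.const_mul 2).const_mul |D|
      obtain ⟨z, hz⟩ := cauchySeq_tendsto_of_complete hc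
      exact ⟨z, fun _ => hz⟩
    · exact ⟨0, fun h => absurd h ht⟩
  choose Y hY using hex
  have hmeas : ∀ t ∈ Icc 0 T, Measurable (Y t) := fun t ht =>
    measurable_of_tendsto_metrizable (f := fun n => Z n t)
      (fun n => (splitScheme_spec hk hγ hγ0 (hh n).le hμ _).1.measurable)
      (tendsto_pi_nhds.2 fun p => hY t p ht)
  refine ⟨fun t p => (Y t p).1, fun t p => (Y t p).2,
    fun t ht => ⟨(hmeas t ht).fst, (hmeas t ht).snd⟩, fun t ht => ?_, fun t ht p hp => ?_,
    fun P hP => ?_⟩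
  · exact DensityBound.of_tendsto (hdens · t) fun p => hY t p ht
  · have hRv := hμ.Rv_nonneg
    have hb := fun n => (splitScheme_spec hk hγ hγ0 (hh n).le hμ ⌊t / h n⌋₊).2 p hp
    constructor
    · refine le_of_tendsto (hY t p ht).fst_nhds.norm (Eventually.of_forall fun n =>
        (hb n).1.trans ?_)
      have := mul_le_mul_of_nonneg_right (hfl n t ht) hRv
      linarith
    · refine le_of_tendsto (hY t p ht).snd_nhds.norm (Eventually.of_forall fun n =>
        (hb n).2.trans ?_)
      have := hfl n t ht
      gcongr
  · obtain ⟨c, D, hc, hring, happ⟩ := approx P hP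
    obtain ⟨D', hD'⟩ := cauchy P hP
    have hd : ∀ n, ∀ t ∈ Icc 0 T, ∀ p ∈ closedBall (0 : E × E) P,
        dist (Z n t p) (Y t p) ≤ D' * h n := by
      intro n t ht p hp
      have h1 : Tendsto (fun m => D' * (h n + h m)) atTop (𝓝 (D' * (h n + 0))) :=
        (hlim0.const_add _).const_mul _
      rw [add_zero] at h1
      exact le_of_tendsto_of_tendsto' (tendsto_const_nhds.dist (hY t p ht)) h1
        fun m => hD' t ht p hp n m
    have hd0 : ∀ D : ℝ, Tendsto (fun n => D * h n) atTop (𝓝 0) := fun D => by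
      simpa using hlim0.const_mul D
    refine IsApproxSol.of_tendsto hk hγ0 hT.le happ (hμ.supp.mono fun p hp => hbox P hP hp) hring
      (hd0 D) (hd0 D') (fun n t ht p hp => ?_) (fun n t ht p hp => ?_)
      (fun t ht => (hmeas t ht).fst.aestronglyMeasurable)
      (fun t ht => (hmeas t ht).snd.aestronglyMeasurable)
    · exact (le_max_left _ _).trans (hd n t ht p hp)
    · exact (le_max_right _ _).trans (hd n t ht p hp)

end Existence

section Derivative

open Filter Topology

lemma hasDerivWithinAt_of_eq_integral {E : Type*} [NormedAddCommGroup E] [NormedSpace ℝ E]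
    [CompleteSpace E] {y f : ℝ → E} {a : E} {T t : ℝ} (hf : ContinuousOn f (Icc 0 T))
    (hy : ∀ t ∈ Icc 0 T, y t = a + ∫ s in (0 : ℝ)..t, f s) (ht : t ∈ Icc 0 T) :
    HasDerivWithinAt y (f t) (Icc 0 T) t := by
  have hT : 0 ≤ T := ht.1.trans ht.2
  set g := IccExtend hT ((Icc 0 T).domRestrict f) with hg
  have hgc : Continuous g := (continuousOn_iff_continuous_domRestrict.1 hf).Icc_extend'
  have hgf : ∀ s ∈ Icc 0 T, g s = f s := fun s hs => by
    rw [hg, IccExtend_of_mem hT _ hs]; rfl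
  have h1 : HasDerivAt (fun t => a + ∫ s in (0 : ℝ)..t, g s) (g t) t :=
    (hgc.integral_hasStrictDerivAt 0 t).hasDerivAt.const_add a
  rw [← hgf t ht]
  refine h1.hasDerivWithinAt.congr (fun s hs => ?_) ?_
  · rw [hy s hs]
    congr 1
    refine intervalIntegral.integral_congr fun r hr => (hgf r ?_).symm
    rw [uIcc_of_le hs.1] at hr
    exact ⟨hr.1, hr.2.trans hs.2⟩
  · rw [hy t ht]
    congr 1
    refine intervalIntegral.integral_congr fun r hr => (hgf r ?_).symm
    rw [uIcc_of_le ht.1] at hr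
    exact ⟨hr.1, hr.2.trans ht.2⟩

lemma dist_le_of_eq_integral {E : Type*} [NormedAddCommGroup E] [NormedSpace ℝ E]
    {y f : ℝ → E} {a : E} {T M : ℝ} (hf : IntervalIntegrable f volume 0 T)
    (hM : ∀ s ∈ Icc 0 T, ‖f s‖ ≤ M)
    (hy : ∀ t ∈ Icc 0 T, y t = a + ∫ s in (0 : ℝ)..t, f s) {s t : ℝ} (hs : s ∈ Icc 0 T)
    (ht : t ∈ Icc 0 T) : dist (y s) (y t) ≤ M * |s - t| := by
  have hT : 0 ≤ T := ht.1.trans ht.2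
  have hsub : ∀ t ∈ Icc 0 T, IntervalIntegrable f volume 0 t := fun t ht => hf.mono_set (by
    rw [uIcc_of_le ht.1, uIcc_of_le hT]
    exact Icc_subset_Icc_right ht.2)
  rw [hy s hs, hy t ht, dist_add_left, dist_eq_norm,
    intervalIntegral.integral_interval_sub_left (hsub s hs) (hsub t ht)]
  refine intervalIntegral.norm_integral_le_of_norm_le_const fun r hr => hM r ?_
  have := uIcc_subset_Icc ht hs
  exact this (uIoc_subset_uIcc hr)

variable {E : Type*} [NormedAddCommGroup E] [NormedSpace ℝ E] [MeasurableSpace E]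
  {k : ℝ → ℝ} {L k₀ γ T : ℝ} {μ : Measure (E × E)}
  {X U : ℝ → E × E → E} {S : Set (E × E)} {R c : ℝ}

omit [MeasurableSpace E] in
lemma accel_smul {Ω : Type*} [MeasurableSpace Ω] (μ : Measure Ω) (X U : Ω → E) (a : ℝ) (x : E) :
    accel k μ X (fun p => a • U p) x = a • accel k μ X U x := by
  unfold accel
  rw [← integral_smul]
  simp_rw [smul_comm a]

lemma IsApproxSol.eq_integral (h : IsApproxSol k γ T μ X U S R 0) {p : E × E} (hp : p ∈ S) {t : ℝ}
    (ht : t ∈ Icc 0 T) :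
    X t p = p.1 + ∫ s in (0 : ℝ)..t, Real.exp (-(γ * s)) • U s p ∧
      U t p = p.2 + ∫ s in (0 : ℝ)..t, accel k μ (X s) (U s) (X s p) :=
  ⟨dist_le_zero.1 (h.eq_X p hp t ht), dist_le_zero.1 (h.eq_U p hp t ht)⟩

lemma IsApproxSol.dist_time_le [IsProbabilityMeasure μ] (hk : LipWeight k L k₀) (hγ : 0 ≤ γ)
    (h : IsApproxSol k γ T μ X U S R 0)
    (hS : ∀ᵐ p ∂μ, p ∈ S) {p : E × E} (hp : p ∈ S) {s t : ℝ} (hs : s ∈ Icc 0 T)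
    (ht : t ∈ Icc 0 T) :
    dist (X s p) (X t p) ≤ (1 + k₀) * R * |s - t| ∧
      dist (U s p) (U t p) ≤ (1 + k₀) * R * |s - t| := by
  have hR : 0 ≤ R := (norm_nonneg _).trans (h.norm_X t ht p hp)
  have hk₀ := hk.k₀_nonneg
  constructor
  · refine dist_le_of_eq_integral (h.intble_U p hp) (fun r hr => ?_)
      (fun t ht => (h.eq_integral hp ht).1) hs ht
    rw [norm_smul, Real.norm_of_nonneg (Real.exp_pos _).le]
    have h1 : Real.exp (-(γ * r)) ≤ 1 :=
      Real.exp_le_one_iff.2 (neg_nonpos.2 (mul_nonneg hγ hr.1))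
    exact mul_le_mul (h1.trans (by linarith)) (h.norm_U r hr p hp) (norm_nonneg _) (by linarith)
  · refine dist_le_of_eq_integral (h.intble_accel p hp) (fun r hr => ?_)
      (fun t ht => (h.eq_integral hp ht).2) hs ht
    refine (norm_accel_le hk (hS.mono fun q hq => h.norm_U r hr q hq) _).trans ?_
    nlinarith

lemma IsApproxSol.hasDerivWithinAt [CompleteSpace E] [IsProbabilityMeasure μ]
    (hk : LipWeight k L k₀) (hγ : 0 ≤ γ) (h : IsApproxSol k γ T μ X U S R 0)
    (hS : ∀ᵐ p ∂μ, p ∈ S) (hc : 0 ≤ c) (hring : ∀ t ∈ Icc 0 T, RingBound μ (X t) R c)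
    {p : E × E} (hp : p ∈ S) {t : ℝ} (ht : t ∈ Icc 0 T) :
    HasDerivWithinAt (fun s => X s p) (Real.exp (-(γ * t)) • U t p) (Icc 0 T) t ∧
      HasDerivWithinAt (fun s => U s p) (accel k μ (X t) (U t) (X t p)) (Icc 0 T) t := by
  have hR : 0 ≤ R := (norm_nonneg _).trans (h.norm_X t ht p hp)
  have hk₀ := hk.k₀_nonneg
  have hA : 0 ≤ L * (c * 2) * R + k₀ := by have := hk.L_nonneg; positivity
  have hcU : ContinuousOn (fun s => U s p) (Icc 0 T) := by
    have : LipschitzOnWith ⟨(1 + k₀) * R, by positivity⟩ (fun s => U s p) (Icc 0 T) :=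
      LipschitzOnWith.of_dist_le_mul fun s hs t ht => (h.dist_time_le hk hγ hS hp hs ht).2
    exact this.continuousOn
  constructor
  · refine hasDerivWithinAt_of_eq_integral (f := fun s => Real.exp (-(γ * s)) • U s p) ?_
      (fun t ht => (h.eq_integral hp ht).1) ht
    exact (by fun_prop : Continuous fun s : ℝ => Real.exp (-(γ * s))).continuousOn.smul hcU
  · refine hasDerivWithinAt_of_eq_integral (f := fun s => accel k μ (X s) (U s) (X s p)) ?_
      (fun t ht => (h.eq_integral hp ht).2) ht
    have : LipschitzOnWith ⟨(L * (c * 2) * R + k₀) * (2 * ((1 + k₀) * R)), by positivity⟩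
        (fun s => accel k μ (X s) (U s) (X s p)) (Icc 0 T) := by
      refine LipschitzOnWith.of_dist_le_mul fun s hs t ht => ?_
      have hd := fun q (hq : q ∈ S) => h.dist_time_le hk hγ hS hq hs ht
      refine (accel_sub_le hk (h.meas_X s hs) (h.meas_X t ht) (h.meas_U s hs) (h.meas_U t ht)
        (hring s hs) (h.norm_X s hs p hp) (δ := (1 + k₀) * R * |s - t|) (by positivity)
        (hS.mono fun q hq => (hd q hq).1) (hS.mono fun q hq => (hd q hq).2)
        (hS.mono fun q hq => h.norm_U s hs q hq)).trans ?_
      change _ ≤ (L * (c * 2) * R + k₀) * (2 * ((1 + k₀) * R)) * |s - t|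
      rw [mul_assoc (L * (c * 2) * R + k₀)]
      refine mul_le_mul_of_nonneg_left ?_ hA
      linarith [(hd p hp).1]
    exact this.continuousOn

end Derivative

section WField

open Filter Topology

variable {d : ℕ}

/-- The law of `Z` under `μ` has density `g`. -/
structure HasDensity {Ω F : Type*} [MeasurableSpace Ω] [MeasureSpace F] (μ : Measure Ω) (Z : Ω → F)
    (g : F → ℝ) : Prop where
  meas : AEMeasurable Z μ
  meas_density : Measurable g
  nonneg : ∀ p, 0 ≤ g p
  map_eq : μ.map Z = volume.withDensity fun p => ENNReal.ofReal (g p)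

variable {Ω : Type*} [MeasurableSpace Ω] {μ : Measure Ω} [IsProbabilityMeasure μ]
  {X V : Ω → EuclideanSpace ℝ (Fin d)}
  {g : EuclideanSpace ℝ (Fin d) × EuclideanSpace ℝ (Fin d) → ℝ}

lemma HasDensity.integrable {F : Type*} [MeasureSpace F] {Z : Ω → F} {g : F → ℝ}
    (h : HasDensity μ Z g) : Integrable g := by
  refine ⟨h.meas_density.aestronglyMeasurable, ?_⟩
  rw [hasFiniteIntegral_iff_ofReal (Eventually.of_forall h.nonneg)]
  have : (μ.map Z) univ < ⊤ := by
    have := Measure.isProbabilityMeasure_map h.meas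
    exact measure_lt_top _ _
  rwa [h.map_eq, withDensity_apply _ MeasurableSet.univ, Measure.restrict_univ] at this

lemma HasDensity.Mdens_eq (h : HasDensity μ (fun p => (X p, V p)) g)
    (x : EuclideanSpace ℝ (Fin d)) (r : ℝ) : Mdens (Smarg g) x r = massIn μ X x r := by
  have hm : MeasurableSet (closedBall x r ×ˢ (univ : Set (EuclideanSpace ℝ (Fin d)))) :=
    measurableSet_closedBall.prod MeasurableSet.univ
  have h1 : {q | dist x (X q) ≤ r} =
      (fun p => (X p, V p)) ⁻¹' (closedBall x r ×ˢ (univ : Set (EuclideanSpace ℝ (Fin d)))) := by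
    ext q
    simp only [mem_ofPred_eq, mem_preimage, mem_prod, mem_closedBall, mem_univ, and_true]
    rw [dist_comm]
  rw [massIn, h1, Measure.real, ← Measure.map_apply_of_aemeasurable h.meas hm, h.map_eq,
    withDensity_apply _ hm, ← integral_eq_lintegral_of_nonneg_ae
      (Eventually.of_forall h.nonneg) h.meas_density.aestronglyMeasurable.restrict]
  have h2 := setIntegral_prod (μ := (volume : Measure (EuclideanSpace ℝ (Fin d))))
    (ν := (volume : Measure (EuclideanSpace ℝ (Fin d)))) g (s := closedBall x r) (t := univ)
    h.integrable.integrableOn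
  rw [← Measure.volume_eq_prod] at h2
  rw [h2]
  simp [Mdens, Smarg]

lemma HasDensity.Wfield_eq_integral {k : ℝ → ℝ} {L k₀ : ℝ} (hk : LipWeight k L k₀) {K : ℝ → ℝ}
    (hKk : ∀ z ∈ Icc (0 : ℝ) 1, K z = k z) (h : HasDensity μ (fun p => (X p, V p)) g)
    (x v : EuclideanSpace ℝ (Fin d)) :
    Wfield K (Smarg g) g x v = ∫ q, k (massIn μ X x (dist x (X q))) • (V q - v) ∂μ := by
  unfold Wfield
  have hm : Measurable fun p : EuclideanSpace ℝ (Fin d) × EuclideanSpace ℝ (Fin d) =>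
      k (massIn μ X x (dist x p.1)) • (p.2 - v) :=
    (hk.continuous.measurable.comp ((massIn_mono X x).measurable.comp (by fun_prop))).smul
      (measurable_snd.sub_const v)
  have h1 := integral_map h.meas (f := fun p : EuclideanSpace ℝ (Fin d) ×
    EuclideanSpace ℝ (Fin d) => k (massIn μ X x (dist x p.1)) • (p.2 - v))
    hm.aestronglyMeasurable
  rw [← h1, h.map_eq, integral_withDensity_eq_integral_toReal_smul
    h.meas_density.ennreal_ofReal (by simp)]
  refine integral_congr_ae (Eventually.of_forall fun p => ?_)
  change (K (Mdens (Smarg g) x (dist x p.1)) * g p) • (p.2 - v) =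
    (ENNReal.ofReal (g p)).toReal • k (massIn μ X x (dist x p.1)) • (p.2 - v)
  rw [h.Mdens_eq, hKk _ ⟨massIn_nonneg _ _ _, massIn_le_one _ _ _⟩,
    ENNReal.toReal_ofReal (h.nonneg p), smul_smul, mul_comm]

lemma HasDensity.integrable_iff {k : ℝ → ℝ} {L k₀ k₁ : ℝ} (hk : LipWeight k L k₀) (hk₁ : 0 < k₁)
    (hk₁' : ∀ z, k₁ ≤ k z) (h : HasDensity μ (fun p => (X p, V p)) g)
    (x v : EuclideanSpace ℝ (Fin d)) :
    Integrable (fun q => k (massIn μ X x (dist x (X q))) • (V q - v)) μ ↔ Integrable V μ := by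
  have hX : AEStronglyMeasurable X μ := h.meas.fst.aestronglyMeasurable
  have hV : AEStronglyMeasurable V μ := h.meas.snd.aestronglyMeasurable
  constructor
  · intro hi
    have h1 : Integrable (fun q => V q - v) μ := by
      refine (hi.norm.const_mul k₁⁻¹).mono' (hV.sub aestronglyMeasurable_const)
        (Eventually.of_forall fun q => ?_)
      rw [norm_smul, Real.norm_of_nonneg (hk.nonneg _), ← mul_assoc]
      refine le_mul_of_one_le_left (norm_nonneg _) ?_
      rw [inv_mul_eq_div, one_le_div hk₁]
      exact hk₁' _
    exact (h1.add (integrable_const v)).congr (Eventually.of_forall fun q => by simp)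
  · intro hi
    exact integrable_accel hk hX (hi.sub (integrable_const v)) x

omit [IsProbabilityMeasure μ] in
lemma HasDensity.null {F : Type*} [MeasureSpace F] {Z : Ω → F} {g : F → ℝ} (h : HasDensity μ Z g)
    {S : Set F} (hS : volume S = 0) : μ (Z ⁻¹' S) = 0 := by
  have h1 : (μ.map Z) (toMeasurable volume S) = 0 := by
    rw [h.map_eq]
    exact withDensity_absolutelyContinuous _ _ (by rwa [measure_toMeasurable])
  rw [Measure.map_apply_of_aemeasurable h.meas (measurableSet_toMeasurable _ _)] at h1
  exact measure_mono_null (preimage_mono (subset_toMeasurable volume S)) h1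

omit [IsProbabilityMeasure μ] in
lemma HasDensity.fst_null (h : HasDensity μ (fun p => (X p, V p)) g)
    {S : Set (EuclideanSpace ℝ (Fin d))} (hS : volume S = 0) : μ (X ⁻¹' S) = 0 := by
  have h1 : volume (S ×ˢ (univ : Set (EuclideanSpace ℝ (Fin d)))) = 0 := by
    rw [Measure.volume_eq_prod, Measure.prod_prod, hS, zero_mul]
  have h2 := h.null h1
  rwa [mk_preimage_prod, preimage_univ, inter_univ] at h2

lemma HasDensity.Wfield_eq [Nontrivial (EuclideanSpace ℝ (Fin d))] {k : ℝ → ℝ} {L k₀ γ : ℝ}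
    (hk : LipWeight k L k₀) {K : ℝ → ℝ}
    (hKk : ∀ z ∈ Icc (0 : ℝ) 1, K z = k z) (hγ : γ = ∫ z in (0 : ℝ)..1, k z)
    (h : HasDensity μ (fun p => (X p, V p)) g) (hV : Integrable V μ)
    (x v : EuclideanSpace ℝ (Fin d)) :
    Wfield K (Smarg g) g x v = accel k μ X V x - γ • v := by
  have hX : AEStronglyMeasurable X μ := h.meas.fst.aestronglyMeasurable
  rw [h.Wfield_eq_integral hk hKk]
  simp_rw [smul_sub]
  rw [integral_sub (integrable_accel hk hX hV x) (integrable_accel hk hX (integrable_const v) x),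
    integral_smul_const, integral_weight hX (fun S hS => h.fst_null hS) hk.continuous, ← hγ]
  rfl

lemma HasDensity.Wfield_eq_zero {k : ℝ → ℝ} {L k₀ k₁ : ℝ}
    (hk : LipWeight k L k₀) (hk₁ : 0 < k₁) (hk₁' : ∀ z, k₁ ≤ k z) {K : ℝ → ℝ}
    (hKk : ∀ z ∈ Icc (0 : ℝ) 1, K z = k z)
    (h : HasDensity μ (fun p => (X p, V p)) g) (hV : ¬ Integrable V μ)
    (x v : EuclideanSpace ℝ (Fin d)) :
    Wfield K (Smarg g) g x v = 0 := by
  rw [h.Wfield_eq_integral hk hKk]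
  exact integral_undef fun hi => hV ((h.integrable_iff hk hk₁ hk₁' x v).1 hi)

end WField

section Density

open Filter Topology

open Module

variable {Ω F : Type*} [MeasurableSpace Ω] {μ : Measure Ω} [IsProbabilityMeasure μ]
  [MeasureSpace F] [SigmaFinite (volume : Measure F)] {Z Z' : Ω → F} {g g' : F → ℝ} {C : NNReal}

lemma DensityBound.exists_hasDensity (h : DensityBound μ Z C) (hZ : AEMeasurable Z μ) {A : Set F}
    (hA : MeasurableSet A) (hZA : ∀ᵐ q ∂μ, Z q ∈ A) :
    ∃ g, HasDensity μ Z g ∧ (∀ p, g p ≠ 0 → p ∈ A) ∧ ∀ᵐ p, g p ≤ C := by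
  have hp := Measure.isProbabilityMeasure_map hZ
  have hac : μ.map Z ≪ volume := by
    refine Measure.AbsolutelyContinuous.mk fun S hS h0 => ?_
    rw [Measure.map_apply_of_aemeasurable hZ hS]
    exact h.null h0
  have hle : (μ.map Z).rnDeriv volume ≤ᵐ[volume] fun _ => (C : ENNReal) := by
    refine ae_le_of_forall_setLIntegral_le_of_sigmaFinite (Measure.measurable_rnDeriv _ _)
      fun S hS _ => ?_
    rw [setLIntegral_const]
    refine (Measure.setLIntegral_rnDeriv_le S).trans ?_
    rw [Measure.map_apply_of_aemeasurable hZ hS]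
    exact h S hS
  refine ⟨A.indicator fun p => ((μ.map Z).rnDeriv volume p).toReal,
    ⟨hZ, (Measure.measurable_rnDeriv _ _).ennreal_toReal.indicator hA,
      fun p => indicator_nonneg (fun _ _ => ENNReal.toReal_nonneg) p, ?_⟩,
    fun p hp => mem_of_indicator_ne_zero hp, ?_⟩
  · have h1 : (fun p => ENNReal.ofReal
        (A.indicator (fun p => ((μ.map Z).rnDeriv volume p).toReal) p)) =ᵐ[volume]
        A.indicator ((μ.map Z).rnDeriv volume) := by
      filter_upwards [hle] with p hp
      by_cases hpA : p ∈ A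
      · simp only [indicator_of_mem hpA]
        exact ENNReal.ofReal_toReal (hp.trans_lt ENNReal.coe_lt_top).ne
      · simp [indicator_of_notMem hpA]
    rw [withDensity_congr_ae h1, withDensity_indicator hA, ← restrict_withDensity hA,
      Measure.withDensity_rnDeriv_eq _ _ hac, Measure.restrict_eq_self_of_ae_mem]
    exact (ae_map_iff hZ hA).2 hZA
  · filter_upwards [hle] with p hp
    refine (indicator_le_self' (fun _ _ => ENNReal.toReal_nonneg) p).trans ?_
    exact ENNReal.toReal_le_coe_of_le_coe hp

omit [SigmaFinite (volume : Measure F)] [IsProbabilityMeasure μ] in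
lemma HasDensity.integral_mul (h : HasDensity μ Z g) {α : F → ℝ} (hα : Measurable α) :
    ∫ p, α p * g p = ∫ q, α (Z q) ∂μ := by
  rw [← integral_map h.meas hα.aestronglyMeasurable, h.map_eq,
    integral_withDensity_eq_integral_toReal_smul h.meas_density.ennreal_ofReal (by simp)]
  refine integral_congr_ae (Eventually.of_forall fun p => ?_)
  simp [ENNReal.toReal_ofReal (h.nonneg p), mul_comm]

omit [SigmaFinite (volume : Measure F)] in
lemma HasDensity.integral_eq_one (h : HasDensity μ Z g) : ∫ p, g p = 1 := by
  have := h.integral_mul (α := fun _ => 1) measurable_const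
  simpa using this

omit [IsProbabilityMeasure μ] in
lemma HasDensity.ae_eq (h : HasDensity μ Z g) (h' : HasDensity μ Z' g') (hZ : Z =ᵐ[μ] Z') :
    g =ᵐ[volume] g' := by
  have h1 := h.map_eq
  rw [Measure.map_congr hZ, h'.map_eq,
    withDensity_eq_iff_of_sigmaFinite h'.meas_density.ennreal_ofReal.aemeasurable
      h.meas_density.ennreal_ofReal.aemeasurable] at h1
  filter_upwards [h1] with p hp
  exact ((ENNReal.ofReal_eq_ofReal_iff (h'.nonneg p) (h.nonneg p)).1 hp).symm

lemma DensityBound.smul_snd {E : Type*} [NormedAddCommGroup E] [InnerProductSpace ℝ E]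
    [FiniteDimensional ℝ E] [MeasurableSpace E] [BorelSpace E] {Ω : Type*} [MeasurableSpace Ω]
    {μ : Measure Ω} {X U : Ω → E} {C : NNReal} (h : DensityBound μ (fun p => (X p, U p)) C) {a : ℝ}
    (ha : 0 < a) :
    DensityBound μ (fun p => (X p, a • U p)) (C * Real.toNNReal ((a ^ finrank ℝ E)⁻¹)) := by
  intro S hS
  have hm : Measurable (Prod.map id (fun v => a • v) : E × E → E × E) := by fun_prop
  have h2 : volume ((Prod.map id (fun v => a • v) : E × E → E × E) ⁻¹' S) =
      ENNReal.ofReal ((a ^ finrank ℝ E)⁻¹) * volume S := by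
    rw [← Measure.map_apply hm hS, Measure.volume_eq_prod,
      ← Measure.map_prod_map _ _ measurable_id (measurable_const_smul a), Measure.map_id,
      Measure.map_addHaar_smul _ ha.ne', abs_of_pos (by positivity), Measure.prod_smul_right]
    rfl
  have h1 := h _ (hm hS)
  rw [h2] at h1
  rw [ENNReal.coe_mul, mul_assoc]
  exact h1

end Density

section Existence

open Filter Topology

variable {d : ℕ} [Nontrivial (EuclideanSpace ℝ (Fin d))] {k K : ℝ → ℝ} {L k₀ γ T Rx Rv B : ℝ}
  {f₀ : EuclideanSpace ℝ (Fin d) × EuclideanSpace ℝ (Fin d) → ℝ}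

lemma isProbabilityMeasure_withDensity_ofReal {F : Type*} [MeasureSpace F] {g : F → ℝ}
    (hg : ∀ p, 0 ≤ g p) (h1 : ∫ p, g p = 1) :
    IsProbabilityMeasure (volume.withDensity fun p => ENNReal.ofReal (g p)) := by
  refine ⟨?_⟩
  rw [withDensity_apply _ MeasurableSet.univ, Measure.restrict_univ,
    ← ofReal_integral_eq_lintegral_ofReal (.of_integral_ne_zero (by simp [h1]))
    (Eventually.of_forall hg), h1, ENNReal.ofReal_one]

lemma integral_withDensity_ofReal {F : Type*} [MeasureSpace F] {g : F → ℝ}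
    (hg : ∀ p, 0 ≤ g p) (hgm : Measurable g) (β : F → ℝ) :
    ∫ p, β p ∂(volume.withDensity fun p => ENNReal.ofReal (g p)) = ∫ p, β p * g p := by
  rw [integral_withDensity_eq_integral_toReal_smul hgm.ennreal_ofReal (by simp)]
  refine integral_congr_ae (Eventually.of_forall fun p => ?_)
  simp [ENNReal.toReal_ofReal (hg p), mul_comm]

omit [Nontrivial (EuclideanSpace ℝ (Fin d))] in
lemma isDatum_withDensity (hRx : 0 ≤ Rx) (hRv : 0 ≤ Rv)
    (hf₀ : Measurable f₀) (hB : ∀ᵐ p, f₀ p ≤ B)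
    (hsupp : ∀ p, f₀ p ≠ 0 → p ∈ closedBall (0 : EuclideanSpace ℝ (Fin d)) Rx ×ˢ
      closedBall (0 : EuclideanSpace ℝ (Fin d)) Rv) :
    IsDatum (volume.withDensity fun p => ENNReal.ofReal (f₀ p)) B.toNNReal Rx Rv where
  le := by
    intro S hS
    rw [preimage_id', withDensity_apply _ hS, ← setLIntegral_const]
    refine lintegral_mono_ae (ae_restrict_of_ae ?_)
    filter_upwards [hB] with p hp
    exact ENNReal.ofReal_le_ofReal hp
  supp := by
    refine (ae_withDensity_iff hf₀.ennreal_ofReal).2 (Eventually.of_forall fun p hp => hsupp p ?_)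
    intro h0
    simp [h0] at hp
  Rx_nonneg := hRx
  Rv_nonneg := hRv

theorem exists_weakSol (hk : LipWeight k L k₀) (hKk : ∀ z ∈ Icc (0 : ℝ) 1, K z = k z)
    (hγ : γ = ∫ z in (0 : ℝ)..1, k z) (hγ0 : 0 ≤ γ) (hT : 0 < T)
    (hRx : 0 ≤ Rx) (hRv : 0 ≤ Rv) (hB0 : 0 ≤ B)
    (hf₀ : Measurable f₀) (hf₀' : ∀ p, 0 ≤ f₀ p) (h1 : ∫ p, f₀ p = 1) (hB : ∀ᵐ p, f₀ p ≤ B)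
    (hsupp : ∀ p, f₀ p ≠ 0 → p ∈ closedBall (0 : EuclideanSpace ℝ (Fin d)) Rx ×ˢ
      closedBall (0 : EuclideanSpace ℝ (Fin d)) Rv)
    {μ : Measure (EuclideanSpace ℝ (Fin d) × EuclideanSpace ℝ (Fin d))}
    (hμ : μ = volume.withDensity fun p => ENNReal.ofReal (f₀ p)) :
    ∃ (f : ℝ → EuclideanSpace ℝ (Fin d) × EuclideanSpace ℝ (Fin d) → ℝ)
      (X U : ℝ → EuclideanSpace ℝ (Fin d) × EuclideanSpace ℝ (Fin d) → EuclideanSpace ℝ (Fin d)),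
      IsWeakSolCS K T f₀ f ∧
      (∀ t ∈ Icc 0 T, ∀ p, f t p ≠ 0 →
        p ∈ closedBall (0 : EuclideanSpace ℝ (Fin d)) (Rx + t * Rv) ×ˢ
          closedBall (0 : EuclideanSpace ℝ (Fin d)) Rv) ∧
      (∀ t ∈ Icc 0 T, ∀ᵐ p, f t p ≤ B * Real.exp (d * γ * t)) ∧
      (∀ t ∈ Icc 0 T, HasDensity μ (fun p => (X t p, Real.exp (-(γ * t)) • U t p)) (f t)) ∧
      (∀ t ∈ Icc 0 T, DensityBound μ (fun p => (X t p, U t p)) B.toNNReal) ∧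
      IsApproxSol k γ T μ X U (closedBall 0 (max Rx Rv)) (trajBound γ T Rv (max Rx Rv)) 0 := by
  have hprob : IsProbabilityMeasure μ := hμ ▸ isProbabilityMeasure_withDensity_ofReal hf₀' h1
  have hdat : IsDatum μ B.toNNReal Rx Rv := hμ ▸ isDatum_withDensity hRx hRv hf₀ hB hsupp
  obtain ⟨X, U, hm, hD, hbox, hsol⟩ := exists_flow hk hγ hγ0 hT hdat
  have hZm : ∀ t ∈ Icc 0 T, Measurable fun p => (X t p, Real.exp (-(γ * t)) • U t p) := by
    intro t ht
    have h2 := (hm t ht).2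
    exact (hm t ht).1.prodMk (by fun_prop)
  have hZbox : ∀ t ∈ Icc 0 T, ∀ᵐ p ∂μ, (X t p, Real.exp (-(γ * t)) • U t p) ∈
      closedBall (0 : EuclideanSpace ℝ (Fin d)) (Rx + t * Rv) ×ˢ
        closedBall (0 : EuclideanSpace ℝ (Fin d)) Rv := by
    intro t ht
    filter_upwards [hdat.supp] with p hp
    refine ⟨mem_closedBall_zero_iff.2 (hbox t ht p hp).1, mem_closedBall_zero_iff.2 ?_⟩
    rw [norm_smul, Real.norm_of_nonneg (Real.exp_pos _).le]
    calc _ ≤ Real.exp (-(γ * t)) * (Real.exp (γ * t) * Rv) :=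
          mul_le_mul_of_nonneg_left (hbox t ht p hp).2 (Real.exp_pos _).le
      _ = Rv := by rw [← mul_assoc, ← Real.exp_add]; simp
  have hex : ∀ t, ∃ g : EuclideanSpace ℝ (Fin d) × EuclideanSpace ℝ (Fin d) → ℝ,
      t ∈ Icc 0 T → HasDensity μ (fun p => (X t p, Real.exp (-(γ * t)) • U t p)) g ∧
        (∀ p, g p ≠ 0 → p ∈ closedBall (0 : EuclideanSpace ℝ (Fin d)) (Rx + t * Rv) ×ˢ
          closedBall (0 : EuclideanSpace ℝ (Fin d)) Rv) ∧
        ∀ᵐ p, g p ≤ B * Real.exp (d * γ * t) := by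
    intro t
    by_cases ht : t ∈ Icc 0 T
    · obtain ⟨g, hg1, hg2, hg3⟩ := ((hD t ht).smul_snd (Real.exp_pos (-(γ * t)))).exists_hasDensity
        (hZm t ht).aemeasurable (measurableSet_closedBall.prod measurableSet_closedBall)
        (hZbox t ht)
      refine ⟨g, fun _ => ⟨hg1, hg2, hg3.mono fun p hp => hp.trans (le_of_eq ?_)⟩⟩
      rw [NNReal.coe_mul, Real.coe_toNNReal _ hB0, Real.coe_toNNReal _ (by positivity),
        ← Real.exp_nat_mul, ← Real.exp_neg, finrank_euclideanSpace_fin]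
      congr 2
      ring
    · exact ⟨0, fun h => absurd h ht⟩
  choose f hf using hex
  have hS : ∀ P, max Rx Rv ≤ P → ∀ᵐ p ∂μ, p ∈ closedBall
      (0 : EuclideanSpace ℝ (Fin d) × EuclideanSpace ℝ (Fin d)) P := by
    intro P hP
    filter_upwards [hdat.supp] with p hp
    rw [mem_closedBall_zero_iff, Prod.norm_def]
    exact max_le ((mem_closedBall_zero_iff.1 hp.1).trans ((le_max_left _ _).trans hP))
      ((mem_closedBall_zero_iff.1 hp.2).trans ((le_max_right _ _).trans hP))
  have hder : ∀ p, ∀ t ∈ Icc 0 T,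
      HasDerivWithinAt (fun s => X s p) (Real.exp (-(γ * t)) • U t p) (Icc 0 T) t ∧
      HasDerivWithinAt (fun s => Real.exp (-(γ * s)) • U s p)
        (Wfield K (Smarg (f t)) (f t) (X t p) (Real.exp (-(γ * t)) • U t p)) (Icc 0 T) t := by
    intro p t ht
    set P := max (max Rx Rv) ‖p‖
    have hP : max Rx Rv ≤ P := le_max_left _ _
    have hsolP := hsol P hP
    have hpP : p ∈ closedBall 0 P := mem_closedBall_zero_iff.2 (le_max_right _ _)
    have hRP : 0 ≤ trajBound γ T Rv P := (norm_nonneg _).trans (hsolP.norm_X t ht p hpP)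
    obtain ⟨c, hc, hring⟩ := exists_ringBound_of_densityBound (EuclideanSpace ℝ (Fin d)) μ
      B.toNNReal hRP hRP
    obtain ⟨hX, hU⟩ := hsolP.hasDerivWithinAt hk hγ0 (hS P hP) hc (fun s hs => hring _ _ (hD s hs)
      ((hS P hP).mono fun q hq => hsolP.norm_X s hs q hq)
      ((hS P hP).mono fun q hq => hsolP.norm_U s hs q hq)) hpP ht
    refine ⟨hX, ?_⟩
    have hUi : Integrable (U t) μ := Integrable.of_bound (hm t ht).2.aestronglyMeasurable
      (trajBound γ T Rv P) ((hS P hP).mono fun q hq => hsolP.norm_U t ht q hq)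
    have hVi : Integrable (fun q => Real.exp (-(γ * t)) • U t q) μ := hUi.smul (Real.exp (-(γ * t)))
    rw [(hf t ht).1.Wfield_eq hk hKk hγ hVi, accel_smul]
    have he : HasDerivWithinAt (fun s : ℝ => Real.exp (-(γ * s)))
        (Real.exp (-(γ * t)) * (-γ)) (Icc 0 T) t := by
      have := ((hasDerivAt_id t).const_mul γ).neg.exp.hasDerivWithinAt (s := Icc 0 T)
      simpa using this
    refine (he.smul hU).congr_deriv ?_
    rw [sub_eq_add_neg, smul_smul, ← neg_smul, mul_comm _ (-γ), neg_mul]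
  refine ⟨f, X, fun t => U t, ⟨fun t ht => ?_, ⟨B * Real.exp (d * γ * T), fun t ht => ?_⟩, ?_, ?_⟩,
    fun t ht => (hf t ht).2.1, fun t ht => (hf t ht).2.2, fun t ht => (hf t ht).1, hD,
    hsol _ le_rfl⟩
  · exact ⟨(hf t ht).1.meas_density, (hf t ht).1.nonneg, (hf t ht).1.integral_eq_one⟩
  · filter_upwards [(hf t ht).2.2] with p hp
    refine hp.trans (mul_le_mul_of_nonneg_left (Real.exp_le_exp.2 ?_) hB0)
    exact mul_le_mul_of_nonneg_left ht.2 (by positivity)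
  · rintro α hα ⟨C, hC⟩
    have : ContinuousOn (fun t => ∫ q, α (X t q, Real.exp (-(γ * t)) • U t q) ∂μ) (Icc 0 T) := by
      refine continuousOn_of_dominated (bound := fun _ => C)
        (fun t ht => (hα.measurable.comp (hZm t ht)).aestronglyMeasurable)
        (fun t ht => Eventually.of_forall fun q => hC _) (integrable_const _)
        (Eventually.of_forall fun q => hα.comp_continuousOn ?_)
      exact ContinuousOn.prodMk (fun t ht => (hder q t ht).1.continuousWithinAt)
        (fun t ht => (hder q t ht).2.continuousWithinAt)
    exact this.congr fun t ht => (hf t ht).1.integral_mul hα.measurable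
  · refine ⟨fun t p => (X t p, Real.exp (-(γ * t)) • U t p), fun p => ?_, hder,
      fun t ht α hα _ => ?_⟩
    · have h0 : (0 : ℝ) ∈ Icc 0 T := ⟨le_rfl, hT.le⟩
      have := (hsol _ (le_max_left (max Rx Rv) ‖p‖)).eq_integral
        (mem_closedBall_zero_iff.2 (le_max_right _ _)) h0
      simp only [intervalIntegral.integral_same, add_zero] at this
      ext1 <;> simp [this]
    · rw [(hf t ht).1.integral_mul hα.measurable, hμ, integral_withDensity_ofReal hf₀' hf₀]

end Existence

section Flow

open Filter Topology

variable {E : Type*} [NormedAddCommGroup E] [InnerProductSpace ℝ E] [FiniteDimensional ℝ E]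
  [MeasurableSpace E] [BorelSpace E] {k : ℝ → ℝ} {L k₀ γ T : ℝ} {C : NNReal}

/-- The flow of the alignment system. Where the mean speed is infinite, the interaction integral
diverges and the velocities are stationary by convention. -/
structure IsFlow (k : ℝ → ℝ) (γ T : ℝ) (C : NNReal) (μ : Measure (E × E))
    (X V : ℝ → E × E → E) : Prop where
  meas_X : ∀ t ∈ Icc 0 T, AEStronglyMeasurable (X t) μ
  meas_V : ∀ t ∈ Icc 0 T, AEStronglyMeasurable (V t) μ
  density : ∀ t ∈ Icc 0 T, DensityBound μ (fun p => (X t p, V t p)) C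
  init : ∀ p, X 0 p = p.1 ∧ V 0 p = p.2
  deriv_X : ∀ p, ∀ t ∈ Icc 0 T, HasDerivWithinAt (fun s => X s p) (V t p) (Icc 0 T) t
  deriv_V : ∀ p, ∀ t ∈ Icc 0 T, Integrable (V t) μ → HasDerivWithinAt (fun s => V s p)
    (accel k μ (X t) (V t) (X t p) - γ • V t p) (Icc 0 T) t
  deriv_V_zero : ∀ p, ∀ t ∈ Icc 0 T, ¬ Integrable (V t) μ →
    HasDerivWithinAt (fun s => V s p) 0 (Icc 0 T) t

/-- The mean speed, possibly infinite. -/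
def meanSpeed {Ω : Type*} [MeasurableSpace Ω] (μ : Measure Ω) (V : ℝ → Ω → E) (t : ℝ) : ENNReal :=
  ∫⁻ q, ‖V t q‖ₑ ∂μ

variable {μ : Measure (E × E)} {X V : ℝ → E × E → E}

lemma IsFlow.integrable_iff (h : IsFlow k γ T C μ X V) {t : ℝ} (ht : t ∈ Icc 0 T) :
    Integrable (V t) μ ↔ meanSpeed μ V t ≠ ⊤ :=
  ⟨fun hi => hi.2.ne, fun hi => ⟨h.meas_V t ht, lt_top_iff_ne_top.2 hi⟩⟩

lemma IsFlow.continuousOn_X (h : IsFlow k γ T C μ X V) (p : E × E) :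
    ContinuousOn (fun s => X s p) (Icc 0 T) :=
  fun t ht => (h.deriv_X p t ht).continuousWithinAt

lemma IsFlow.continuousOn_V (h : IsFlow k γ T C μ X V) (p : E × E) :
    ContinuousOn (fun s => V s p) (Icc 0 T) := by
  intro t ht
  by_cases hi : Integrable (V t) μ
  · exact (h.deriv_V p t ht hi).continuousWithinAt
  · exact (h.deriv_V_zero p t ht hi).continuousWithinAt

lemma IsFlow.meanSpeed_le_of_tendsto (h : IsFlow k γ T C μ X V) {t : ℝ} (ht : t ∈ Icc 0 T)
    {s : ℕ → ℝ} (hs : ∀ n, s n ∈ Icc 0 T) (hst : Tendsto s atTop (𝓝 t)) {N : ENNReal}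
    (hN : ∀ n, meanSpeed μ V (s n) ≤ N) : meanSpeed μ V t ≤ N := by
  have h1 : ∀ q, ‖V t q‖ₑ = liminf (fun n => ‖V (s n) q‖ₑ) atTop := by
    intro q
    have h2 : Tendsto (fun n => V (s n) q) atTop (𝓝 (V t q)) :=
      ((h.continuousOn_V q) t ht).tendsto.comp
        (tendsto_nhdsWithin_iff.2 ⟨hst, Eventually.of_forall hs⟩)
    exact h2.enorm.liminf_eq.symm
  calc meanSpeed μ V t = ∫⁻ q, liminf (fun n => ‖V (s n) q‖ₑ) atTop ∂μ :=
        lintegral_congr h1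
    _ ≤ liminf (fun n => meanSpeed μ V (s n)) atTop :=
        lintegral_liminf_le' fun n => (h.meas_V _ (hs n)).enorm
    _ ≤ N := by
        refine (liminf_le_liminf (Eventually.of_forall hN)).trans ?_
        simp

omit [FiniteDimensional ℝ E] [BorelSpace E] in
lemma norm_alignment_le [IsProbabilityMeasure μ] (hk : LipWeight k L k₀) (hγ0 : 0 ≤ γ)
    (hγ : γ ≤ k₀) {t : ℝ} {p : E × E}
    {N y : ℝ} (hN : ∫ q, ‖V t q‖ ∂μ ≤ N) (hi : Integrable (V t) μ) (hy : ‖V t p‖ ≤ y) :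
    ‖accel k μ (X t) (V t) (X t p) - γ • V t p‖ ≤ k₀ * (N + y) := by
  have h1 : ‖accel k μ (X t) (V t) (X t p)‖ ≤ k₀ * N := by
    refine (norm_integral_le_of_norm_le (hi.norm.const_mul k₀)
      (Eventually.of_forall fun q => ?_)).trans ?_
    · rw [norm_smul, Real.norm_of_nonneg (hk.nonneg _)]
      exact mul_le_mul_of_nonneg_right (hk.le _) (norm_nonneg _)
    · rw [integral_const_mul]
      exact mul_le_mul_of_nonneg_left hN hk.k₀_nonneg
  refine (norm_sub_le _ _).trans ?_
  rw [norm_smul, Real.norm_of_nonneg hγ0, mul_add]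
  exact add_le_add h1 (mul_le_mul hγ hy (norm_nonneg _) hk.k₀_nonneg)

lemma IsFlow.meanSpeed_le_of_bounded [IsProbabilityMeasure μ] (hk : LipWeight k L k₀)
    (hγ0 : 0 ≤ γ) (hγ : γ ≤ k₀) (h : IsFlow k γ T C μ X V) {a b : ℝ} (hab : Icc a b ⊆ Icc 0 T)
    (hlen : k₀ * (b - a) ≤ 1 / 8) {N : ENNReal} (hNt : N ≠ ⊤)
    (hN : ∀ t ∈ Icc a b, meanSpeed μ V t ≤ N) {s t : ℝ} (hs : s ∈ Icc a b) (ht : t ∈ Icc a b) :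
    meanSpeed μ V t ≤ 3 * meanSpeed μ V s := by
  have hint : ∀ t ∈ Icc a b, Integrable (V t) μ := fun t ht =>
    (h.integrable_iff (hab ht)).2 ((hN t ht).trans_lt (lt_top_iff_ne_top.2 hNt)).ne
  have hm : ∀ t ∈ Icc a b, meanSpeed μ V t = ENNReal.ofReal (∫ q, ‖V t q‖ ∂μ) := fun t ht => by
    rw [ofReal_integral_norm_eq_lintegral_enorm (hint t ht)]; rfl
  set m : ℝ → ℝ := fun t => ∫ q, ‖V t q‖ ∂μ with hmdef
  have hbdd : BddAbove (m '' Icc a b) := by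
    refine ⟨N.toReal, ?_⟩
    rintro _ ⟨t, ht, rfl⟩
    have := hN t ht
    rw [hm t ht] at this
    exact ENNReal.ofReal_le_iff_le_toReal hNt |>.1 this
  set M := sSup (m '' Icc a b) with hM
  have hmM : ∀ t ∈ Icc a b, m t ≤ M := fun t ht => le_csSup hbdd (mem_image_of_mem m ht)
  have hk0 := hk.k₀_nonneg
  have key : ∀ s ∈ Icc a b, ∀ t ∈ Icc a b, ∀ p, ‖V t p‖ ≤ 8 / 7 * ‖V s p‖ + M / 7 := by
    intro s hs t ht p
    obtain ⟨r, hr, hry⟩ := isCompact_Icc.exists_isMaxOn ⟨s, hs⟩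
      ((h.continuousOn_V p).mono hab).norm
    set y := ‖V r p‖ with hy
    have hy' : ∀ r ∈ Icc a b, ‖V r p‖ ≤ y := fun r hr => hry hr
    have hM0 : 0 ≤ M := (integral_nonneg fun q => norm_nonneg _).trans (hmM s hs)
    have hy0 : 0 ≤ y := norm_nonneg _
    have h1 : ‖V r p - V s p‖ ≤ k₀ * (M + y) * ‖r - s‖ := by
      refine (convex_Icc a b).norm_image_sub_le_of_norm_hasDerivWithin_le
        (f' := fun t => accel k μ (X t) (V t) (X t p) - γ • V t p)
        (fun x hx => (h.deriv_V p x (hab hx) (hint x hx)).mono hab) (fun x hx => ?_) hs hr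
      exact norm_alignment_le hk hγ0 hγ (hmM x hx) (hint x hx) (hy' x hx)
    have h2 : ‖r - s‖ ≤ b - a := by
      rw [Real.norm_eq_abs, abs_le]
      constructor <;> linarith [hr.1, hr.2, hs.1, hs.2]
    have h3 : k₀ * (M + y) * ‖r - s‖ ≤ 1 / 8 * (M + y) := by
      calc _ ≤ k₀ * (M + y) * (b - a) := by gcongr
        _ = k₀ * (b - a) * (M + y) := by ring
        _ ≤ _ := by gcongr
    have h4 : y ≤ ‖V s p‖ + ‖V r p - V s p‖ := by
      have := norm_add_le (V s p) (V r p - V s p)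
      simpa [hy] using this
    linarith [hy' t ht]
  have key2 : ∀ s ∈ Icc a b, ∀ t ∈ Icc a b, m t ≤ 8 / 7 * m s + M / 7 := by
    intro s hs t ht
    calc m t ≤ ∫ q, (8 / 7 * ‖V s q‖ + M / 7) ∂μ :=
          integral_mono (hint t ht).norm (((hint s hs).norm.const_mul _).add (integrable_const _))
            (key s hs t ht)
      _ = _ := by
          rw [integral_add ((hint s hs).norm.const_mul _) (integrable_const _),
            integral_const_mul]
          simp [hmdef]
  have h5 : M ≤ 8 / 7 * m s + M / 7 := csSup_le ⟨m s, mem_image_of_mem m hs⟩ (by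
    rintro _ ⟨t, ht, rfl⟩
    exact key2 s hs t ht)
  have hms : 0 ≤ m s := integral_nonneg fun q => norm_nonneg _
  rw [hm t ht, hm s hs, show (3 : ENNReal) = ENNReal.ofReal 3 by simp,
    ← ENNReal.ofReal_mul (by norm_num)]
  refine ENNReal.ofReal_le_ofReal ?_
  linarith [hmM t ht]

/-- Near `t`, the mean speed varies by at most a factor of three. -/
def IsRegularTime (μ : Measure (E × E)) (V : ℝ → E × E → E) (T t : ℝ) : Prop :=
  ∃ ε > 0, ∀ s ∈ Icc 0 T, ∀ s' ∈ Icc 0 T, |s - t| < ε → |s' - t| < ε →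
    meanSpeed μ V s' ≤ 3 * meanSpeed μ V s

lemma IsFlow.meanSpeed_le_of_regular [IsProbabilityMeasure μ] (hk : LipWeight k L k₀)
    (hγ0 : 0 ≤ γ) (hγ : γ ≤ k₀) (h : IsFlow k γ T C μ X V) {a b : ℝ} (hab : Icc a b ⊆ Icc 0 T)
    (hlen : k₀ * (b - a) ≤ 1 / 8) (hreg : ∀ t ∈ Ioo a b, IsRegularTime μ V T t)
    {s t : ℝ} (hs : s ∈ Icc a b) (ht : t ∈ Icc a b) :
    meanSpeed μ V t ≤ 3 * meanSpeed μ V s := by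
  rcases (hs.1.trans hs.2).eq_or_lt with rfl | hlt
  · rw [Icc_self] at hs ht
    rw [hs, ht]
    exact le_mul_of_one_le_left' (by norm_num)
  have hsub : Ioo a b ⊆ Icc 0 T := Ioo_subset_Icc_self.trans hab
  set c := (a + b) / 2
  have hc : c ∈ Ioo a b := ⟨by simp only [c]; linarith, by simp only [c]; linarith⟩
  have hcl : Icc a b ⊆ closure (Ioo a b) := (closure_Ioo hlt.ne).ge
  have hseq : ∀ t ∈ Icc a b, ∃ u : ℕ → ℝ, (∀ n, u n ∈ Ioo a b) ∧ Tendsto u atTop (𝓝 t) :=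
    fun t ht => mem_closure_iff_seq_limit.1 (hcl ht)
  have hdich : ∀ x ∈ Ioo a b, (meanSpeed μ V x = ⊤ ↔ meanSpeed μ V c = ⊤) := by
    intro x hx
    refine isPreconnected_Ioo.induction₂ (fun x y => meanSpeed μ V x = ⊤ ↔ meanSpeed μ V y = ⊤)
      (fun x hx => ?_) (fun x y z _ _ _ h1 h2 => h1.trans h2) (fun x y _ _ h1 => h1.symm) hx hc
    obtain ⟨ε, hε, hr⟩ := hreg x hx
    have h1 : ∀ᶠ y in 𝓝[Ioo a b] x, |y - x| < ε :=
      eventually_nhdsWithin_of_eventually_nhds (Metric.ball_mem_nhds x hε)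
    filter_upwards [h1, self_mem_nhdsWithin] with y hy hy'
    have h2 := hr x (hsub hx) y (hsub hy') (by simpa using hε) hy
    have h3 := hr y (hsub hy') x (hsub hx) hy (by simpa using hε)
    constructor <;> intro h4
    · rw [h4, top_le_iff] at h3
      by_contra h5
      exact ENNReal.mul_ne_top (by norm_num) h5 h3
    · rw [h4, top_le_iff] at h2
      by_contra h5
      exact ENNReal.mul_ne_top (by norm_num) h5 h2
  by_cases htop : meanSpeed μ V c = ⊤
  · have hconst : ∀ x ∈ Ioo a b, ∀ q, V x q = V c q := by
      intro x hx q
      have := (convex_Ioo a b).norm_image_sub_le_of_norm_hasDerivWithin_le (C := 0)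
        (f' := fun _ => (0 : E)) (f := fun s => V s q)
        (fun x hx => (h.deriv_V_zero q x (hsub hx) fun hi =>
          (h.integrable_iff (hsub hx)).1 hi ((hdich x hx).2 htop)).mono hsub)
        (fun _ _ => norm_zero.le) hc hx
      rw [zero_mul] at this
      exact sub_eq_zero.1 (norm_le_zero_iff.1 this)
    have hconst' : ∀ x ∈ Icc a b, V x = V c := by
      intro x hx
      funext q
      exact EqOn.of_subset_closure (f := fun x => V x q) (g := fun _ => V c q) (s := Ioo a b)
        (fun x hx => hconst x hx q)
        ((h.continuousOn_V q).mono hab) continuousOn_const Ioo_subset_Icc_self hcl hx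
    have : meanSpeed μ V s = ⊤ := by
      rw [← htop, meanSpeed, meanSpeed, hconst' s hs]
    rw [this]
    simp
  · have hin : ∀ s ∈ Ioo a b, ∀ t ∈ Ioo a b, meanSpeed μ V t ≤ 3 * meanSpeed μ V s := by
      intro s hs t ht
      set a' := min s t
      set b' := max s t
      have hsub' : Icc a' b' ⊆ Ioo a b := fun x hx =>
        ⟨(lt_min hs.1 ht.1).trans_le hx.1, hx.2.trans_lt (max_lt hs.2 ht.2)⟩
      obtain ⟨N, hNt, hN⟩ : ∃ N : ENNReal, N ≠ ⊤ ∧ ∀ x ∈ Icc a' b', meanSpeed μ V x ≤ N := by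
        refine isCompact_Icc.induction_on
          (p := fun S => ∃ N : ENNReal, N ≠ ⊤ ∧ ∀ x ∈ S, meanSpeed μ V x ≤ N)
          ⟨0, by simp, by simp⟩ (fun S S' hS ⟨N, hN, hN'⟩ => ⟨N, hN, fun x hx => hN' x (hS hx)⟩)
          (fun S S' ⟨N, hN, hN'⟩ ⟨M, hM, hM'⟩ => ⟨max N M, (max_lt hN.lt_top hM.lt_top).ne, ?_⟩)
          fun x hx => ?_
        · rintro x (hx | hx)
          · exact (hN' x hx).trans (le_max_left _ _)
          · exact (hM' x hx).trans (le_max_right _ _)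
        · obtain ⟨ε, hε, hr⟩ := hreg x (hsub' hx)
          refine ⟨Icc a' b' ∩ Metric.ball x ε, inter_mem_nhdsWithin _ (Metric.ball_mem_nhds x hε),
            3 * meanSpeed μ V x, ENNReal.mul_ne_top (by norm_num) ?_, fun y hy => ?_⟩
          · exact fun h1 => htop ((hdich x (hsub' hx)).1 h1)
          · exact hr x (hsub (hsub' hx)) y (hsub (hsub' hy.1)) (by simpa using hε) hy.2
      refine h.meanSpeed_le_of_bounded hk hγ0 hγ (hsub'.trans hsub) ?_ hNt hN
        ⟨min_le_left _ _, le_max_left _ _⟩ ⟨min_le_right _ _, le_max_right _ _⟩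
      refine (mul_le_mul_of_nonneg_left ?_ hk.k₀_nonneg).trans hlen
      have h1 : a ≤ a' := (lt_min hs.1 ht.1).le
      have h2 : b' ≤ b := (max_lt hs.2 ht.2).le
      linarith
    have hbd : ∀ x ∈ Icc a b, meanSpeed μ V x ≤ 3 * meanSpeed μ V c := by
      intro x hx
      obtain ⟨u, hu, hux⟩ := hseq x hx
      exact h.meanSpeed_le_of_tendsto (hab hx) (fun n => hsub (hu n)) hux
        fun n => hin c hc _ (hu n)
    exact h.meanSpeed_le_of_bounded hk hγ0 hγ hab hlen
      (ENNReal.mul_ne_top (by norm_num) htop) hbd hs ht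

end Flow

section Measurability

open Filter Topology

variable {Ω E : Type*} [MeasurableSpace Ω] {μ : Measure Ω} [NormedAddCommGroup E]
  [InnerProductSpace ℝ E] [FiniteDimensional ℝ E] [MeasurableSpace E] [BorelSpace E] {X V : Ω → E}

lemma measurable_accel [IsProbabilityMeasure μ] {k : ℝ → ℝ} (hk : Continuous k)
    (hX : AEStronglyMeasurable X μ) (hV : AEStronglyMeasurable V μ) :
    Measurable (accel k μ X V) := by
  obtain ⟨X', hX', hXX'⟩ := hX
  obtain ⟨V', hV', hVV'⟩ := hV
  have hmass : ∀ x r, massIn μ X x r = massIn μ X' x r := fun x r => by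
    refine measureReal_congr (eventuallyEq_set.2 ?_)
    filter_upwards [hXX'] with q hq
    simp only [hq]
  have hacc : accel k μ X V = fun x => ∫ q, k (massIn μ X' x (dist x (X' q))) • V' q ∂μ := by
    funext x
    refine integral_congr_ae ?_
    filter_upwards [hXX', hVV'] with q hq hq'
    rw [hq, hq', hmass]
  have hF : Measurable fun y : E × ℝ => massIn μ X' y.1 y.2 := by
    have hS : MeasurableSet {z : (E × ℝ) × Ω | dist z.1.1 (X' z.2) ≤ z.1.2} :=
      measurableSet_le (measurable_fst.fst.dist (hX'.measurable.comp measurable_snd))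
        measurable_fst.snd
    exact (measurable_measure_prodMk_left hS).ennreal_toReal
  rw [hacc]
  have hj : StronglyMeasurable (Function.uncurry fun (x : E) (q : Ω) =>
      k (massIn μ X' x (dist x (X' q))) • V' q) := by
    have h1 : Measurable fun z : E × Ω => (z.1, dist z.1 (X' z.2)) :=
      measurable_fst.prodMk (measurable_fst.dist (hX'.measurable.comp measurable_snd))
    exact ((hk.measurable.comp (hF.comp h1)).smul
      (hV'.measurable.comp measurable_snd)).stronglyMeasurable
  exact hj.integral_prod_right.measurable

lemma DensityBound.measure_le {C : NNReal} (h : DensityBound μ (fun p => (X p, V p)) C) {A : E → E}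
    (hA : Measurable A) {γ ρ ε : ℝ} (hγ : 0 < γ) :
    μ {q | ‖X q‖ ≤ ρ ∧ ‖A (X q) - γ • V q‖ ≤ ε} ≤
      C * (volume (closedBall (0 : E) ρ) * volume (closedBall (0 : E) (ε / γ))) := by
  have hmp := measurePreserving_shear_snd (φ := fun x => -(γ⁻¹ • A x)) (by fun_prop)
  have hS : MeasurableSet (closedBall (0 : E) ρ ×ˢ closedBall (0 : E) (ε / γ)) :=
    measurableSet_closedBall.prod measurableSet_closedBall
  have h1 := h _ (hmp.measurable hS)
  rw [hmp.measure_preimage hS.nullMeasurableSet, Measure.volume_eq_prod, Measure.prod_prod] at h1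
  refine (measure_mono ?_).trans h1
  rintro q ⟨hq1, hq2⟩
  refine ⟨mem_closedBall_zero_iff.2 hq1, mem_closedBall_zero_iff.2 ?_⟩
  have h2 : V q + -(γ⁻¹ • A (X q)) = -(γ⁻¹ • (A (X q) - γ • V q)) := by
    rw [smul_sub, smul_smul, inv_mul_cancel₀ hγ.ne', one_smul]
    abel
  change ‖V q + -(γ⁻¹ • A (X q))‖ ≤ _
  rw [h2, norm_neg, norm_smul, norm_inv, Real.norm_of_nonneg hγ.le, div_eq_inv_mul]
  exact mul_le_mul_of_nonneg_left hq2 (by positivity)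

end Measurability

section Wild

open Filter Topology

open Module

variable {E : Type*} [NormedAddCommGroup E] [InnerProductSpace ℝ E] [FiniteDimensional ℝ E]
  [MeasurableSpace E] [BorelSpace E] {k : ℝ → ℝ} {L k₀ γ T : ℝ} {C : NNReal}
  {μ : Measure (E × E)} [IsProbabilityMeasure μ] {X V : ℝ → E × E → E}

lemma IsFlow.exists_slope_close (h : IsFlow k γ T C μ X V) (hT : 0 < T) {t : ℝ} (ht : t ∈ Icc 0 T)
    (hi : Integrable (V t) μ) {η : ℝ} (hη : 0 < η) :
    ∃ s ∈ Icc 0 T, s ≠ t ∧ |s - t| < η ∧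
      μ {q | ENNReal.ofReal η ≤ edist (slope (fun r => V r q) t s)
        (accel k μ (X t) (V t) (X t q) - γ • V t q)} ≤ ENNReal.ofReal η := by
  have hne : (𝓝[Icc 0 T \ {t}] t).NeBot := by
    exact accPt_principal_iff_nhdsWithin.1
      (uniqueDiffWithinAt_iff_accPt.1 (uniqueDiffOn_Icc hT t ht))
  obtain ⟨u, hu⟩ := exists_seq_tendsto (𝓝[Icc 0 T \ {t}] t)
  obtain ⟨hu1, hu2⟩ := tendsto_nhdsWithin_iff.1 hu
  obtain ⟨N, hN⟩ := eventually_atTop.1 hu2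
  have hu' : Tendsto (fun n => u (n + N)) atTop (𝓝[Icc 0 T \ {t}] t) :=
    (tendsto_add_atTop_iff_nat N).2 hu
  have hmem : ∀ n, u (n + N) ∈ Icc 0 T \ {t} := fun n => hN _ (Nat.le_add_left _ _)
  have hmeas := tendstoInMeasure_of_tendsto_ae (μ := μ)
    (f := fun n q => slope (fun r => V r q) t (u (n + N)))
    (g := fun q => accel k μ (X t) (V t) (X t q) - γ • V t q)
    (fun n => by
      simp only [slope_def_module]
      exact ((h.meas_V _ (hmem n).1).sub (h.meas_V t ht)).const_smul _)
    (Eventually.of_forall fun q =>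
      (hasDerivWithinAt_iff_tendsto_slope.1 (h.deriv_V q t ht hi)).comp hu')
  have h2 := (hmeas _ (ENNReal.ofReal_pos.2 hη)).eventually
    (ge_mem_nhds (ENNReal.ofReal_pos.2 hη))
  have h3 : ∀ᶠ n in atTop, |u (n + N) - t| < η :=
    (tendsto_nhdsWithin_iff.1 hu').1.eventually (Metric.ball_mem_nhds t hη)
  obtain ⟨n, hn2, hn3⟩ := (h2.and h3).exists
  exact ⟨u (n + N), (hmem n).1, (hmem n).2, hn3, hn2⟩

lemma IsFlow.false_of_wild_sequence [Nontrivial E] (hk : LipWeight k L k₀) (hγ : 0 < γ)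
    (h : IsFlow k γ T C μ X V)
    {t : ℝ} (ht : t ∈ Icc 0 T) (hi : ¬ Integrable (V t) μ) {r s η : ℕ → ℝ}
    (hr : ∀ n, r n ∈ Icc 0 T) (hs : ∀ n, s n ∈ Icc 0 T) (hη : Tendsto η atTop (𝓝 0))
    (hrt : ∀ n, |r n - t| < |s n - r n|) (hsr : ∀ n, |s n - r n| < η n)
    (hslope : ∀ n, μ {q | ENNReal.ofReal (η n) ≤ edist (slope (fun a => V a q) (r n) (s n))
        (accel k μ (X (r n)) (V (r n)) (X (r n) q) - γ • V (r n) q)} ≤ ENNReal.ofReal (η n)) :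
    False := by
  have hrlim : Tendsto r atTop (𝓝 t) := by
    refine tendsto_iff_dist_tendsto_zero.2 (squeeze_zero (fun _ => dist_nonneg) (fun n => ?_) hη)
    exact ((hrt n).trans (hsr n)).le
  have hslim : Tendsto s atTop (𝓝 t) := by
    have h2 : Tendsto (fun n => 2 * η n) atTop (𝓝 0) := by simpa using hη.const_mul 2
    refine tendsto_iff_dist_tendsto_zero.2 (squeeze_zero (fun _ => dist_nonneg) (fun n => ?_) h2)
    have := abs_sub_le (s n) (r n) t
    rw [Real.dist_eq]
    linarith [hrt n, hsr n]
  have hrlim' := tendsto_nhdsWithin_iff.2 ⟨hrlim, Eventually.of_forall hr⟩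
  have hslim' := tendsto_nhdsWithin_iff.2 ⟨hslim, Eventually.of_forall hs⟩
  have hslope0 : ∀ q, Tendsto (fun n => slope (fun a => V a q) (r n) (s n)) atTop (𝓝 0) := by
    intro q
    rw [Metric.tendsto_atTop']
    intro ε hε
    have h1 := (hasDerivWithinAt_iff_isLittleO.1 (h.deriv_V_zero q t ht hi)).def
      (show 0 < ε / 4 by positivity)
    obtain ⟨N, hN⟩ := eventually_atTop.1 ((hrlim'.eventually h1).and (hslim'.eventually h1))
    refine ⟨N, fun n hn => ?_⟩
    obtain ⟨ha, hb⟩ := hN n hn.le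
    simp only [smul_zero, sub_zero, Real.norm_eq_abs] at ha hb
    have hρ : 0 < |s n - r n| := (abs_nonneg _).trans_lt (hrt n)
    have h3 := abs_sub_le (s n) (r n) t
    have h4 : ‖V (s n) q - V (r n) q‖ ≤ ε / 4 * (3 * |s n - r n|) := by
      have := norm_sub_le (V (s n) q - V t q) (V (r n) q - V t q)
      rw [sub_sub_sub_cancel_right] at this
      have h5 : ε / 4 * |r n - t| ≤ ε / 4 * |s n - r n| :=
        mul_le_mul_of_nonneg_left (hrt n).le (by positivity)
      have h6 : ε / 4 * |s n - t| ≤ ε / 4 * (2 * |s n - r n|) :=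
        mul_le_mul_of_nonneg_left (by linarith [hrt n]) (by positivity)
      linarith
    rw [dist_zero_right, slope_def_module, norm_smul, norm_inv, Real.norm_eq_abs,
      inv_mul_lt_iff₀ hρ]
    nlinarith
  have hbig : ∀ᶠ m : ℕ in atTop, μ {q | 1 ≤ edist (((m : ℝ) + 1)⁻¹ • X t q) 0} ≤ 8⁻¹ := by
    refine (tendstoInMeasure_of_tendsto_ae (μ := μ) (f := fun (m : ℕ) q => ((m : ℝ) + 1)⁻¹ • X t q)
      (g := fun _ => 0) (fun n => (h.meas_X t ht).const_smul _) (Eventually.of_forall fun q => ?_)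
      1 one_pos).eventually (ge_mem_nhds (by simp))
    have : Tendsto (fun m : ℕ => ((m : ℝ) + 1)⁻¹) atTop (𝓝 0) := by
      simpa using tendsto_one_div_add_atTop_nhds_zero_nat (𝕜 := ℝ)
    simpa using this.smul_const (X t q)
  obtain ⟨m, hm⟩ := hbig.exists
  set ρ : ℝ := m + 1 + 1 with hρdef
  have hvol : Tendsto (fun ε : ℝ => (C : ENNReal) * (volume (closedBall (0 : E) ρ) *
      volume (closedBall (0 : E) (2 * ε / γ)))) (𝓝[>] 0) (𝓝 0) := by
    have h1 : Tendsto (fun ε : ℝ => ENNReal.ofReal ((2 * ε / γ) ^ finrank ℝ E)) (𝓝[>] 0)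
        (𝓝 0) := by
      have h2 : Continuous fun ε : ℝ => ENNReal.ofReal ((2 * ε / γ) ^ finrank ℝ E) :=
        ENNReal.continuous_ofReal.comp (by fun_prop)
      have h3 := h2.tendsto 0
      simp only [mul_zero, zero_div, zero_pow finrank_pos.ne', ENNReal.ofReal_zero] at h3
      exact h3.mono_left nhdsWithin_le_nhds
    have h2 : Tendsto (fun ε : ℝ => (C : ENNReal) * (volume (closedBall (0 : E) ρ) *
        (ENNReal.ofReal ((2 * ε / γ) ^ finrank ℝ E) * volume (ball (0 : E) 1)))) (𝓝[>] 0)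
        (𝓝 (C * (volume (closedBall (0 : E) ρ) * (0 * volume (ball (0 : E) 1))))) :=
      ENNReal.Tendsto.const_mul (ENNReal.Tendsto.const_mul (ENNReal.Tendsto.mul_const h1
        (Or.inr measure_ball_lt_top.ne)) (Or.inr measure_closedBall_lt_top.ne))
        (Or.inr ENNReal.coe_ne_top)
    simp only [zero_mul, mul_zero] at h2
    refine h2.congr' ?_
    filter_upwards [self_mem_nhdsWithin] with ε hε
    have hε' : 0 ≤ 2 * ε / γ := by have : 0 < ε := hε; positivity
    rw [Measure.addHaar_closedBall _ _ hε']
  obtain ⟨ε, hε1, hε⟩ := ((hvol.eventually (ge_mem_nhds (show (0 : ENNReal) < 8⁻¹ by simp))).and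
    self_mem_nhdsWithin).exists
  replace hε : 0 < ε := hε
  have e1 : ∀ᶠ n in atTop, η n ≤ ε := hη.eventually (ge_mem_nhds hε)
  have e2 : ∀ᶠ n in atTop, ENNReal.ofReal (η n) ≤ 8⁻¹ := by
    have := (ENNReal.continuous_ofReal.tendsto 0).comp hη
    rw [ENNReal.ofReal_zero] at this
    exact this.eventually (ge_mem_nhds (by simp))
  have e3 : ∀ᶠ n in atTop, μ {q | ENNReal.ofReal ε ≤
      edist (slope (fun a => V a q) (r n) (s n)) 0} ≤ 8⁻¹ := by
    refine (tendstoInMeasure_of_tendsto_ae (μ := μ)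
      (f := fun n q => slope (fun a => V a q) (r n) (s n)) (g := fun _ => 0) (fun n => ?_)
      (Eventually.of_forall hslope0) _ (ENNReal.ofReal_pos.2 hε)).eventually
      (ge_mem_nhds (by simp))
    simp only [slope_def_module]
    exact ((h.meas_V _ (hs n)).sub (h.meas_V _ (hr n))).const_smul _
  have e4 : ∀ᶠ n in atTop, μ {q | 1 ≤ edist (X (r n) q) (X t q)} ≤ 8⁻¹ :=
    (tendstoInMeasure_of_tendsto_ae (μ := μ) (f := fun n q => X (r n) q) (g := fun q => X t q)
      (fun n => h.meas_X _ (hr n)) (Eventually.of_forall fun q =>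
        ((h.continuousOn_X q) t ht).tendsto.comp hrlim') 1 one_pos).eventually
      (ge_mem_nhds (by simp))
  obtain ⟨n, h1, h2, h3, h4⟩ := (e1.and (e2.and (e3.and e4))).exists
  have h5 := (h.density _ (hr n)).measure_le (ρ := ρ) (ε := 2 * ε)
    (measurable_accel hk.continuous (h.meas_X _ (hr n)) (h.meas_V _ (hr n))) hγ
  have hcover : (univ : Set (E × E)) ⊆ {q | 1 ≤ edist (((m : ℝ) + 1)⁻¹ • X t q) 0} ∪
      ({q | ENNReal.ofReal (η n) ≤ edist (slope (fun a => V a q) (r n) (s n))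
        (accel k μ (X (r n)) (V (r n)) (X (r n) q) - γ • V (r n) q)} ∪
      ({q | ENNReal.ofReal ε ≤ edist (slope (fun a => V a q) (r n) (s n)) 0} ∪
      ({q | 1 ≤ edist (X (r n) q) (X t q)} ∪
      {q | ‖X (r n) q‖ ≤ ρ ∧
        ‖accel k μ (X (r n)) (V (r n)) (X (r n) q) - γ • V (r n) q‖ ≤ 2 * ε}))) := by
    intro q _
    by_contra hq
    simp only [mem_union, mem_ofPred_eq, not_or, not_le, not_and] at hq
    obtain ⟨a1, a2, a3, a4, a5⟩ := hq
    have hη0 : 0 < η n := (abs_nonneg _).trans_lt (hsr n)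
    rw [edist_dist, ENNReal.ofReal_lt_one, dist_zero_right, norm_smul, norm_inv,
      Real.norm_of_nonneg (by positivity), inv_mul_lt_iff₀ (by positivity), mul_one] at a1
    rw [edist_dist, ENNReal.ofReal_lt_ofReal_iff hη0, dist_eq_norm] at a2
    rw [edist_dist, ENNReal.ofReal_lt_ofReal_iff hε, dist_zero_right] at a3
    rw [edist_dist, ENNReal.ofReal_lt_one, dist_eq_norm] at a4
    have b1 : ‖X (r n) q‖ ≤ ρ := by
      have := norm_le_norm_add_norm_sub' (X (r n) q) (X t q)
      linarith
    have b2 := norm_le_norm_add_norm_sub (slope (fun a => V a q) (r n) (s n))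
      (accel k μ (X (r n)) (V (r n)) (X (r n) q) - γ • V (r n) q)
    linarith [a5 b1]
  have h6 : (1 : ENNReal) ≤ 8⁻¹ + (8⁻¹ + (8⁻¹ + (8⁻¹ + 8⁻¹))) := by
    rw [← measure_univ (μ := μ)]
    refine (measure_mono hcover).trans ((measure_union_le _ _).trans (add_le_add hm ?_))
    refine (measure_union_le _ _).trans (add_le_add ((hslope n).trans h2) ?_)
    refine (measure_union_le _ _).trans (add_le_add h3 ?_)
    exact (measure_union_le _ _).trans (add_le_add h4 (h5.trans hε1))
  have h7 : (8⁻¹ : ENNReal) = ENNReal.ofReal 8⁻¹ := by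
    rw [ENNReal.ofReal_inv_of_pos (by norm_num)]; simp
  rw [h7, ← ENNReal.ofReal_add, ← ENNReal.ofReal_add, ← ENNReal.ofReal_add, ← ENNReal.ofReal_add,
    ENNReal.one_le_ofReal] at h6 <;>
    first | positivity | norm_num at h6

end Wild

section Regular

open Filter Topology

variable {E : Type*} [NormedAddCommGroup E] [InnerProductSpace ℝ E] [FiniteDimensional ℝ E]
  [MeasurableSpace E] [BorelSpace E] {k : ℝ → ℝ} {L k₀ γ T : ℝ} {C : NNReal}
  {μ : Measure (E × E)} [IsProbabilityMeasure μ] {X V : ℝ → E × E → E}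

omit [InnerProductSpace ℝ E] [FiniteDimensional ℝ E] [BorelSpace E] [IsProbabilityMeasure μ] in
lemma isOpen_isRegularTime : IsOpen {t | IsRegularTime μ V T t} := by
  refine Metric.isOpen_iff.2 fun t ⟨ε, hε, h⟩ => ⟨ε / 2, by positivity, fun t' ht' => ?_⟩
  have h1 : |t' - t| < ε / 2 := ht'
  refine ⟨ε / 2, by positivity, fun s hs s' hs' h2 h3 => h s hs s' hs' ?_ ?_⟩
  · linarith [abs_sub_le s t' t]
  · linarith [abs_sub_le s' t' t]

lemma IsFlow.isRegularTime_of_bounded (hk : LipWeight k L k₀)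
    (hγ0 : 0 ≤ γ) (hγ : γ ≤ k₀) (h : IsFlow k γ T C μ X V) {t ε : ℝ}
    (hε : 0 < ε) (hε' : k₀ * (2 * ε) ≤ 1 / 8) {N : ENNReal} (hNt : N ≠ ⊤)
    (hN : ∀ s ∈ Icc 0 T, |s - t| ≤ ε → meanSpeed μ V s ≤ N) : IsRegularTime μ V T t := by
  have hmem : ∀ s ∈ Icc 0 T, |s - t| ≤ ε → s ∈ Icc (max 0 (t - ε)) (min T (t + ε)) := by
    intro s hs hst
    rw [abs_le] at hst
    exact ⟨max_le hs.1 (by linarith), le_min hs.2 (by linarith)⟩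
  refine ⟨ε, hε, fun s hs s' hs' h1 h2 => h.meanSpeed_le_of_bounded hk hγ0 hγ
    (a := max 0 (t - ε)) (b := min T (t + ε)) (fun x hx => ?_) ?_ hNt (fun x hx => ?_)
    (hmem s hs h1.le) (hmem s' hs' h2.le)⟩
  · exact ⟨(le_max_left _ _).trans hx.1, hx.2.trans (min_le_left _ _)⟩
  · refine (mul_le_mul_of_nonneg_left ?_ hk.k₀_nonneg).trans hε'
    linarith [le_max_right 0 (t - ε), min_le_right T (t + ε)]
  · refine hN x ⟨(le_max_left _ _).trans hx.1, hx.2.trans (min_le_left _ _)⟩ ?_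
    have := (le_max_right 0 (t - ε)).trans hx.1
    have := hx.2.trans (min_le_right T (t + ε))
    rw [abs_le]
    constructor <;> linarith

lemma IsFlow.exists_irregular_comparable (hk : LipWeight k L k₀)
    (hγ0 : 0 ≤ γ) (hγ : γ ≤ k₀) (h : IsFlow k γ T C μ X V) {t d : ℝ} (ht : t ∈ Icc 0 T)
    (hd : d ∈ Icc 0 T) (hd' : ¬ IsRegularTime μ V T d) (htd : k₀ * |t - d| ≤ 1 / 8) :
    ∃ b ∈ Icc 0 T, ¬ IsRegularTime μ V T b ∧ |b - d| ≤ |t - d| ∧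
      meanSpeed μ V t ≤ 3 * meanSpeed μ V b ∧ meanSpeed μ V b ≤ 3 * meanSpeed μ V t := by
  have hcl : IsClosed {t | ¬ IsRegularTime μ V T t} := isOpen_isRegularTime.isClosed_compl
  rcases le_total t d with hle | hle
  · obtain ⟨b, ⟨hb1, hb2⟩, hb3⟩ :=
      (isCompact_Icc.inter_right hcl : IsCompact (Icc t d ∩ _)).exists_isLeast
        ⟨d, ⟨hle, le_rfl⟩, hd'⟩
    have hsub : Icc t b ⊆ Icc 0 T := Icc_subset_Icc ht.1 (hb1.2.trans hd.2)
    have hlen : k₀ * (b - t) ≤ 1 / 8 := by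
      refine (mul_le_mul_of_nonneg_left ?_ hk.k₀_nonneg).trans htd
      rw [abs_sub_comm]
      exact (sub_le_sub_right hb1.2 t).trans (le_abs_self _)
    have hreg : ∀ s ∈ Ioo t b, IsRegularTime μ V T s := fun s hs => by
      by_contra hs'
      exact (hb3 ⟨⟨hs.1.le, hs.2.le.trans hb1.2⟩, hs'⟩).not_gt hs.2
    refine ⟨b, hsub ⟨hb1.1, le_rfl⟩, hb2, ?_,
      h.meanSpeed_le_of_regular hk hγ0 hγ hsub hlen hreg ⟨hb1.1, le_rfl⟩ ⟨le_rfl, hb1.1⟩,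
      h.meanSpeed_le_of_regular hk hγ0 hγ hsub hlen hreg ⟨le_rfl, hb1.1⟩ ⟨hb1.1, le_rfl⟩⟩
    rw [abs_sub_comm b, abs_sub_comm t, abs_of_nonneg (sub_nonneg.2 hb1.2),
      abs_of_nonneg (sub_nonneg.2 hle)]
    linarith [hb1.1]
  · obtain ⟨b, ⟨hb1, hb2⟩, hb3⟩ :=
      (isCompact_Icc.inter_right hcl : IsCompact (Icc d t ∩ _)).exists_isGreatest
        ⟨d, ⟨le_rfl, hle⟩, hd'⟩
    have hsub : Icc b t ⊆ Icc 0 T := Icc_subset_Icc (hd.1.trans hb1.1) ht.2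
    have hlen : k₀ * (t - b) ≤ 1 / 8 := by
      refine (mul_le_mul_of_nonneg_left ?_ hk.k₀_nonneg).trans htd
      exact (sub_le_sub_left hb1.1 t).trans (le_abs_self _)
    have hreg : ∀ s ∈ Ioo b t, IsRegularTime μ V T s := fun s hs => by
      by_contra hs'
      exact (hb3 ⟨⟨hb1.1.trans hs.1.le, hs.2.le⟩, hs'⟩).not_gt hs.1
    refine ⟨b, hsub ⟨le_rfl, hb1.2⟩, hb2, ?_,
      h.meanSpeed_le_of_regular hk hγ0 hγ hsub hlen hreg ⟨le_rfl, hb1.2⟩ ⟨hb1.2, le_rfl⟩,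
      h.meanSpeed_le_of_regular hk hγ0 hγ hsub hlen hreg ⟨hb1.2, le_rfl⟩ ⟨le_rfl, hb1.2⟩⟩
    rw [abs_of_nonneg (sub_nonneg.2 hb1.1), abs_of_nonneg (sub_nonneg.2 hle)]
    linarith [hb1.2]

lemma IsFlow.isRegularTime [Nontrivial E] (hk : LipWeight k L k₀) (hγ0 : 0 < γ) (hγ : γ ≤ k₀)
    (h : IsFlow k γ T C μ X V) (hT : 0 < T) : ∀ t ∈ Icc 0 T, IsRegularTime μ V T t := by
  by_contra! hex
  obtain ⟨d₀, hd₀, hd₀'⟩ := hex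
  set D : Set ℝ := Icc 0 T ∩ {t | ¬ IsRegularTime μ V T t} with hD
  have hDc : IsClosed D := isClosed_Icc.inter isOpen_isRegularTime.isClosed_compl
  have : Nonempty D := ⟨⟨d₀, hd₀, hd₀'⟩⟩
  have : CompleteSpace D := hDc.completeSpace_coe
  have hk0 : 0 < k₀ := hγ0.trans_le hγ
  have hshort : ∀ δ > 0, ∃ ε > 0, ε < δ ∧ k₀ * (2 * ε) ≤ 1 / 8 := by
    intro δ hδ
    refine ⟨min (δ / 2) (1 / (16 * k₀)), by positivity,
      (min_le_left _ _).trans_lt (by linarith), ?_⟩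
    calc k₀ * (2 * min (δ / 2) (1 / (16 * k₀))) ≤ k₀ * (2 * (1 / (16 * k₀))) := by
          gcongr; exact min_le_right _ _
      _ = 1 / 8 := by field_simp; norm_num
  have hnear : ∀ d ∈ D, ∀ δ > 0, ∃ ε > 0, ε < δ ∧ k₀ * (2 * ε) ≤ 1 / 8 ∧
      ∀ t ∈ Icc 0 T, |t - d| ≤ ε → ∃ b ∈ D, |b - d| < δ ∧
        meanSpeed μ V t ≤ 3 * meanSpeed μ V b ∧ meanSpeed μ V b ≤ 3 * meanSpeed μ V t := by
    intro d hd δ hδ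
    obtain ⟨ε, hε, hεδ, hε'⟩ := hshort δ hδ
    refine ⟨ε, hε, hεδ, hε', fun t ht htd => ?_⟩
    obtain ⟨b, hb1, hb2, hb3, hb4⟩ := h.exists_irregular_comparable hk hγ0.le hγ ht hd.1 hd.2
      (by nlinarith)
    exact ⟨b, ⟨hb1, hb2⟩, by linarith, hb4⟩
  have hlarge : ∀ d ∈ D, ∀ δ > 0, ∀ n : ℕ, ∃ b ∈ D, |b - d| < δ ∧ n < meanSpeed μ V b := by
    intro d hd δ hδ n
    by_contra! hcon
    obtain ⟨ε, hε, -, hε', hcmp⟩ := hnear d hd δ hδ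
    refine hd.2 (h.isRegularTime_of_bounded hk hγ0.le hγ hε hε' (N := 3 * n)
      (ENNReal.mul_ne_top (by norm_num) (by simp)) fun s hs hsd => ?_)
    obtain ⟨b, hb1, hb2, hb3, -⟩ := hcmp s hs hsd
    exact hb3.trans (mul_le_mul_right (hcon b hb1 hb2) _)
  have hfin : ∀ d ∈ D, ∀ δ > 0, ∃ b ∈ D, |b - d| < δ ∧ meanSpeed μ V b ≠ ⊤ := by
    intro d hd δ hδ
    by_contra! hcon
    obtain ⟨ε, hε, -, -, hcmp⟩ := hnear d hd δ hδ
    refine hd.2 ⟨ε, hε, fun s hs s' hs' hsd _ => ?_⟩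
    obtain ⟨b, hb1, hb2, -, hb4⟩ := hcmp s hs hsd.le
    rw [hcon b hb1 hb2] at hb4
    exact le_top.trans hb4
  set A : ℕ → Set D := fun n => {x | (n : ENNReal) < meanSpeed μ V x}
  have hAo : ∀ n, IsOpen (A n) := by
    intro n
    rw [← isClosed_compl_iff]
    refine IsSeqClosed.isClosed fun u x hu hux => ?_
    simp only [A, mem_compl_iff, mem_ofPred_eq, not_lt] at hu ⊢
    exact h.meanSpeed_le_of_tendsto x.2.1 (fun n => (u n).2.1)
      ((continuous_subtype_val.tendsto x).comp hux) hu
  have hAd : ∀ n, Dense (A n) := by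
    intro n
    refine Metric.dense_iff.2 fun x δ hδ => ?_
    obtain ⟨b, hb, hbx, hbn⟩ := hlarge x x.2 δ hδ n
    exact ⟨⟨b, hb⟩, hbx, hbn⟩
  set η : ℕ → ℝ := fun n => 1 / ((n : ℝ) + 1) with hη
  have hηpos : ∀ n, 0 < η n := fun n => by positivity
  set P : ℕ → ℝ → ℝ → Prop := fun n r s => |s - r| < η n ∧
    μ {q | ENNReal.ofReal (η n) ≤ edist (slope (fun a => V a q) r s)
      (accel k μ (X r) (V r) (X r q) - γ • V r q)} ≤ ENNReal.ofReal (η n)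
  set O : ℕ → Set D := fun n =>
    {x | ∃ r ∈ Icc 0 T, ∃ s ∈ Icc 0 T, |r - x| < |s - r| ∧ P n r s} with hO
  have hOo : ∀ n, IsOpen (O n) := by
    intro n
    refine Metric.isOpen_iff.2 ?_
    rintro x ⟨r, hr, s, hs, hrs, hP⟩
    refine ⟨|s - r| - |r - x|, sub_pos.2 hrs, fun y hy => ⟨r, hr, s, hs, ?_, hP⟩⟩
    have h1 : |(y : ℝ) - x| < |s - r| - |r - x| := hy
    have h2 := abs_sub_le r (x : ℝ) y
    rw [abs_sub_comm (x : ℝ) y] at h2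
    linarith
  have hOd : ∀ n, Dense (O n) := by
    intro n
    refine Metric.dense_iff.2 fun x δ hδ => ?_
    obtain ⟨b, hb, hbx, hbn⟩ := hfin x x.2 δ hδ
    obtain ⟨s, hs, hsb, hsη, hm⟩ := h.exists_slope_close hT hb.1
      ((h.integrable_iff hb.1).2 hbn) (hηpos n)
    refine ⟨⟨b, hb⟩, hbx, b, hb.1, s, hs, ?_, hsη, hm⟩
    simpa using sub_ne_zero.2 hsb
  obtain ⟨x, hx⟩ := (dense_iInter_of_isOpen_nat (fun n => (hAo n).inter (hOo n))
    (fun n => (hAd n).inter_of_isOpen_left (hOd n) (hAo n))).nonempty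
  rw [mem_iInter] at hx
  have htop : meanSpeed μ V x = ⊤ := by
    by_contra hne
    obtain ⟨n, hn⟩ := ENNReal.exists_nat_gt hne
    exact (hx n).1.not_gt hn
  choose r hr s hs hrs hP using fun n => (hx n).2
  exact h.false_of_wild_sequence hk hγ0 x.2.1
    (fun hi => (h.integrable_iff x.2.1).1 hi htop) hr hs
    (tendsto_one_div_add_atTop_nhds_zero_nat (𝕜 := ℝ)) hrs (fun n => (hP n).1) fun n => (hP n).2

lemma IsFlow.exists_meanSpeed_le [Nontrivial E] (hk : LipWeight k L k₀) (hγ0 : 0 < γ)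
    (hγ : γ ≤ k₀) (h : IsFlow k γ T C μ X V) (hT : 0 < T) (h0 : meanSpeed μ V 0 ≠ ⊤) :
    ∃ N : ENNReal, N ≠ ⊤ ∧ ∀ t ∈ Icc 0 T, meanSpeed μ V t ≤ N := by
  have hk0 : 0 < k₀ := hγ0.trans_le hγ
  set τ := 1 / (8 * k₀)
  have hτ : 0 < τ := by positivity
  have hτ' : k₀ * τ = 1 / 8 := by simp only [τ]; field_simp
  have hreg := h.isRegularTime hk hγ0 hγ hT
  have hstep : ∀ j : ℕ, ∀ t ∈ Icc 0 T, t ≤ j * τ →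
      meanSpeed μ V t ≤ 3 ^ j * meanSpeed μ V 0 := by
    intro j
    induction j with
    | zero =>
      intro t ht htj
      rw [show t = 0 from le_antisymm (by simpa using htj) ht.1]
      simp
    | succ j ih =>
      intro t ht htj
      set a := max 0 (t - τ)
      have ha0 : 0 ≤ a := le_max_left _ _
      have hat : a ≤ t := max_le ht.1 (by linarith)
      have haj : a ≤ j * τ := max_le (by positivity) (by push_cast at htj; linarith)
      have hsub : Icc a t ⊆ Icc 0 T := Icc_subset_Icc ha0 ht.2
      calc meanSpeed μ V t ≤ 3 * meanSpeed μ V a :=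
            h.meanSpeed_le_of_regular hk hγ0.le hγ hsub
              ((mul_le_mul_of_nonneg_left (by linarith [le_max_right 0 (t - τ)]) hk0.le).trans
                hτ'.le)
              (fun s hs => hreg s (hsub (Ioo_subset_Icc_self hs))) ⟨le_rfl, hat⟩ ⟨hat, le_rfl⟩
        _ ≤ 3 * (3 ^ j * meanSpeed μ V 0) :=
            mul_le_mul_right (ih a ⟨ha0, hat.trans ht.2⟩ haj) _
        _ = _ := by rw [pow_succ', mul_assoc]
  obtain ⟨j, hj⟩ := exists_nat_ge (T / τ)
  refine ⟨3 ^ j * meanSpeed μ V 0, ENNReal.mul_ne_top (by simp) h0, fun t ht => hstep j t ht ?_⟩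
  rw [div_le_iff₀ hτ] at hj
  exact ht.2.trans hj

end Regular

section Comparison

open Filter Topology

lemma eq_add_integral_of_hasDerivWithinAt {F : Type*} [NormedAddCommGroup F] [NormedSpace ℝ F]
    [CompleteSpace F] [MeasurableSpace F] [BorelSpace F] [SecondCountableTopology F]
    {y f : ℝ → F} {T M : ℝ} (hT : 0 ≤ T)
    (hy : ∀ t ∈ Icc 0 T, HasDerivWithinAt y (f t) (Icc 0 T) t) (hf : ∀ t ∈ Icc 0 T, ‖f t‖ ≤ M) :
    IntervalIntegrable f volume 0 T ∧ ∀ t ∈ Icc 0 T, y t = y 0 + ∫ s in (0 : ℝ)..t, f s := by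
  have hd : ∀ t ∈ Ioo 0 T, HasDerivAt y (f t) t := fun t ht =>
    (hy t (Ioo_subset_Icc_self ht)).hasDerivAt (Icc_mem_nhds ht.1 ht.2)
  have hint : IntervalIntegrable f volume 0 T := by
    rw [intervalIntegrable_iff_integrableOn_Ioo_of_le hT]
    refine IntegrableOn.of_bound (C := M) (by simp) ?_ ?_
    · refine ((measurable_deriv y).aestronglyMeasurable (μ := volume.restrict (Ioo 0 T))).congr ?_
      filter_upwards [ae_restrict_mem measurableSet_Ioo] with t ht
      exact (hd t ht).deriv
    · filter_upwards [ae_restrict_mem measurableSet_Ioo] with t ht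
      exact hf t (Ioo_subset_Icc_self ht)
  refine ⟨hint, fun t ht => ?_⟩
  have hsub : Icc 0 t ⊆ Icc 0 T := Icc_subset_Icc_right ht.2
  rw [intervalIntegral.integral_eq_sub_of_hasDerivAt_of_le ht.1
    (fun s hs => ((hy s (hsub hs)).continuousWithinAt).mono hsub)
    (fun s hs => hd s ⟨hs.1, hs.2.trans_le ht.2⟩) (hint.mono_set ?_), add_sub_cancel]
  rwa [uIcc_of_le ht.1, uIcc_of_le hT]

variable {E : Type*} [NormedAddCommGroup E] [InnerProductSpace ℝ E] [FiniteDimensional ℝ E]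
  [MeasurableSpace E] [BorelSpace E] {k : ℝ → ℝ} {L k₀ γ T : ℝ} {C : NNReal}
  {μ : Measure (E × E)} [IsProbabilityMeasure μ] {X V U : ℝ → E × E → E}

omit [FiniteDimensional ℝ E] [BorelSpace E] [IsProbabilityMeasure μ] in
lemma IsApproxSol.mono {S : Set (E × E)} {R R' δ : ℝ} (h : IsApproxSol k γ T μ X U S R δ)
    (hR : R ≤ R') : IsApproxSol k γ T μ X U S R' δ :=
  { h with
    norm_X := fun t ht p hp => (h.norm_X t ht p hp).trans hR
    norm_U := fun t ht p hp => (h.norm_U t ht p hp).trans hR }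

omit [IsProbabilityMeasure μ] in
/-- A flow with bounded mean speed satisfies the integral equations for the rescaled velocities. -/
lemma IsFlow.exists_isApproxSol (hk : LipWeight k L k₀) (hγ : 0 ≤ γ)
    (h : IsFlow k γ T C μ X V) (hT : 0 ≤ T) {N : ENNReal} (hN : N ≠ ⊤)
    (hVN : ∀ t ∈ Icc 0 T, meanSpeed μ V t ≤ N) (P : ℝ) :
    ∃ R, IsApproxSol k γ T μ X (fun t p => Real.exp (γ * t) • V t p) (closedBall 0 P) R 0 := by
  have hk₀ := hk.k₀_nonneg
  have hint : ∀ t ∈ Icc 0 T, Integrable (V t) μ := fun t ht =>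
    (h.integrable_iff ht).2 ((hVN t ht).trans_lt hN.lt_top).ne
  set U : ℝ → E × E → E := fun t p => Real.exp (γ * t) • V t p with hU
  have hVU : ∀ t p, Real.exp (-(γ * t)) • U t p = V t p := fun t p => by
    simp only [hU, smul_smul, ← Real.exp_add]
    simp
  have hmean : ∀ t ∈ Icc 0 T, ∫ q, ‖V t q‖ ∂μ ≤ N.toReal := fun t ht => by
    rw [integral_norm_eq_lintegral_enorm (h.meas_V t ht)]
    exact ENNReal.toReal_mono hN (hVN t ht)
  set A := k₀ * (Real.exp (γ * T) * N.toReal) with hA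
  have hA0 : 0 ≤ A := by positivity
  have hacc : ∀ t ∈ Icc 0 T, ∀ x, ‖accel k μ (X t) (U t) x‖ ≤ A := by
    intro t ht x
    refine (norm_integral_le_of_norm_le (((hint t ht).norm.const_mul (Real.exp (γ * T))).const_mul
      k₀) (Eventually.of_forall fun q => ?_)).trans ?_
    · rw [norm_smul, Real.norm_of_nonneg (hk.nonneg _)]
      change _ * ‖Real.exp (γ * t) • V t q‖ ≤ k₀ * (Real.exp (γ * T) * ‖V t q‖)
      rw [norm_smul, Real.norm_of_nonneg (Real.exp_pos _).le]
      have h1 : Real.exp (γ * t) ≤ Real.exp (γ * T) :=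
        Real.exp_le_exp.2 (mul_le_mul_of_nonneg_left ht.2 hγ)
      exact mul_le_mul (hk.le _) (mul_le_mul_of_nonneg_right h1 (norm_nonneg _)) (by positivity) hk₀
    · rw [integral_const_mul, integral_const_mul]
      exact mul_le_mul_of_nonneg_left
        (mul_le_mul_of_nonneg_left (hmean t ht) (Real.exp_pos _).le) hk₀
  have hdU : ∀ p, ∀ t ∈ Icc 0 T, HasDerivWithinAt (fun s => U s p)
      (accel k μ (X t) (U t) (X t p)) (Icc 0 T) t := by
    intro p t ht
    have h1 : HasDerivAt (fun s : ℝ => Real.exp (γ * s)) (Real.exp (γ * t) * γ) t := by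
      simpa using ((hasDerivAt_id t).const_mul γ).exp
    refine (h1.hasDerivWithinAt.smul (h.deriv_V p t ht (hint t ht))).congr_deriv ?_
    rw [hU, accel_smul, smul_sub, mul_smul, sub_add_cancel]
  have hIU := fun p => eq_add_integral_of_hasDerivWithinAt hT (hdU p) (fun t ht => hacc t ht _)
  have hboundU : ∀ p ∈ closedBall (0 : E × E) P, ∀ t ∈ Icc 0 T, ‖U t p‖ ≤ P + A * T := by
    intro p hp t ht
    rw [(hIU p).2 t ht]
    refine (norm_add_le _ _).trans (add_le_add ?_ ?_)
    · have : U 0 p = p.2 := by simp [hU, (h.init p).2]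
      rw [this]
      exact (norm_snd_le p).trans (mem_closedBall_zero_iff.1 hp)
    · refine (intervalIntegral.norm_integral_le_of_norm_le_const (C := A) fun s hs => ?_).trans ?_
      · rw [uIoc_of_le ht.1] at hs
        exact hacc s ⟨hs.1.le, hs.2.trans ht.2⟩ _
      · rw [sub_zero, abs_of_nonneg ht.1]
        exact mul_le_mul_of_nonneg_left ht.2 hA0
  have hboundV : ∀ p ∈ closedBall (0 : E × E) P, ∀ t ∈ Icc 0 T, ‖V t p‖ ≤ P + A * T := by
    intro p hp t ht
    rw [← hVU t p, norm_smul, Real.norm_of_nonneg (Real.exp_pos _).le]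
    have h1 : Real.exp (-(γ * t)) ≤ 1 := Real.exp_le_one_iff.2 (neg_nonpos.2 (mul_nonneg hγ ht.1))
    exact (mul_le_of_le_one_left (norm_nonneg _) h1).trans (hboundU p hp t ht)
  have hIX := fun p (hp : p ∈ closedBall (0 : E × E) P) =>
    eq_add_integral_of_hasDerivWithinAt hT (h.deriv_X p) (hboundV p hp)
  have hboundX : ∀ p ∈ closedBall (0 : E × E) P, ∀ t ∈ Icc 0 T,
      ‖X t p‖ ≤ P + (P + A * T) * T := by
    intro p hp t ht
    rw [(hIX p hp).2 t ht]
    refine (norm_add_le _ _).trans (add_le_add ?_ ?_)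
    · rw [(h.init p).1]
      exact (norm_fst_le p).trans (mem_closedBall_zero_iff.1 hp)
    · refine (intervalIntegral.norm_integral_le_of_norm_le_const (C := P + A * T)
        fun s hs => ?_).trans ?_
      · rw [uIoc_of_le ht.1] at hs
        exact hboundV p hp s ⟨hs.1.le, hs.2.trans ht.2⟩
      · rw [sub_zero, abs_of_nonneg ht.1]
        exact mul_le_mul_of_nonneg_left ht.2 ((norm_nonneg _).trans (hboundV p hp t ht))
  refine ⟨max (P + (P + A * T) * T) (P + A * T), h.meas_X, fun t ht => (h.meas_V t ht).const_smul _,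
    fun t ht p hp => (hboundX p hp t ht).trans (le_max_left _ _),
    fun t ht p hp => (hboundU p hp t ht).trans (le_max_right _ _), fun p hp => ?_,
    fun p _ => (hIU p).1, fun p hp t ht => ?_, fun p hp t ht => ?_⟩
  · simp_rw [hVU]
    exact (hIX p hp).1
  · simp_rw [hVU]
    rw [(hIX p hp).2 t ht, (h.init p).1, dist_self]
  · have : U 0 p = p.2 := by simp [hU, (h.init p).2]
    change dist (U t p) _ ≤ 0
    rw [(hIU p).2 t ht, this, dist_self]

/-- Every flow coincides, on the support of the datum, with a given solution of the integral
equations whose spatial law charges thin rings little. -/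
lemma IsFlow.eq_of_isApproxSol [Nontrivial E] (hk : LipWeight k L k₀) (hγ0 : 0 < γ) (hγ : γ ≤ k₀)
    (hT : 0 < T) (h : IsFlow k γ T C μ X V) (h0 : meanSpeed μ V 0 ≠ ⊤)
    {X' U' : ℝ → E × E → E} {P R : ℝ} {B : NNReal}
    (h' : IsApproxSol k γ T μ X' U' (closedBall 0 P) R 0) (hS : ∀ᵐ p ∂μ, p ∈ closedBall 0 P)
    (hB : ∀ t ∈ Icc 0 T, DensityBound μ (fun p => (X' t p, U' t p)) B)
    {t : ℝ} (ht : t ∈ Icc 0 T) {p : E × E} (hp : p ∈ closedBall 0 P) :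
    X t p = X' t p ∧ V t p = Real.exp (-(γ * t)) • U' t p := by
  obtain ⟨N, hN, hVN⟩ := h.exists_meanSpeed_le hk hγ0 hγ hT h0
  obtain ⟨R₁, h₁⟩ := h.exists_isApproxSol hk hγ0.le hT.le hN hVN P
  have h₁' := h₁.mono (le_max_left R₁ R)
  have h₂ := h'.mono (le_max_right R₁ R)
  have hR : 0 ≤ max R₁ R := (norm_nonneg _).trans (h₂.norm_X t ht p hp)
  obtain ⟨c, hc, hring⟩ := exists_ringBound_of_densityBound E μ B hR hR
  have hd := h₂.dist_le hk hγ0.le h₁' hS hc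
    (fun s hs => hring _ _ (hB s hs) (hS.mono fun q hq => h₂.norm_X s hs q hq)
      (hS.mono fun q hq => h₂.norm_U s hs q hq)) ht hp
  simp only [add_zero, mul_zero, zero_mul] at hd
  refine ⟨(dist_le_zero.1 hd.1).symm, ?_⟩
  rw [dist_le_zero.1 hd.2, smul_smul, ← Real.exp_add]
  simp

end Comparison

section Uniqueness

open Filter Topology

variable {d : ℕ}

lemma aemeasurable_of_forall_bounded {Ω : Type*} [MeasurableSpace Ω] {μ : Measure Ω}
    {Y : Ω → EuclideanSpace ℝ (Fin d)} (h : ∀ α : EuclideanSpace ℝ (Fin d) → ℝ, Continuous α →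
      (∃ C, ∀ p, |α p| ≤ C) → AEMeasurable (fun q => α (Y q)) μ) : AEMeasurable Y μ := by
  have h1 : AEMeasurable (fun q => (Y q).ofLp) μ := by
    refine aemeasurable_pi_lambda _ fun i => ?_
    have h2 := h (fun p => Real.arctan (p i)) (by fun_prop) ⟨Real.pi / 2, fun p => abs_le.2
      ⟨(Real.neg_pi_div_two_lt_arctan _).le, (Real.arctan_lt_pi_div_two _).le⟩⟩
    have htan : Measurable Real.tan := by
      have : Real.tan = fun x => Real.sin x / Real.cos x := funext Real.tan_eq_sin_div_cos
      rw [this]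
      exact Real.measurable_sin.div Real.measurable_cos
    simpa [Function.comp_def, Real.tan_arctan] using htan.comp_aemeasurable h2
  exact (WithLp.measurable_toLp 2 (Fin d → ℝ)).comp_aemeasurable h1

lemma hasDensity_of_forall_integral {Ω : Type*} [MeasurableSpace Ω] {μ : Measure Ω}
    [IsProbabilityMeasure μ] {Z : Ω → EuclideanSpace ℝ (Fin d) × EuclideanSpace ℝ (Fin d)}
    {g : EuclideanSpace ℝ (Fin d) × EuclideanSpace ℝ (Fin d) → ℝ} (hg : Measurable g)
    (hg0 : ∀ p, 0 ≤ g p) (h1 : ∫ p, g p = 1)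
    (h : ∀ α : EuclideanSpace ℝ (Fin d) × EuclideanSpace ℝ (Fin d) → ℝ, Continuous α →
      (∃ C, ∀ p, |α p| ≤ C) → ∫ p, α p * g p = ∫ q, α (Z q) ∂μ) : HasDensity μ Z g := by
  have hgi : Integrable g := by
    by_contra hi
    rw [integral_undef hi] at h1
    exact zero_ne_one h1
  have hm : ∀ α : EuclideanSpace ℝ (Fin d) × EuclideanSpace ℝ (Fin d) → ℝ, Continuous α →
      (∃ C, ∀ p, |α p| ≤ C) → AEMeasurable (fun q => α (Z q)) μ := by
    rintro α hα ⟨C, hC⟩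
    have hpos : ∀ p, 1 ≤ α p + (C + 1) := fun p => by linarith [(abs_le.1 (hC p)).1]
    have h2 := h (fun p => α p + (C + 1)) (by fun_prop) ⟨C + (C + 1), fun p => by
      rw [abs_of_nonneg (zero_le_one.trans (hpos p))]
      linarith [(abs_le.1 (hC p)).2]⟩
    have h3 : 1 ≤ ∫ p, (α p + (C + 1)) * g p := by
      refine h1.ge.trans (integral_mono hgi ?_ fun p => le_mul_of_one_le_left (hg0 p) (hpos p))
      refine hgi.bdd_mul (c := C + (C + 1)) (by fun_prop) (Eventually.of_forall fun p => ?_)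
      rw [Real.norm_of_nonneg (zero_le_one.trans (hpos p))]
      linarith [(abs_le.1 (hC p)).2]
    have h4 : Integrable (fun q => α (Z q) + (C + 1)) μ := by
      by_contra hi
      rw [h2, integral_undef hi] at h3
      linarith
    simpa using h4.aemeasurable.sub_const (C + 1)
  have hZ : AEMeasurable Z μ := by
    refine AEMeasurable.prodMk (f := fun q => (Z q).1) (g := fun q => (Z q).2) ?_ ?_
    · exact aemeasurable_of_forall_bounded fun α hα ⟨C, hC⟩ =>
        hm (fun p => α p.1) (by fun_prop) ⟨C, fun p => hC p.1⟩
    · exact aemeasurable_of_forall_bounded fun α hα ⟨C, hC⟩ =>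
        hm (fun p => α p.2) (by fun_prop) ⟨C, fun p => hC p.2⟩
  refine ⟨hZ, hg, hg0, ?_⟩
  have := Measure.isProbabilityMeasure_map hZ
  have := isProbabilityMeasure_withDensity_ofReal hg0 h1
  refine ext_of_forall_integral_eq_of_IsFiniteMeasure fun α => ?_
  rw [integral_map hZ α.continuous.aestronglyMeasurable, integral_withDensity_ofReal hg0 hg]
  exact (h α α.continuous ⟨‖α‖, fun p => α.norm_coe_le_norm p⟩).symm

lemma HasDensity.densityBound {Ω F : Type*} [MeasurableSpace Ω] [MeasureSpace F] {μ : Measure Ω}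
    {Z : Ω → F} {g : F → ℝ} (h : HasDensity μ Z g) {C : ℝ} (hC : ∀ᵐ p, g p ≤ C) :
    DensityBound μ Z C.toNNReal := by
  intro S hS
  rw [← Measure.map_apply_of_aemeasurable h.meas hS, h.map_eq, withDensity_apply _ hS,
    ← setLIntegral_const]
  refine lintegral_mono_ae (ae_restrict_of_ae ?_)
  filter_upwards [hC] with p hp
  exact ENNReal.ofReal_le_ofReal hp

variable {k K : ℝ → ℝ} {L k₀ k₁ γ T : ℝ}
  {f₀ : EuclideanSpace ℝ (Fin d) × EuclideanSpace ℝ (Fin d) → ℝ}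
  {μ : Measure (EuclideanSpace ℝ (Fin d) × EuclideanSpace ℝ (Fin d))}

/-- A weak solution is transported by a flow of the alignment system. -/
lemma IsWeakSolCS.exists_isFlow [Nontrivial (EuclideanSpace ℝ (Fin d))] [IsProbabilityMeasure μ]
    (hk : LipWeight k L k₀) (hk₁ : 0 < k₁) (hk₁' : ∀ z, k₁ ≤ k z)
    (hKk : ∀ z ∈ Icc (0 : ℝ) 1, K z = k z) (hγ : γ = ∫ z in (0 : ℝ)..1, k z)
    (hf₀ : Measurable f₀) (hf₀' : ∀ p, 0 ≤ f₀ p)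
    (hμ : μ = volume.withDensity fun p => ENNReal.ofReal (f₀ p))
    {g : ℝ → EuclideanSpace ℝ (Fin d) × EuclideanSpace ℝ (Fin d) → ℝ}
    (h : IsWeakSolCS K T f₀ g) :
    ∃ (C : NNReal) (X V : ℝ → EuclideanSpace ℝ (Fin d) × EuclideanSpace ℝ (Fin d) →
      EuclideanSpace ℝ (Fin d)), IsFlow k γ T C μ X V ∧
        ∀ t ∈ Icc 0 T, HasDensity μ (fun p => (X t p, V t p)) (g t) := by
  obtain ⟨hg, ⟨C, hC⟩, -, Z, hZ0, hZd, hZ⟩ := h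
  have hD : ∀ t ∈ Icc 0 T, HasDensity μ (Z t) (g t) := fun t ht =>
    hasDensity_of_forall_integral (hg t ht).1 (hg t ht).2.1 (hg t ht).2.2 fun α hα hαb => by
      rw [hZ t ht α hα hαb, hμ, integral_withDensity_ofReal hf₀' hf₀]
  refine ⟨C.toNNReal, fun t p => (Z t p).1, fun t p => (Z t p).2,
    ⟨fun t ht => (hD t ht).meas.fst.aestronglyMeasurable,
      fun t ht => (hD t ht).meas.snd.aestronglyMeasurable,
      fun t ht => (hD t ht).densityBound (hC t ht), fun p => by simp [hZ0],
      fun p t ht => (hZd p t ht).1, fun p t ht hi => ?_, fun p t ht hi => ?_⟩, hD⟩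
  · have h1 := (hZd p t ht).2
    rwa [HasDensity.Wfield_eq (X := fun p => (Z t p).1) (V := fun p => (Z t p).2)
      hk hKk hγ (hD t ht) hi] at h1
  · have h1 := (hZd p t ht).2
    rwa [HasDensity.Wfield_eq_zero (X := fun p => (Z t p).1) (V := fun p => (Z t p).2)
      hk hk₁ hk₁' hKk (hD t ht) hi] at h1

/-- Well-posedness in positive dimension, for a weight defined on the whole line. -/
theorem wellPosed_of_nontrivial [Nontrivial (EuclideanSpace ℝ (Fin d))] (hk : LipWeight k L k₀)
    (hk₁ : 0 < k₁) (hk₁' : ∀ z, k₁ ≤ k z)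
    (hKk : ∀ z ∈ Icc (0 : ℝ) 1, K z = k z) (hγ : γ = ∫ z in (0 : ℝ)..1, k z) (hT : 0 < T)
    {Rx Rv B : ℝ} (hRx : 0 ≤ Rx) (hRv : 0 ≤ Rv) (hB0 : 0 ≤ B)
    (hf₀ : Measurable f₀) (hf₀' : ∀ p, 0 ≤ f₀ p) (h1 : ∫ p, f₀ p = 1) (hB : ∀ᵐ p, f₀ p ≤ B)
    (hsupp : ∀ p, f₀ p ≠ 0 → p ∈ closedBall (0 : EuclideanSpace ℝ (Fin d)) Rx ×ˢ
      closedBall (0 : EuclideanSpace ℝ (Fin d)) Rv) :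
    ∃ f : ℝ → EuclideanSpace ℝ (Fin d) × EuclideanSpace ℝ (Fin d) → ℝ,
      IsWeakSolCS K T f₀ f ∧
      (∀ t ∈ Icc 0 T, ∀ p, f t p ≠ 0 →
        p ∈ closedBall (0 : EuclideanSpace ℝ (Fin d)) (Rx + t * Rv) ×ˢ
          closedBall (0 : EuclideanSpace ℝ (Fin d)) Rv) ∧
      (∀ t ∈ Icc 0 T, ∀ᵐ p, f t p ≤ B * Real.exp (d * γ * t)) ∧
      (∀ g : ℝ → EuclideanSpace ℝ (Fin d) × EuclideanSpace ℝ (Fin d) → ℝ,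
        IsWeakSolCS K T f₀ g → ∀ t ∈ Icc 0 T, g t =ᵐ[volume] f t) := by
  have hkint : IntervalIntegrable k volume 0 1 := hk.continuous.intervalIntegrable _ _
  have hγ0 : 0 < γ := by
    have := intervalIntegral.integral_mono_on zero_le_one
      (intervalIntegrable_const (c := k₁)) hkint fun z _ => hk₁' z
    rw [intervalIntegral.integral_const, ← hγ] at this
    simp only [sub_zero, one_smul] at this
    linarith
  have hγk : γ ≤ k₀ := by
    have := intervalIntegral.integral_mono_on zero_le_one hkint
      (intervalIntegrable_const (c := k₀)) fun z _ => hk.le z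
    rw [intervalIntegral.integral_const, ← hγ] at this
    simpa using this
  obtain ⟨μ, hμ⟩ : ∃ μ, μ = volume.withDensity fun p => ENNReal.ofReal (f₀ p) := ⟨_, rfl⟩
  have hprob : IsProbabilityMeasure μ := hμ ▸ isProbabilityMeasure_withDensity_ofReal hf₀' h1
  have hdat : IsDatum μ B.toNNReal Rx Rv := hμ ▸ isDatum_withDensity hRx hRv hf₀ hB hsupp
  obtain ⟨f, X, U, hsol, hsup, hbd, hD, hDB, hA⟩ :=
    exists_weakSol hk hKk hγ hγ0.le hT hRx hRv hB0 hf₀ hf₀' h1 hB hsupp hμ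
  refine ⟨f, hsol, hsup, hbd, fun g hg t ht => ?_⟩
  obtain ⟨C, X', V', hF, hgD⟩ := hg.exists_isFlow hk hk₁ hk₁' hKk hγ hf₀ hf₀' hμ
  have hS : ∀ᵐ p ∂μ, p ∈ closedBall
      (0 : EuclideanSpace ℝ (Fin d) × EuclideanSpace ℝ (Fin d)) (max Rx Rv) := by
    filter_upwards [hdat.supp] with p hp
    rw [mem_closedBall_zero_iff, Prod.norm_def]
    exact max_le_max (mem_closedBall_zero_iff.1 hp.1) (mem_closedBall_zero_iff.1 hp.2)
  have h0 : meanSpeed μ V' 0 ≠ ⊤ := by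
    refine ((lintegral_mono_ae (g := fun _ => ENNReal.ofReal Rv) ?_).trans_lt ?_).ne
    · filter_upwards [hdat.supp] with p hp
      rw [(hF.init p).2, ← ofReal_norm]
      exact ENNReal.ofReal_le_ofReal (mem_closedBall_zero_iff.1 hp.2)
    · simp
  refine (hgD t ht).ae_eq (hD t ht) ?_
  filter_upwards [hS] with p hp
  obtain ⟨e1, e2⟩ := hF.eq_of_isApproxSol hk hγ0 hγk hT h0 hA hS hDB ht hp
  rw [e1, e2]

/-- In dimension zero the phase space is a point and nothing moves. -/
lemma wellPosed_of_subsingleton [Subsingleton (EuclideanSpace ℝ (Fin d))]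
    {Rx Rv B : ℝ} (hRx : 0 ≤ Rx) (hRv : 0 ≤ Rv)
    (hf₀ : Measurable f₀) (hf₀' : ∀ p, 0 ≤ f₀ p) (h1 : ∫ p, f₀ p = 1) (hB : ∀ᵐ p, f₀ p ≤ B) :
    IsWeakSolCS K T f₀ (fun _ => f₀) ∧
      (∀ t ∈ Icc 0 T, ∀ p, f₀ p ≠ 0 →
        p ∈ closedBall (0 : EuclideanSpace ℝ (Fin d)) (Rx + t * Rv) ×ˢ
          closedBall (0 : EuclideanSpace ℝ (Fin d)) Rv) ∧
      (∀ g : ℝ → EuclideanSpace ℝ (Fin d) × EuclideanSpace ℝ (Fin d) → ℝ,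
        IsWeakSolCS K T f₀ g → ∀ t ∈ Icc 0 T, g t =ᵐ[volume] f₀) := by
  have hconst : ∀ {c w : EuclideanSpace ℝ (Fin d)} {t : ℝ},
      HasDerivWithinAt (fun _ => c) w (Icc 0 T) t := fun {c w t} =>
    (hasDerivWithinAt_const t (Icc 0 T) c).congr_deriv (Subsingleton.elim _ _)
  refine ⟨⟨fun t _ => ⟨hf₀, hf₀', h1⟩, ⟨B, fun t _ => hB⟩, fun α _ _ => continuousOn_const,
    fun _ p => p, fun p => rfl, fun p t _ => ⟨hconst, hconst⟩, fun t _ α _ _ => rfl⟩,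
    fun t ht p _ => ?_, fun g hg t ht => Eventually.of_forall fun p => ?_⟩
  · rw [Subsingleton.elim p (0, 0)]
    exact ⟨mem_closedBall_self (add_nonneg hRx (mul_nonneg ht.1 hRv)), mem_closedBall_self hRv⟩
  · have hp : ∀ φ : EuclideanSpace ℝ (Fin d) × EuclideanSpace ℝ (Fin d) → ℝ,
        ∫ q, φ q = volume.real (univ : Set (EuclideanSpace ℝ (Fin d) ×
          EuclideanSpace ℝ (Fin d))) * φ p := fun φ => by
      rw [show φ = fun _ => φ p from funext fun q => congrArg φ (Subsingleton.elim q p)]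
      simp
    have h2 := (hg.1 t ht).2.2
    rw [hp, ← h1, hp] at h2
    refine mul_left_cancel₀ (fun h0 => ?_) h2
    rw [hp, h0, zero_mul] at h1
    exact zero_ne_one h1

lemma lipWeight_projIcc {LK : NNReal} (hKpos : ∀ z ∈ Icc (0 : ℝ) 1, 0 < K z)
    (hKanti : AntitoneOn K (Icc (0 : ℝ) 1)) (hKlip : LipschitzOnWith LK K (Icc (0 : ℝ) 1)) :
    LipWeight (fun z => K (projIcc 0 1 zero_le_one z)) LK (K 0) where
  nonneg z := (hKpos _ (projIcc 0 1 _ z).2).le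
  le z := hKanti ⟨le_rfl, zero_le_one⟩ (projIcc 0 1 _ z).2 (projIcc 0 1 _ z).2.1
  L_nonneg := LK.2
  lip a b := by
    rw [← Real.dist_eq]
    refine (hKlip.dist_le_mul _ (projIcc 0 1 zero_le_one a).2 _
      (projIcc 0 1 zero_le_one b).2).trans ?_
    refine mul_le_mul_of_nonneg_left ?_ LK.2
    have := (LipschitzWith.projIcc (zero_le_one' ℝ)).dist_le_mul a b
    simpa [Subtype.dist_eq, Real.dist_eq] using this

end Uniqueness

/-- For a compactly supported bounded probability density `f₀` and
`T > 0`, there exists a unique weakly continuous family of bounded probability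
densities solving the topological Cucker–Smale equation with initial datum `f₀`;
moreover `supp f_t ⊂ B_{R_x+tR_v} × B_{R_v}` and `‖f_t‖_∞ ≤ ‖f₀‖_∞ e^{dγt}`, where
`γ = ∫₀¹ K`. -/
theorem topological_CS_equation_wellposedness {d : ℕ} (K : ℝ → ℝ)
    (hKpos : ∀ z ∈ Set.Icc (0:ℝ) 1, 0 < K z)
    (hKanti : AntitoneOn K (Set.Icc (0:ℝ) 1))
    (LK : NNReal) (hKlip : LipschitzOnWith LK K (Set.Icc (0:ℝ) 1))
    (Rx Rv T B : ℝ) (hRx : 0 < Rx) (hRv : 0 < Rv) (hT : 0 < T) (hB : 0 < B)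
    (f₀ : EuclideanSpace ℝ (Fin d) × EuclideanSpace ℝ (Fin d) → ℝ)
    (hf₀meas : Measurable f₀) (hf₀nonneg : ∀ p, 0 ≤ f₀ p) (hf₀int : (∫ p, f₀ p) = 1)
    (hf₀bdd : ∀ᵐ p ∂volume, f₀ p ≤ B)
    (hf₀supp : ∀ p, f₀ p ≠ 0 → p ∈ closedBall (0 : EuclideanSpace ℝ (Fin d)) Rx ×ˢ
      closedBall (0 : EuclideanSpace ℝ (Fin d)) Rv) :
    ∃ f : ℝ → EuclideanSpace ℝ (Fin d) × EuclideanSpace ℝ (Fin d) → ℝ,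
      IsWeakSolCS K T f₀ f ∧
      (∀ t ∈ Set.Icc 0 T, ∀ p, f t p ≠ 0 →
        p ∈ closedBall (0 : EuclideanSpace ℝ (Fin d)) (Rx + t * Rv) ×ˢ
          closedBall (0 : EuclideanSpace ℝ (Fin d)) Rv) ∧
      (∀ t ∈ Set.Icc 0 T, ∀ᵐ p ∂volume,
        f t p ≤ B * Real.exp (d * (∫ z in (0:ℝ)..1, K z) * t)) ∧
      (∀ g : ℝ → EuclideanSpace ℝ (Fin d) × EuclideanSpace ℝ (Fin d) → ℝ,
        IsWeakSolCS K T f₀ g → ∀ t ∈ Set.Icc 0 T, g t =ᵐ[volume] f t) := by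
  rcases Nat.eq_zero_or_pos d with rfl | hd
  · obtain ⟨h1, h2, h3⟩ := wellPosed_of_subsingleton (K := K) (T := T) hRx.le hRv.le hf₀meas
      hf₀nonneg hf₀int hf₀bdd
    exact ⟨fun _ => f₀, h1, h2, fun t _ => by simpa using hf₀bdd, h3⟩
  · have : Nonempty (Fin d) := ⟨⟨0, hd⟩⟩
    have hKk : ∀ z ∈ Icc (0 : ℝ) 1, K z = K (projIcc 0 1 zero_le_one z) := fun z hz => by
      rw [projIcc_of_mem zero_le_one hz]
    refine wellPosed_of_nontrivial (lipWeight_projIcc hKpos hKanti hKlip)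
      (hKpos 1 ⟨zero_le_one, le_rfl⟩)
      (fun z => hKanti (projIcc 0 1 zero_le_one z).2 ⟨zero_le_one, le_rfl⟩
        (projIcc 0 1 zero_le_one z).2.2) hKk
      (intervalIntegral.integral_congr fun z hz => ?_) hT hRx.le hRv.le hB.le hf₀meas
      hf₀nonneg hf₀int hf₀bdd hf₀supp
    rw [uIcc_of_le zero_le_one] at hz
    exact hKk z hz
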